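/- arXiv:1305.7376 — 2 statements merged into one kernel-verified Lean document; each statement's English description precedes it below -/
import Mathlib

section
/- For every integer h > 5 there is a constant c > 0 (depending only on h, with c = 2^{O(h^2)}) such that: for every graph H on h vertices with pathwidth at most 2 and every graph G, if k = pack_H(G) is the maximum number of pairwise disjoint models of H in G, then cover_H(G) ≤ c · k^2 · log(2k). In other words, every graph of pathwidth at most 2 has the Erdős–Pósa property with gap f_H(k) = 2^{O(h^2)} · k^2 · log k. -/
open SimpleGraph

/-- A minor model of `H` in `G`: pairwise disjoint branch sets `B v ⊆ V(G)`, each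
inducing a connected (hence nonempty) subgraph of `G`, such that for every edge
`{u,v}` of `H` there is an edge of `G` between `B u` and `B v`. -/
def IsMinorModel {β α : Type*} (H : SimpleGraph β) (G : SimpleGraph α)
    (B : β → Set α) : Prop :=
  (∀ u, (G.induce (B u)).Connected) ∧
  (Pairwise fun u v => Disjoint (B u) (B v)) ∧
  (∀ u v, H.Adj u v → ∃ a ∈ B u, ∃ b ∈ B v, G.Adj a b)

/-- `H` is a minor of `G`. -/
def IsMinor {β α : Type*} (H : SimpleGraph β) (G : SimpleGraph α) : Prop :=
  ∃ B : β → Set α, IsMinorModel H G B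

/-- `G` contains `k` models of `H` whose vertex sets are pairwise disjoint
(equivalently, the disjoint union of `k` copies of `H` is a minor of `G`). -/
def HasDisjointModels {β α : Type*} (H : SimpleGraph β) (G : SimpleGraph α) (k : ℕ) : Prop :=
  ∃ M : Fin k → β → Set α, (∀ i, IsMinorModel H G (M i)) ∧
    Pairwise fun i j => Disjoint (⋃ u, M i u) (⋃ u, M j u)

/-- `pack_H(G)`: the maximum number of pairwise disjoint models of `H` in `G`. -/
noncomputable def packNumber {β α : Type*} (H : SimpleGraph β) (G : SimpleGraph α) : ℕ :=
  sSup {k | HasDisjointModels H G k}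

/-- `S` meets every model of `H` in `G`. -/
def IsHittingSet {β α : Type*} (H : SimpleGraph β) (G : SimpleGraph α) (S : Set α) : Prop :=
  ∀ B : β → Set α, IsMinorModel H G B → ∃ a ∈ S, ∃ u, a ∈ B u

/-- `cover_H(G)`: the minimum size of a set of vertices meeting every model of `H` in `G`. -/
noncomputable def coverNumber {β α : Type*} (H : SimpleGraph β) (G : SimpleGraph α) : ℕ :=
  sInf {n | ∃ S : Set α, IsHittingSet H G S ∧ S.ncard = n}

/-- A tree/path decomposition of `G` with underlying graph `T` and bags `X`. -/
def IsTreeDecomp {α ι : Type*} (G : SimpleGraph α) (T : SimpleGraph ι) (X : ι → Set α) : Prop :=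
  (∀ v, ∃ t, v ∈ X t) ∧
  (∀ u v, G.Adj u v → ∃ t, u ∈ X t ∧ v ∈ X t) ∧
  (∀ v, (T.induce {t | v ∈ X t}).Connected)

/-- The treewidth of `G`: the minimum width of a tree decomposition of `G`. -/
noncomputable def treewidth {α : Type*} (G : SimpleGraph α) : ℕ :=
  sInf {w | ∃ (ι : Type) (T : SimpleGraph ι) (X : ι → Set α),
    T.IsTree ∧ IsTreeDecomp G T X ∧ ∀ t, (X t).ncard ≤ w + 1}

/-- The pathwidth of `G`: the minimum width of a tree decomposition whose
underlying tree is a path. -/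
noncomputable def pathwidth {α : Type*} (G : SimpleGraph α) : ℕ :=
  sInf {w | ∃ (n : ℕ) (X : Fin (n+1) → Set α),
    IsTreeDecomp G (pathGraph (n+1)) X ∧ ∀ t, (X t).ncard ≤ w + 1}

/-- The degeneracy of `G`: the maximum over all (nonempty) subgraphs of `G`
of the minimum degree. -/
noncomputable def degeneracy {α : Type*} (G : SimpleGraph α) : ℕ :=
  sSup {d | ∃ G' : G.Subgraph, G'.verts.Nonempty ∧ ∀ v ∈ G'.verts, d ≤ (G'.neighborSet v).ncard}

/-- The contraction degeneracy of `G`: the maximum over all (nonempty) minors of `G`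
of the minimum degree. -/
noncomputable def contractionDegeneracy {α : Type*} (G : SimpleGraph α) : ℕ :=
  sSup {d | ∃ (n : ℕ) (H : SimpleGraph (Fin n)), 0 < n ∧ IsMinor H G ∧
    ∀ v, d ≤ (H.neighborSet v).ncard}


/-- `X` and `Y` are externally `q`-connected within the vertex set `W` of `G`:
for all disjoint `X' ⊆ X`, `Y' ⊆ Y` with `|X'| = |Y'| ≤ q` there are `|X'|`
pairwise disjoint `X'`–`Y'` paths (inside `W`) having no internal vertices and
no edges in `G[X ∪ Y]`. -/
def ExternallyConnectedIn {α : Type*} (G : SimpleGraph α) (W X Y : Set α) (q : ℕ) : Prop :=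
  ∀ X' Y' : Finset α, ↑X' ⊆ X → ↑Y' ⊆ Y → Disjoint (X' : Set α) (Y' : Set α) →
    X'.card = Y'.card → X'.card ≤ q →
    ∃ p : (x : X') → Σ y : Y', G.Walk x.1 y.1,
      (∀ x, (p x).2.IsPath) ∧
      (∀ x, ∀ v ∈ (p x).2.support, v ∈ W) ∧
      (Pairwise fun x₁ x₂ => ∀ v, v ∈ (p x₁).2.support → v ∉ (p x₂).2.support) ∧
      (∀ x, ∀ v ∈ (p x).2.support.tail.dropLast, v ∉ X ∪ Y) ∧
      (∀ x, ∀ u v : α, s(u, v) ∈ (p x).2.edges → ¬(u ∈ X ∪ Y ∧ v ∈ X ∪ Y))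

/-- `(A, B)` is a `q`-mesh of order `s` in `G`. -/
def IsMesh {α : Type*} (G : SimpleGraph α) (A B : Set α) (q s : ℕ) : Prop :=
  A ∪ B = Set.univ ∧
  ∃ T : G.Subgraph, T.verts ⊆ A ∧ T.coe.IsTree ∧
    (∀ v ∈ T.verts, (T.neighborSet v).ncard ≤ 3) ∧
    A ∩ B ⊆ T.verts ∧
    (∀ v ∈ A ∩ B, (T.neighborSet v).ncard ≤ 2) ∧
    (∃ v ∈ A ∩ B, (T.neighborSet v).ncard = 1) ∧
    (A ∩ B).ncard = s ∧
    ExternallyConnectedIn G B (A ∩ B) (A ∩ B) q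

/-- The graph `Ξ_r`, with vertices `x_i = (0,i)`, `y_i = (1,i)`, `z_i = (2,i)`. -/
def Xi (r : ℕ) : SimpleGraph (Fin 3 × Fin r) :=
  SimpleGraph.fromRel (fun a b =>
    (a.1 = 0 ∧ b.1 = 0 ∧ (b.2 : ℕ) = (a.2 : ℕ) + 1) ∨
    (a.1 = 2 ∧ b.1 = 2 ∧ (b.2 : ℕ) = (a.2 : ℕ) + 1) ∨
    (a.1 = 1 ∧ a.2 = b.2 ∧ (b.1 = 0 ∨ b.1 = 2)))

/-- The underlying simple bipartite graph of the bipartite multigraph with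
parts `α`, `β` and multiplicity function `m`. -/
def bipMulti {α β : Type*} (m : α → β → ℕ) : SimpleGraph (α ⊕ β) :=
  SimpleGraph.fromRel (fun x y => match x, y with
    | Sum.inl v, Sum.inr u => 1 ≤ m v u
    | _, _ => False)


namespace SimpleGraph

variable {α ι : Type*}

/-- `G.ReachIn Z a b` means that `a` and `b` are joined by a walk of `G` all of whose vertices
lie in `Z`. -/
inductive ReachIn (G : SimpleGraph α) (Z : Set α) : α → α → Prop
  | refl {a : α} : a ∈ Z → ReachIn G Z a a
  | cons {a b c : α} : a ∈ Z → G.Adj a b → ReachIn G Z b c → ReachIn G Z a c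

namespace ReachIn

variable {G G' : SimpleGraph α} {Z Z' T : Set α} {a b c : α}

lemma left_mem (h : G.ReachIn Z a b) : a ∈ Z := by cases h <;> assumption

lemma right_mem (h : G.ReachIn Z a b) : b ∈ Z := by
  induction h <;> assumption

lemma trans (h : G.ReachIn Z a b) (h' : G.ReachIn Z b c) : G.ReachIn Z a c := by
  induction h with
  | refl => exact h'
  | cons ha hab _ ih => exact .cons ha hab (ih h')

lemma snoc (h : G.ReachIn Z a b) (hbc : G.Adj b c) (hc : c ∈ Z) : G.ReachIn Z a c :=
  h.trans (.cons h.right_mem hbc (.refl hc))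

lemma symm (h : G.ReachIn Z a b) : G.ReachIn Z b a := by
  induction h with
  | refl ha => exact .refl ha
  | cons ha hab _ ih => exact ih.snoc hab.symm ha

lemma mono_of_adj (h : G.ReachIn Z a b) (hZ : Z ⊆ Z')
    (hG : ∀ u ∈ Z, ∀ v ∈ Z, G.Adj u v → G'.Adj u v) : G'.ReachIn Z' a b := by
  induction h with
  | refl ha => exact .refl (hZ ha)
  | cons ha hab h ih => exact .cons (hZ ha) (hG _ ha _ h.left_mem hab) ih

lemma mono (h : G.ReachIn Z a b) (hZ : Z ⊆ Z') : G.ReachIn Z' a b :=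
  h.mono_of_adj hZ fun _ _ _ _ h => h

lemma restrict (h : G.ReachIn Z a b) : G.ReachIn {v | G.ReachIn Z a v} a b := by
  have key : ∀ {c d}, G.ReachIn Z c d → G.ReachIn Z a c →
      G.ReachIn {v | G.ReachIn Z a v} c d := by
    intro c d hcd
    induction hcd with
    | refl => exact fun hac => .refl hac
    | cons _ hadj hd ih => exact fun hac => .cons hac hadj (ih (hac.snoc hadj hd.left_mem))
  exact key h (.refl h.left_mem)

/-- A walk ending in `T` starts in `T` or has a first vertex in `T`. -/
lemma first_mem (h : G.ReachIn Z a b) (hb : b ∈ T) :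
    a ∈ T ∨ ∃ y t, G.ReachIn (Z \ T) a y ∧ G.Adj y t ∧ t ∈ Z ∧ t ∈ T := by
  induction h with
  | refl => exact .inl hb
  | @cons a b c ha hab h ih =>
    by_cases haT : a ∈ T
    · exact .inl haT
    right
    rcases ih hb with hbT | ⟨y, t, hy, h1, h2, h3⟩
    · exact ⟨a, b, .refl ⟨ha, haT⟩, hab, h.left_mem, hbT⟩
    · exact ⟨y, t, .cons ⟨ha, haT⟩ hab hy, h1, h2, h3⟩

lemma closed (h : G.ReachIn Z a b) (ha : a ∈ T)
    (hT : ∀ u ∈ T, ∀ v ∈ Z, G.Adj u v → v ∈ T) : b ∈ T := by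
  induction h with
  | refl => exact ha
  | cons _ hab h ih => exact ih (hT _ ha _ h.left_mem hab)

end ReachIn

lemma connected_induce_of_reachIn {G : SimpleGraph α} {Z : Set α} {a : α} (ha : a ∈ Z)
    (h : ∀ b ∈ Z, G.ReachIn Z a b) : (G.induce Z).Connected := by
  have key : ∀ {b c}, G.ReachIn Z b c → ∀ (hb : b ∈ Z) (hc : c ∈ Z),
      (G.induce Z).Reachable ⟨b, hb⟩ ⟨c, hc⟩ := by
    intro b c hbc
    induction hbc with
    | refl => exact fun _ _ => .rfl
    | cons _ hab h ih =>
      intro hb hc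
      have hadj : (G.induce Z).Adj ⟨_, hb⟩ ⟨_, h.left_mem⟩ := by simpa using hab
      exact hadj.reachable.trans (ih _ hc)
  have : Nonempty Z := ⟨⟨a, ha⟩⟩
  exact ⟨fun u v => ((key (h u u.2) ha u.2).symm).trans (key (h v v.2) ha v.2)⟩

lemma Connected.reachIn {G : SimpleGraph α} {Z : Set α} (h : (G.induce Z).Connected)
    {a b : α} (ha : a ∈ Z) (hb : b ∈ Z) : G.ReachIn Z a b := by
  obtain ⟨p⟩ := h.preconnected ⟨a, ha⟩ ⟨b, hb⟩
  have key : ∀ {u v : Z}, (G.induce Z).Walk u v → G.ReachIn Z u v := by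
    intro u v p
    induction p with
    | nil => exact .refl (Subtype.coe_prop _)
    | cons hab _ ih => exact .cons (Subtype.coe_prop _) (by simpa using hab) ih
  exact key p

lemma connected_induce_setOf_reachIn {G : SimpleGraph α} {Z : Set α} {a : α} (ha : a ∈ Z) :
    (G.induce {v | G.ReachIn Z a v}).Connected :=
  connected_induce_of_reachIn (a := a) (.refl ha) fun _ hb => ReachIn.restrict hb

/-- The union of connected sets indexed by a connected set of a graph `L`, with an edge of `G`
for each edge of `L`, is connected. -/
lemma connected_induce_biUnion {L : SimpleGraph ι} {G : SimpleGraph α} {M : ι → Set α}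
    {D : Set ι} (hD : (L.induce D).Connected) (hM : ∀ s ∈ D, (G.induce (M s)).Connected)
    (hadj : ∀ s t, L.Adj s t → ∃ a ∈ M s, ∃ b ∈ M t, G.Adj a b) :
    (G.induce (⋃ s ∈ D, M s)).Connected := by
  have sub : ∀ s ∈ D, M s ⊆ ⋃ s ∈ D, M s := fun s hs => Set.subset_biUnion_of_mem hs
  have key : ∀ {s t}, L.ReachIn D s t → ∀ a ∈ M s, ∀ b ∈ M t,
      G.ReachIn (⋃ s ∈ D, M s) a b := by
    intro s t h
    induction h with
    | refl hs => exact fun a ha b hb => ((hM _ hs).reachIn ha hb).mono (sub _ hs)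
    | cons hs hst h ih =>
      intro a ha b hb
      obtain ⟨x, hx, y, hy, hxy⟩ := hadj _ _ hst
      exact (((hM _ hs).reachIn ha hx).mono (sub _ hs)).trans
        (.cons (sub _ hs hx) hxy (ih y hy b hb))
  obtain ⟨s, hs⟩ := hD.nonempty
  obtain ⟨a, ha⟩ := (hM s hs).nonempty
  refine connected_induce_of_reachIn (sub s hs ha) fun b hb => ?_
  obtain ⟨t, ht, hbt⟩ := Set.mem_iUnion₂.1 hb
  exact key (hD.reachIn hs ht) a ha b hbt

end SimpleGraph

namespace SimpleGraph

variable {α : Type*}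

/-- There are `n` pairwise disjoint connections from `A` to `B` in `G`. -/
def HasLinkage (G : SimpleGraph α) (A B : Set α) (n : ℕ) : Prop :=
  ∃ (a b : Fin n → α) (Q : Fin n → Set α), (∀ i, a i ∈ A) ∧ (∀ i, b i ∈ B) ∧
    (∀ i, G.ReachIn (Q i) (a i) (b i)) ∧ ∀ i j, i ≠ j → Disjoint (Q i) (Q j)

lemma HasLinkage.mono {G G' : SimpleGraph α} {A B : Set α} {n : ℕ} (h : G.HasLinkage A B n)
    (hG : G ≤ G') : G'.HasLinkage A B n := by
  obtain ⟨a, b, Q, ha, hb, hQ, hd⟩ := h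
  exact ⟨a, b, Q, ha, hb, fun i => (hQ i).mono_of_adj subset_rfl fun _ _ _ _ h => hG h, hd⟩

/-- A linkage from `A` to `P` can be shortened so that each connection meets `P` only in its
last vertex. -/
lemma HasLinkage.exists_trimmed {G : SimpleGraph α} {A P : Set α} {n : ℕ}
    (h : G.HasLinkage A P n) :
    ∃ (a b : Fin n → α) (Q : Fin n → Set α), (∀ i, a i ∈ A) ∧ (∀ i, b i ∈ P) ∧
      (∀ i, G.ReachIn (Q i) (a i) (b i)) ∧ (∀ i j, i ≠ j → Disjoint (Q i) (Q j)) ∧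
      (∀ i, ∀ u ∈ Q i, u ∈ P → u = b i) ∧ ∀ i, ∀ u ∈ Q i, u ∉ P → G.ReachIn Pᶜ (a i) u := by
  obtain ⟨a, b, Q, ha, hb, hQ, hd⟩ := h
  have key : ∀ i, ∃ (t : α) (R : Set α), R ⊆ Q i ∧ t ∈ P ∧ G.ReachIn R (a i) t ∧
      (∀ u ∈ R, u ∈ P → u = t) ∧ ∀ u ∈ R, u ∉ P → G.ReachIn Pᶜ (a i) u := by
    intro i
    rcases (hQ i).first_mem (hb i) with h | ⟨y, t, hy, hyt, ht, htP⟩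
    · refine ⟨a i, {a i}, by simpa using (hQ i).left_mem, h, .refl rfl, ?_, ?_⟩ <;>
        rintro u rfl
      · simp
      · exact fun hu => absurd h hu
    · refine ⟨t, insert t {u | G.ReachIn (Q i \ P) (a i) u}, ?_, htP, ?_, ?_, ?_⟩
      · rintro u (rfl | hu)
        exacts [ht, hu.right_mem.1]
      · exact (hy.restrict.mono (Set.subset_insert _ _)).snoc hyt (Set.mem_insert _ _)
      · rintro u (rfl | hu) huP
        exacts [rfl, absurd huP hu.right_mem.2]
      · rintro u (rfl | hu) huP
        exacts [absurd htP huP, hu.mono fun _ h => h.2]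
  choose t R hR ht hreach h1 h2 using key
  exact ⟨a, t, R, ha, ht, hreach, fun i j hij => (hd i j hij).mono (hR i) (hR j), h1, h2⟩

lemma reach_of_deleteEdge {G : SimpleGraph α} {A B S T : Set α} {x y : α}
    (hy : ∀ a ∈ A, ¬ (G.deleteEdges {s(x, y)}).ReachIn Sᶜ a y)
    (hB : ∀ a ∈ A, ∀ b ∈ B, ¬ (G.deleteEdges {s(x, y)}).ReachIn Sᶜ a b)
    (hT : ∃ a ∈ A, ∃ b ∈ B, G.ReachIn Tᶜ a b) :
    ∃ a ∈ A, ∃ p ∈ insert x S, (G.deleteEdges {s(x, y)}).ReachIn Tᶜ a p := by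
  by_contra hno
  push Not at hno
  obtain ⟨a, ha, b, hb, hab⟩ := hT
  have haP : a ∉ insert x S := fun h => hno a ha a h (.refl hab.left_mem)
  have hsub : (Tᶜ ∩ (insert x S)ᶜ : Set α) ⊆ Sᶜ := fun v hv hvS => hv.2 (Or.inr hvS)
  have := hab.closed (T := {v | (G.deleteEdges {s(x, y)}).ReachIn (Tᶜ ∩ (insert x S)ᶜ) a v})
    (.refl ⟨hab.left_mem, haP⟩) (by
      intro u hu v hv huv
      have hux : u ≠ x := fun h => hu.right_mem.2 (Or.inl h)
      by_cases he : s(u, v) = s(x, y)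
      · rcases Sym2.eq_iff.1 he with ⟨h, -⟩ | ⟨rfl, rfl⟩
        · exact absurd h hux
        · exact absurd (ReachIn.mono hu hsub) (hy a ha)
      have hadj : (G.deleteEdges {s(x, y)}).Adj u v := by
        simpa [deleteEdges_adj, huv] using he
      by_cases hvP : v ∈ insert x S
      · exact absurd ((ReachIn.mono hu Set.inter_subset_left).snoc hadj hv) (hno a ha v hvP)
      · exact ReachIn.snoc hu hadj ⟨hv, hvP⟩)
  exact hB a ha b hb (ReachIn.mono this hsub)

lemma exists_eq_of_card_le [DecidableEq α] {P : Finset α} {n : ℕ}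
    {b : Fin n → α} {Q : Fin n → Set α} (hb : ∀ i, b i ∈ P) (hbQ : ∀ i, b i ∈ Q i)
    (hd : ∀ i j, i ≠ j → Disjoint (Q i) (Q j)) (hP : P.card ≤ n) {p : α} (hp : p ∈ P) :
    ∃ i, b i = p := by
  have hinj : Function.Injective b := fun i j hij => by
    by_contra hne
    exact Set.disjoint_left.1 (hd i j hne) (hbQ i) (hij ▸ hbQ j)
  have : Finset.univ.image b = P := Finset.eq_of_subset_of_card_le
    (fun x hx => by obtain ⟨i, -, rfl⟩ := Finset.mem_image.1 hx; exact hb i)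
    (by simpa [Finset.card_image_of_injective _ hinj] using hP)
  rw [← this] at hp
  simpa using hp

/-- **Menger's theorem** for vertex sets: if no set of fewer than `n` vertices separates `A`
from `B`, then there are `n` pairwise disjoint connections from `A` to `B`. -/
theorem menger [Finite α] (G : SimpleGraph α) (A B : Set α) (n : ℕ)
    (h : ∀ S : Finset α, S.card < n → ∃ a ∈ A, ∃ b ∈ B, G.ReachIn (↑S)ᶜ a b) :
    G.HasLinkage A B n := by
  classical
  have := Fintype.ofFinite α
  have : Finite (SimpleGraph α) := inferInstance
  induction G using WellFoundedLT.induction generalizing A B with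
  | ind G ih =>
  by_cases hedge : ∃ p q, G.Adj p q
  swap
  · have hcard : n ≤ (Finset.univ.filter fun v => v ∈ A ∧ v ∈ B).card := by
      by_contra hlt
      obtain ⟨a, ha, b, hb, hab⟩ := h _ (not_le.1 hlt)
      cases hab with
      | refl ha' => exact ha' (by simp [ha, hb])
      | cons _ hadj _ => exact hedge ⟨_, _, hadj⟩
    obtain ⟨s, hs, hsc⟩ := Finset.exists_subset_card_eq hcard
    let e := s.equivFinOfCardEq hsc
    have hmem : ∀ i, (e.symm i : α) ∈ A ∧ (e.symm i : α) ∈ B := fun i => by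
      simpa using hs (e.symm i).2
    refine ⟨fun i => e.symm i, fun i => e.symm i, fun i => {(e.symm i : α)},
      fun i => (hmem i).1, fun i => (hmem i).2, fun i => .refl rfl, fun i j hij => ?_⟩
    simpa [Subtype.ext_iff.symm] using hij
  obtain ⟨p, q, hpq⟩ := hedge
  have hlt : G.deleteEdges {s(p, q)} < G := by
    refine lt_of_le_of_ne (deleteEdges_le _) fun heq => ?_
    have := heq ▸ hpq
    simp [deleteEdges_adj] at this
  by_cases hS : ∃ S : Finset α, S.card < n ∧
      ∀ a ∈ A, ∀ b ∈ B, ¬ (G.deleteEdges {s(p, q)}).ReachIn (↑S)ᶜ a b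
  swap
  · push Not at hS
    exact (ih _ hlt A B hS).mono hlt.le
  obtain ⟨S, hSn, hS⟩ := hS
  obtain ⟨x, y, hxy, hxS, hyS, hxA, hyA⟩ : ∃ x y, s(x, y) = s(p, q) ∧ x ∉ S ∧ y ∉ S ∧
      (∃ a ∈ A, (G.deleteEdges {s(p, q)}).ReachIn (↑S)ᶜ a x) ∧
      ∀ a ∈ A, ¬ (G.deleteEdges {s(p, q)}).ReachIn (↑S)ᶜ a y := by
    by_contra hno
    push Not at hno
    obtain ⟨a, ha, b, hb, hab⟩ := h S hSn
    obtain ⟨a', ha', hab'⟩ := hab.closed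
      (T := {v | ∃ a ∈ A, (G.deleteEdges {s(p, q)}).ReachIn (↑S)ᶜ a v})
      ⟨a, ha, .refl hab.left_mem⟩ (by
        rintro u ⟨c, hc, hu⟩ v hv huv
        by_cases he : s(u, v) = s(p, q)
        · exact hno u v he hu.right_mem hv ⟨c, hc, hu⟩
        · exact ⟨c, hc, hu.snoc (by simpa [deleteEdges_adj, huv] using he) hv⟩)
    exact hS a' ha' b hb hab'
  have hadj : G.Adj x y := by
    rw [← mem_edgeSet, hxy]; exact hpq
  rw [← hxy] at hlt hS hxA hyA
  set G' := G.deleteEdges {s(x, y)} with hG'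
  have hle : G' ≤ G := deleteEdges_le _
  have hcard : ∀ z, (insert z S).card ≤ n := fun z => (Finset.card_insert_le _ _).trans hSn
  have l1 : G'.HasLinkage A ↑(insert x S) n := ih _ hlt _ _ fun T hT => by
    simpa using reach_of_deleteEdge hyA hS (h T hT)
  have hsw : G.deleteEdges {s(y, x)} = G' := by rw [Sym2.eq_swap]
  have l2 : G'.HasLinkage B ↑(insert y S) n := ih _ hlt _ _ fun T hT => by
    have := reach_of_deleteEdge (G := G) (A := B) (B := A) (S := S) (T := T) (x := y) (y := x)
      (fun b hb hbx => by
        rw [hsw] at hbx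
        obtain ⟨a, ha, hax⟩ := hxA
        exact hS a ha b hb (hax.trans hbx.symm))
      (fun b hb a ha hba => hS a ha b hb (by rw [hsw] at hba; exact hba.symm))
      (by
        obtain ⟨a, ha, b, hb, hab⟩ := h T hT
        exact ⟨b, hb, a, ha, hab.symm⟩)
    rw [hsw] at this
    simpa using this
  obtain ⟨a, b, Q, ha, hb, hQ, hd, hQP, hQr⟩ := l1.exists_trimmed
  obtain ⟨a₂, b₂, Q₂, ha₂, hb₂, hQ₂, hd₂, hQP₂, hQr₂⟩ := l2.exists_trimmed
  have hinj : ∀ i j, b i = b j → i = j := fun i j hij => by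
    by_contra hne
    exact Set.disjoint_left.1 (hd i j hne) (hQ i).right_mem (hij ▸ (hQ j).right_mem)
  have hj : ∀ i, ∃ j, (b i ∈ S ∧ b₂ j = b i) ∨ (b i = x ∧ b₂ j = y) := by
    intro i
    have ex : ∀ p ∈ insert y S, ∃ j, b₂ j = p := fun p hp =>
      exists_eq_of_card_le hb₂ (fun j => (hQ₂ j).right_mem) hd₂ (hcard y) hp
    rcases Finset.mem_insert.1 (hb i) with h | h
    · obtain ⟨j, hj⟩ := ex y (by simp)
      exact ⟨j, .inr ⟨h, hj⟩⟩
    · obtain ⟨j, hj⟩ := ex (b i) (by simp [h])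
      exact ⟨j, .inl ⟨h, hj⟩⟩
  choose j hj using hj
  have hcross : ∀ i k u, u ∈ Q i → u ∈ Q₂ k → u ∈ S := by
    intro i k u hu hu₂
    by_contra huS
    obtain ⟨c, hc, hcu⟩ : ∃ c ∈ A, G'.ReachIn (↑S)ᶜ c u := by
      by_cases huP : u = x
      · exact huP ▸ hxA
      · exact ⟨a i, ha i, (hQr i u hu (by simp [huP, huS])).mono (by
          intro v hv; simp at hv ⊢; exact hv.2)⟩
    by_cases huP : u = y
    · exact hyA c hc (huP ▸ hcu)
    · exact hS c hc _ (ha₂ k) (hcu.trans ((hQr₂ k u hu₂ (by simp [huP, huS])).mono (by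
          intro v hv; simp at hv ⊢; exact hv.2)).symm)
  have hdc : ∀ i k, i ≠ k → Disjoint (Q i) (Q₂ (j k)) := by
    intro i k hik
    refine Set.disjoint_left.2 fun u hu hu₂ => ?_
    have huS := hcross i _ u hu hu₂
    have h1 := hQP i u hu (by simp [huS])
    have h2 := hQP₂ _ u hu₂ (by simp [huS])
    rcases hj k with ⟨-, h⟩ | ⟨-, h⟩
    · exact hik (hinj _ _ (by rw [← h1, h2, h]))
    · exact hyS (by rw [← h, ← h2]; exact huS)
  refine ⟨a, a₂ ∘ j, fun i => Q i ∪ Q₂ (j i), ha, fun i => ha₂ _, fun i => ?_,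
    fun i k hik => ?_⟩
  · have r1 : G.ReachIn (Q i ∪ Q₂ (j i)) (a i) (b i) :=
      (hQ i).mono_of_adj Set.subset_union_left fun _ _ _ _ h => hle h
    have r2 : G.ReachIn (Q i ∪ Q₂ (j i)) (b₂ (j i)) (a₂ (j i)) :=
      (hQ₂ (j i)).symm.mono_of_adj Set.subset_union_right fun _ _ _ _ h => hle h
    rcases hj i with ⟨-, h⟩ | ⟨h, h'⟩
    · rw [h] at r2
      exact r1.trans r2
    · exact r1.trans (.cons r1.right_mem (by rw [h, h']; exact hadj) r2)
  · have hjk : j i ≠ j k := by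
      intro he
      rcases hj i with ⟨h1, h2⟩ | ⟨h1, h2⟩ <;> rcases hj k with ⟨h3, h4⟩ | ⟨h3, h4⟩
      · exact hik (hinj _ _ (by rw [← h2, ← h4, he]))
      · exact hyS (by rw [← h4, ← he, h2]; exact h1)
      · exact hyS (by rw [← h2, he, h4]; exact h3)
      · exact hik (hinj _ _ (by rw [h1, h3]))
    simp only [Set.disjoint_union_left, Set.disjoint_union_right]
    exact ⟨⟨hd i k hik, (hdc k i hik.symm).symm⟩, hdc i k hik, hd₂ _ _ hjk⟩

end SimpleGraph

namespace SimpleGraph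

variable {α : Type*}

/-- A family of pairwise intersecting connected sets is met by a single path. -/
lemma exists_path_meeting [Fintype α] (G : SimpleGraph α) {F : Set (Finset α)}
    (hconn : ∀ X ∈ F, (G.induce (X : Set α)).Connected)
    (hinter : ∀ X ∈ F, ∀ Y ∈ F, ∃ v ∈ X, v ∈ Y) (hne : F.Nonempty) :
    ∃ (p : ℕ → α) (L : ℕ), Set.InjOn p (Set.Iio L) ∧ (∀ i, i + 1 < L → G.Adj (p i) (p (i + 1))) ∧
      ∀ X ∈ F, ∃ i < L, p i ∈ X := by
  by_contra hno
  push Not at hno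
  have key : ∀ L : ℕ, ∃ p : ℕ → α, Set.InjOn p (Set.Iio (L + 1)) ∧
      (∀ i, i + 1 < L + 1 → G.Adj (p i) (p (i + 1))) ∧
      ∀ Y ∈ F, (∀ i < L + 1, p i ∉ Y) →
        ∃ y, G.Adj (p L) y ∧ ∃ c ∈ Y, G.ReachIn (p '' Set.Iio (L + 1))ᶜ c y := by
    intro L
    induction L with
    | zero =>
      obtain ⟨X, hX⟩ := hne
      obtain ⟨b, hb⟩ := (hconn X hX).nonempty
      refine ⟨fun _ => b, ?_, by simp, fun Y hY hbY => ?_⟩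
      · intro i hi j hj _
        simp at hi hj
        omega
      obtain ⟨d, hdX, hdY⟩ := hinter X hX Y hY
      have hbY : b ∉ Y := hbY 0 (by simp)
      rcases ((hconn X hX).reachIn hdX hb).first_mem (T := {b}) rfl with h | ⟨y, t, hy, hyt, -, ht⟩
      · exact absurd (h ▸ hdY) hbY
      · obtain rfl : t = b := ht
        refine ⟨y, hyt.symm, d, hdY, hy.mono ?_⟩
        rintro v ⟨-, hv⟩ ⟨_, _, h⟩
        exact hv h.symm
    | succ L ih =>
      obtain ⟨p, hinj, hadj, hp⟩ := ih
      obtain ⟨Y, hY, hYp⟩ := hno p (L + 1) hinj hadj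
      obtain ⟨y, hy, c, hcY, hcy⟩ := hp Y hY hYp
      have hynot : ∀ i < L + 1, p i ≠ y := fun i hi h => hcy.right_mem ⟨i, hi, h⟩
      refine ⟨fun i => if i < L + 1 then p i else y, ?_, ?_, fun Y' hY' hY'p => ?_⟩
      · intro i hi j hj hij
        simp only [Set.mem_Iio] at hi hj
        dsimp only at hij
        split_ifs at hij with h1 h2 h2
        · exact hinj h1 h2 hij
        · exact absurd hij (hynot i h1)
        · exact absurd hij.symm (hynot j h2)
        · omega
      · intro i hi
        dsimp only
        split_ifs with h1 h2 h2
        · exact hadj i h2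
        · obtain rfl : i = L := by omega
          exact hy
        · omega
        · omega
      · have hyY' : y ∉ Y' := by simpa using hY'p (L + 1) (by omega)
        obtain ⟨d, hdY, hdY'⟩ := hinter Y hY Y' hY'
        have hdc : G.ReachIn (p '' Set.Iio (L + 1))ᶜ d c :=
          ((hconn Y hY).reachIn hdY hcY).mono fun v hv ⟨i, hi, h⟩ => hYp i hi (h ▸ hv)
        rcases (hdc.trans hcy).first_mem (T := {y}) rfl with h | ⟨z, t, hz, hzt, -, ht⟩
        · exact absurd (h ▸ hdY') hyY'
        · obtain rfl : t = y := ht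
          refine ⟨z, by simpa using hzt.symm, d, hdY', hz.mono ?_⟩
          rintro v ⟨hv, hvt⟩ ⟨i, hi, h⟩
          dsimp only at h
          split_ifs at h with h1
          · exact hv ⟨i, h1, h⟩
          · exact hvt h.symm
  obtain ⟨p, hinj, -⟩ := key (Fintype.card α)
  have := Finset.card_le_card_of_injOn (s := Finset.range (Fintype.card α + 1))
    (t := Finset.univ) p (by simp) (by simpa [Set.InjOn] using hinj)
  simp at this

/-- No set of fewer than `m` vertices meets all members of `F`. -/
def CoverAtLeast (F : Set (Finset α)) (m : ℕ) : Prop :=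
  ∀ S : Finset α, S.card < m → ∃ X ∈ F, Disjoint X S

lemma CoverAtLeast.exists_split {F : Set (Finset α)} {M K L : ℕ} {p : ℕ → α} (hK : 0 < K)
    (hp : ∀ X ∈ F, ∃ i < L, p i ∈ X) (h : CoverAtLeast F (M + K)) :
    ∃ t ≤ L, CoverAtLeast {X | X ∈ F ∧ ∃ i < t, p i ∈ X} K ∧
      CoverAtLeast {X | X ∈ F ∧ ∀ i < t, p i ∉ X} M := by
  classical
  have hex : ∃ t, CoverAtLeast {X | X ∈ F ∧ ∃ i < t, p i ∈ X} K := ⟨L, fun S hS => by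
    obtain ⟨X, hX, hd⟩ := h S (by omega)
    exact ⟨X, ⟨hX, hp X hX⟩, hd⟩⟩
  have hL : Nat.find hex ≤ L := Nat.find_min' hex fun S hS => by
    obtain ⟨X, hX, hd⟩ := h S (by omega)
    exact ⟨X, ⟨hX, hp X hX⟩, hd⟩
  refine ⟨Nat.find hex, hL, Nat.find_spec hex, fun S hS => ?_⟩
  rcases ht : Nat.find hex with _ | t
  · obtain ⟨X, ⟨-, i, hi, -⟩, -⟩ := Nat.find_spec hex ∅ (by simpa using hK)
    omega
  have hmin := Nat.find_min hex (m := t) (by omega)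
  unfold CoverAtLeast at hmin
  push Not at hmin
  obtain ⟨S', hS', hhit⟩ := hmin
  obtain ⟨X, hX, hd⟩ := h (insert (p t) (S ∪ S')) (by
    have h1 := Finset.card_insert_le (p t) (S ∪ S')
    have h2 := Finset.card_union_le S S'
    omega)
  rw [Finset.disjoint_insert_right, Finset.disjoint_union_right] at hd
  refine ⟨X, ⟨hX, fun i hi hiX => ?_⟩, hd.2.1⟩
  rcases Nat.lt_succ_iff_lt_or_eq.1 hi with hi | rfl
  · exact hhit X ⟨hX, i, hi, hiX⟩ hd.2.2
  · exact hd.1 hiX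

lemma sdiff_between_adj {G : SimpleGraph α} {A B : Set α} {u v : α} :
    (G \ G.between A B).Adj u v ↔ G.Adj u v ∧ ¬ (u ∈ A ∧ v ∈ B ∨ u ∈ B ∧ v ∈ A) := by
  simp only [sdiff_adj, between_adj]
  tauto

lemma reachIn_sdiff_between {G : SimpleGraph α} {A B Z : Set α} {x y b : α}
    (hxZ : x ∈ Z) (hxB : x ∉ B) (hyB : y ∉ B) (hxy : G.Adj y x)
    (h : G.ReachIn (Z \ A) y b) : (G \ G.between A B).ReachIn Z x b := by
  refine .cons hxZ (sdiff_between_adj.2 ⟨hxy.symm, by tauto⟩)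
    (h.mono_of_adj Set.sdiff_subset fun u hu v hv huv => sdiff_between_adj.2 ⟨huv, ?_⟩)
  rintro (h | h)
  exacts [hu.2 h.1, hv.2 h.2]

/-- Three pairwise intersecting connected sets link `A` to `B` or to `C` by a connection which is
not a single edge. -/
lemma exists_reachIn_sdiff_between {G : SimpleGraph α} {A B C Z X₁ X₂ X₃ : Set α}
    (hAB : Disjoint A B) (hAC : Disjoint A C) (hBC : Disjoint B C)
    (h₁ : (G.induce X₁).Connected) (h₂ : (G.induce X₂).Connected) (h₃ : (G.induce X₃).Connected)
    (h₁₃ : (X₁ ∩ X₃).Nonempty) (h₂₃ : (X₂ ∩ X₃).Nonempty)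
    (hA : (X₁ ∩ A).Nonempty) (hB : (X₂ ∩ B).Nonempty) (hC : (X₃ ∩ C).Nonempty)
    (h₂A : Disjoint X₂ A) (h₃A : Disjoint X₃ A) (hZ₁ : X₁ ⊆ Z) (hZ₂ : X₂ ⊆ Z) (hZ₃ : X₃ ⊆ Z) :
    (∃ a ∈ A, ∃ b ∈ B, (G \ G.between A B).ReachIn Z a b) ∨
      ∃ a ∈ A, ∃ c ∈ C, (G \ G.between A C).ReachIn Z a c := by
  obtain ⟨u, hu₁, hu₃⟩ := h₁₃
  obtain ⟨w, hw₂, hw₃⟩ := h₂₃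
  obtain ⟨a, ha₁, haA⟩ := hA
  obtain ⟨b, hb₂, hbB⟩ := hB
  obtain ⟨c, hc₃, hcC⟩ := hC
  have sub : ∀ {X : Set α}, Disjoint X A → X ⊆ Z → X ⊆ Z \ A :=
    fun hd hs v hv => ⟨hs hv, Set.disjoint_left.1 hd hv⟩
  rcases (h₁.reachIn hu₁ ha₁).first_mem haA with h | ⟨y, x, hy, hyx, hx, hxA⟩
  · exact absurd h (Set.disjoint_left.1 h₃A hu₃)
  have hyu : G.ReachIn (Z \ A) y u := hy.symm.mono (Set.sdiff_subset_sdiff_left hZ₁)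
  have huc : G.ReachIn (Z \ A) u c := (h₃.reachIn hu₃ hc₃).mono (sub h₃A hZ₃)
  have hub : G.ReachIn (Z \ A) u b := ((h₃.reachIn hu₃ hw₃).mono (sub h₃A hZ₃)).trans
    ((h₂.reachIn hw₂ hb₂).mono (sub h₂A hZ₂))
  by_cases hyB : y ∈ B
  · exact .inr ⟨x, hxA, c, hcC, reachIn_sdiff_between (hZ₁ hx)
      (Set.disjoint_left.1 hAC hxA) (Set.disjoint_left.1 hBC hyB) hyx (hyu.trans huc)⟩
  · exact .inl ⟨x, hxA, b, hbB, reachIn_sdiff_between (hZ₁ hx)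
      (Set.disjoint_left.1 hAB hxA) hyB hyx (hyu.trans hub)⟩

/-- A linkage from `A` to `B` without `A`–`B` edges yields connected sets outside `A ∪ B` attached
to both `A` and `B`. -/
lemma HasLinkage.exists_rungs {G : SimpleGraph α} {A B : Set α} {n : ℕ} (hAB : Disjoint A B)
    (h : (G \ G.between A B).HasLinkage A B n) :
    ∃ (a b : Fin n → α) (I : Fin n → Set α), (∀ i, a i ∈ A) ∧ (∀ i, b i ∈ B) ∧
      Function.Injective a ∧ Function.Injective b ∧ (∀ i, (G.induce (I i)).Connected) ∧
      (∀ i, Disjoint (I i) A) ∧ (∀ i, Disjoint (I i) B) ∧ (∀ i j, i ≠ j → Disjoint (I i) (I j)) ∧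
      (∀ i, ∃ u ∈ I i, G.Adj (a i) u) ∧ ∀ i, ∃ u ∈ I i, G.Adj (b i) u := by
  obtain ⟨a, b, Q, ha, hb, hQ, hd⟩ := h
  have key : ∀ i, ∃ x y : α, ∃ I ⊆ Q i, x ∈ A ∧ y ∈ B ∧ x ∈ Q i ∧ y ∈ Q i ∧
      (G.induce I).Connected ∧ Disjoint I A ∧ Disjoint I B ∧
      (∃ u ∈ I, G.Adj x u) ∧ ∃ u ∈ I, G.Adj y u := by
    intro i
    rcases (hQ i).symm.first_mem (ha i) with h | ⟨u, x, hu, hux, hx, hxA⟩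
    · exact absurd (hb i) (Set.disjoint_left.1 hAB h)
    rcases hu.symm.first_mem (hb i) with h | ⟨v, y, hv, hvy, hy, hyB⟩
    · exact absurd (.inr ⟨h, hxA⟩) (sdiff_between_adj.1 hux).2
    have hv' : G.ReachIn ((Q i \ A) \ B) u v :=
      hv.mono_of_adj subset_rfl fun _ _ _ _ h => (sdiff_between_adj.1 h).1
    refine ⟨x, y, {w | G.ReachIn ((Q i \ A) \ B) u w}, fun w hw => hw.right_mem.1.1, hxA, hyB, hx,
      hy.1, connected_induce_setOf_reachIn hv'.left_mem,
      Set.disjoint_left.2 fun w hw => hw.right_mem.1.2,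
      Set.disjoint_left.2 fun w hw => hw.right_mem.2,
      ⟨u, .refl hv'.left_mem, (sdiff_between_adj.1 hux).1.symm⟩,
      ⟨v, hv', (sdiff_between_adj.1 hvy).1.symm⟩⟩
  choose x y I hIQ hxA hyB hxQ hyQ hI hIA hIB hIx hIy using key
  refine ⟨x, y, I, hxA, hyB, fun i j hij => ?_, fun i j hij => ?_, hI, hIA, hIB,
    fun i j hij => (hd i j hij).mono (hIQ i) (hIQ j), hIx, hIy⟩ <;> by_contra hne
  · exact Set.disjoint_left.1 (hd i j hne) (hxQ i) (hij ▸ hxQ j)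
  · exact Set.disjoint_left.1 (hd i j hne) (hyQ i) (hij ▸ hyQ j)

/-- A family of pairwise intersecting connected sets that is hard to cover yields two disjoint
subpaths of a path with `n` disjoint connected sets attached to both. -/
lemma CoverAtLeast.exists_rungs [Fintype α] {G : SimpleGraph α} {F : Set (Finset α)} {n : ℕ}
    (hconn : ∀ X ∈ F, (G.induce (X : Set α)).Connected)
    (hinter : ∀ X ∈ F, ∀ Y ∈ F, ∃ v ∈ X, v ∈ Y) (hn : 0 < n) (hF : CoverAtLeast F (6 * n)) :
    ∃ (p : ℕ → α) (t s e : ℕ), t ≤ s ∧ Set.InjOn p (Set.Iio t ∪ Set.Ico s e) ∧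
      (∀ i, i + 1 < t → G.Adj (p i) (p (i + 1))) ∧
      (∀ i, s ≤ i → i + 1 < e → G.Adj (p i) (p (i + 1))) ∧
      ∃ (a b : Fin n → ℕ) (I : Fin n → Set α), (∀ i, a i < t) ∧ (∀ i, s ≤ b i ∧ b i < e) ∧
        Function.Injective a ∧ Function.Injective b ∧ (∀ i, (G.induce (I i)).Connected) ∧
        (∀ i, ∀ j < t, p j ∉ I i) ∧ (∀ i, ∀ j, s ≤ j → j < e → p j ∉ I i) ∧
        (∀ i j, i ≠ j → Disjoint (I i) (I j)) ∧
        (∀ i, ∃ u ∈ I i, G.Adj (p (a i)) u) ∧ ∀ i, ∃ u ∈ I i, G.Adj (p (b i)) u := by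
  classical
  have hne : F.Nonempty := by
    obtain ⟨X, hX, -⟩ := hF ∅ (by simpa using hn)
    exact ⟨X, hX⟩
  obtain ⟨p, L, hinj, hadj, hhit⟩ := G.exists_path_meeting hconn hinter hne
  obtain ⟨t₁, ht₁, hF₁, hF'⟩ := CoverAtLeast.exists_split (M := 4 * n) (K := 2 * n) (by omega) hhit
    (by convert hF using 1; omega)
  obtain ⟨t₂, ht₂, hF₂, hF₃⟩ := CoverAtLeast.exists_split (M := 2 * n) (K := 2 * n)
    (F := {X | X ∈ F ∧ ∀ i < t₁, p i ∉ X}) (by omega) (fun X hX => hhit X hX.1)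
    (by convert hF' using 1; omega)
  have hle : t₁ ≤ t₂ := by
    obtain ⟨X, ⟨hX, i, hi, hiX⟩, -⟩ := hF₂ ∅ (by simpa using hn)
    by_contra hlt
    exact hX.2 i (by omega) hiX
  suffices h : ∃ s e, t₁ ≤ s ∧ e ≤ L ∧
      (G \ G.between (p '' Set.Iio t₁) (p '' Set.Ico s e)).HasLinkage
        (p '' Set.Iio t₁) (p '' Set.Ico s e) n by
    obtain ⟨s, e, hs, he, hlink⟩ := h
    have hdisj : Disjoint (p '' Set.Iio t₁) (p '' Set.Ico s e) := by
      rw [Set.disjoint_left]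
      rintro _ ⟨i, hi, rfl⟩ ⟨j, ⟨hj₁, hj₂⟩, hij⟩
      simp only [Set.mem_Iio] at hi
      have := hinj (by simp; omega) (by simp; omega) hij
      omega
    obtain ⟨a, b, I, ha, hb, hai, hbi, hI, hIA, hIB, hd, hIa, hIb⟩ := hlink.exists_rungs hdisj
    choose a' ha' haa using ha
    choose b' hb' hbb using hb
    obtain rfl : (fun i => p (a' i)) = a := funext haa
    obtain rfl : (fun i => p (b' i)) = b := funext hbb
    refine ⟨p, t₁, s, e, hs, hinj.mono ?_, fun i hi => hadj i (by omega),
      fun i _ hi => hadj i (by omega), a', b', I, ha', hb', ?_, ?_, hI, ?_, ?_, hd, hIa, hIb⟩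
    · rintro i (hi | hi) <;> simp at hi ⊢ <;> omega
    · exact fun i j hij => hai (by simp only [hij])
    · exact fun i j hij => hbi (by simp only [hij])
    · exact fun i j hj hmem => Set.disjoint_left.1 (hIA i) hmem ⟨j, hj, rfl⟩
    · exact fun i j hj hj' hmem => Set.disjoint_left.1 (hIB i) hmem ⟨j, ⟨hj, hj'⟩, rfl⟩
  by_contra hno
  push Not at hno
  have h₂ := mt (menger _ _ _ n) (hno t₁ t₂ le_rfl ht₂)
  have h₃ := mt (menger _ _ _ n) (hno t₂ L hle le_rfl)
  push Not at h₂ h₃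
  obtain ⟨S₂, hS₂, hsep₂⟩ := h₂
  obtain ⟨S₃, hS₃, hsep₃⟩ := h₃
  have hS : (S₂ ∪ S₃).card < 2 * n := by
    have := Finset.card_union_le S₂ S₃
    omega
  obtain ⟨X₁, ⟨hX₁, i₁, hi₁, hiX₁⟩, hd₁⟩ := hF₁ _ hS
  obtain ⟨X₂, ⟨⟨hX₂, hX₂'⟩, i₂, hi₂, hiX₂⟩, hd₂⟩ := hF₂ _ hS
  obtain ⟨X₃, ⟨⟨hX₃, hX₃'⟩, hX₃''⟩, hd₃⟩ := hF₃ _ hS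
  obtain ⟨i₃, hi₃, hiX₃⟩ := hhit X₃ hX₃
  have hi₂' : t₁ ≤ i₂ := by
    by_contra hlt
    exact hX₂' i₂ (by omega) hiX₂
  have hi₃' : t₂ ≤ i₃ := by
    by_contra hlt
    exact hX₃'' i₃ (by omega) hiX₃
  have hdisj : ∀ s s' e e', e' ≤ L → s' ≤ L → s ≤ s' → e ≤ e' → s' ≤ e →
      Disjoint (p '' Set.Ico s s') (p '' Set.Ico e e') := by
    intro s s' e e' h1 h2 h3 h4 h5
    rw [Set.disjoint_left]
    rintro _ ⟨i, ⟨hi, hi'⟩, rfl⟩ ⟨j, ⟨hj₁, hj₂⟩, hij⟩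
    have := hinj (by simp; omega) (by simp; omega) hij
    omega
  have hIio : Set.Iio t₁ = Set.Ico 0 t₁ := by ext; simp
  have hcompl : ∀ {X : Finset α}, Disjoint X (S₂ ∪ S₃) → (X : Set α) ⊆ (↑(S₂ ∪ S₃))ᶜ :=
    fun hd v hv hvS => Finset.disjoint_left.1 hd hv hvS
  have hnA : ∀ {X : Finset α}, (∀ i < t₁, p i ∉ X) → Disjoint (X : Set α) (p '' Set.Iio t₁) := by
    intro X hX
    rw [Set.disjoint_left]
    rintro _ hv ⟨i, hi, rfl⟩
    exact hX i hi hv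
  have hnon : ∀ {X Y : Finset α}, X ∈ F → Y ∈ F → ((X : Set α) ∩ Y).Nonempty :=
    fun hX hY => hinter _ hX _ hY
  rcases exists_reachIn_sdiff_between (A := p '' Set.Iio t₁) (B := p '' Set.Ico t₁ t₂)
      (C := p '' Set.Ico t₂ L) (Z := (↑(S₂ ∪ S₃))ᶜ)
      (hIio ▸ hdisj _ _ _ _ (by omega) (by omega) (by omega) (by omega) (by omega))
      (hIio ▸ hdisj _ _ _ _ (by omega) (by omega) (by omega) (by omega) (by omega))
      (hdisj _ _ _ _ (by omega) (by omega) (by omega) (by omega) (by omega))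
      (hconn X₁ hX₁) (hconn X₂ hX₂) (hconn X₃ hX₃) (hnon hX₁ hX₃) (hnon hX₂ hX₃)
      ⟨p i₁, hiX₁, i₁, hi₁, rfl⟩ ⟨p i₂, hiX₂, i₂, ⟨hi₂', hi₂⟩, rfl⟩
      ⟨p i₃, hiX₃, i₃, ⟨hi₃', hi₃⟩, rfl⟩ (hnA hX₂') (hnA hX₃') (hcompl hd₁) (hcompl hd₂)
      (hcompl hd₃) with ⟨a, ha, b, hb, hab⟩ | ⟨a, ha, b, hb, hab⟩
  · exact hsep₂ a ha b hb (hab.mono fun v hv hvS => hv (by simp at hvS; simp [hvS]))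
  · exact hsep₃ a ha b hb (hab.mono fun v hv hvS => hv (by simp at hvS; simp [hvS]))

end SimpleGraph

/-- The **Erdős–Szekeres theorem** for a pair of injective sequences. -/
lemma erdos_szekeres_pair (r : ℕ) (a b : Fin (r ^ 2) → ℕ) (ha : Function.Injective a)
    (hb : Function.Injective b) :
    ∃ e : Fin r → Fin (r ^ 2), StrictMono (a ∘ e) ∧ (StrictMono (b ∘ e) ∨ StrictAnti (b ∘ e)) := by
  classical
  have order : ∀ T : Finset (Fin (r ^ 2)), r ≤ T.card →
      ∃ e : Fin r → Fin (r ^ 2), (∀ i, e i ∈ T) ∧ StrictMono (a ∘ e) := by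
    intro T hT
    have hcard : r ≤ (T.image a).card := by rwa [Finset.card_image_of_injective _ ha]
    obtain ⟨A, hA, hAr⟩ := Finset.exists_subset_card_eq hcard
    have hex : ∀ i, ∃ x ∈ T, a x = A.orderEmbOfFin hAr i := fun i =>
      Finset.mem_image.1 (hA (A.orderEmbOfFin_mem hAr i))
    choose e heT he using hex
    refine ⟨e, heT, fun i j hij => ?_⟩
    simpa [he] using hij
  by_cases hchain : ∃ T : Finset (Fin (r ^ 2)), r ≤ T.card ∧
      ∀ x ∈ T, ∀ y ∈ T, a x < a y → b x < b y
  · obtain ⟨T, hT, hmono⟩ := hchain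
    obtain ⟨e, heT, he⟩ := order T hT
    exact ⟨e, he, .inl fun i j hij => hmono _ (heT i) _ (heT j) (he hij)⟩
  push Not at hchain
  have hr : 0 < r := by
    by_contra h
    obtain ⟨x, hx, -⟩ := hchain ∅ (by simp; omega)
    simp at hx
  let C : Fin (r ^ 2) → Finset (Finset (Fin (r ^ 2))) := fun i =>
    Finset.univ.filter fun T => i ∈ T ∧ (∀ x ∈ T, x ≠ i → a x < a i) ∧
      ∀ x ∈ T, ∀ y ∈ T, a x < a y → b x < b y
  let f : Fin (r ^ 2) → ℕ := fun i => (C i).sup Finset.card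
  have hfr : ∀ i, f i < r := by
    intro i
    refine (Finset.sup_lt_iff (by simpa using hr)).2 fun T hT => ?_
    by_contra hle
    obtain ⟨x, hx, y, hy, hxy, h⟩ := hchain T (not_lt.1 hle)
    exact absurd ((Finset.mem_filter.1 hT).2.2.2 x hx y hy hxy) (not_lt.2 h)
  have hf0 : ∀ i, 0 < f i := by
    intro i
    have : ({i} : Finset _) ∈ C i := by simp [C]
    exact (by simp : 0 < ({i} : Finset (Fin (r ^ 2))).card).trans_le
      (Finset.le_sup (f := Finset.card) this)
  have hflt : ∀ i j, a i < a j → b i < b j → f i < f j := by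
    intro i j hij hbij
    obtain ⟨T, hT, hTf⟩ := Finset.exists_mem_eq_sup (C i) ⟨{i}, by simp [C]⟩ Finset.card
    simp only [C, Finset.mem_filter, Finset.mem_univ, true_and] at hT
    obtain ⟨hiT, hTi, hmono⟩ := hT
    have hale : ∀ x ∈ T, a x ≤ a i := fun x hx => by
      by_cases h : x = i
      exacts [h ▸ le_rfl, (hTi x hx h).le]
    have hble : ∀ x ∈ T, b x ≤ b i := fun x hx => by
      by_cases h : x = i
      exacts [h ▸ le_rfl, (hmono x hx i hiT (hTi x hx h)).le]
    have hjT : j ∉ T := fun h => absurd (hale j h) (not_le.2 hij)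
    have hmem : insert j T ∈ C j := by
      simp only [C, Finset.mem_filter, Finset.mem_univ, true_and]
      refine ⟨Finset.mem_insert_self _ _, ?_, ?_⟩
      · intro x hx hxj
        exact (hale x (Finset.mem_of_mem_insert_of_ne hx hxj)).trans_lt hij
      · intro x hx y hy hxy
        rcases Finset.mem_insert.1 hx with hxj | hxT <;>
          rcases Finset.mem_insert.1 hy with hyj | hyT
        · subst hxj hyj
          omega
        · have := hale y hyT
          subst hxj
          omega
        · subst hyj
          exact (hble x hxT).trans_lt hbij
        · exact hmono x hxT y hyT hxy
    have := Finset.le_sup (f := Finset.card) hmem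
    rw [Finset.card_insert_of_notMem hjT] at this
    change (C i).sup Finset.card < (C j).sup Finset.card
    omega
  obtain ⟨m, -, hm⟩ := Finset.exists_lt_card_fiber_of_mul_lt_card_of_maps_to
    (s := Finset.univ) (t := Finset.Ico 1 r) (f := f) (n := r - 1)
    (fun i _ => Finset.mem_Ico.2 ⟨hf0 i, hfr i⟩) (by
      obtain ⟨k, rfl⟩ : ∃ k, r = k + 1 := ⟨r - 1, by omega⟩
      simp
      nlinarith)
  obtain ⟨e, heT, he⟩ := order (Finset.univ.filter fun x => f x = m) (by omega)
  refine ⟨e, he, .inr fun i j hij => ?_⟩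
  have h1 := (Finset.mem_filter.1 (heT i)).2
  have h2 := (Finset.mem_filter.1 (heT j)).2
  by_contra hle
  rcases (not_lt.1 hle).lt_or_eq with h | h
  · have := hflt (e i) (e j) (he hij) h
    omega
  · have := he hij
    simp [hb h] at this

namespace SimpleGraph

variable {α : Type*}

lemma connected_induce_image_Ico {G : SimpleGraph α} {p : ℕ → α} {l u : ℕ} (hlu : l < u)
    (hp : ∀ j, l ≤ j → j + 1 < u → G.Adj (p j) (p (j + 1))) :
    (G.induce (p '' Set.Ico l u)).Connected := by
  refine connected_induce_of_reachIn (a := p l) ⟨l, by simp [hlu], rfl⟩ ?_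
  have key : ∀ j, l ≤ j → j < u → G.ReachIn (p '' Set.Ico l u) (p l) (p j) := by
    intro j hj
    induction j, hj using Nat.le_induction with
    | base => exact fun _ => .refl ⟨l, by simp [hlu], rfl⟩
    | succ j hj ih =>
      exact fun h => (ih (by omega)).snoc (hp j hj h) ⟨j + 1, ⟨by omega, h⟩, rfl⟩
  rintro _ ⟨j, hj, rfl⟩
  exact key j hj.1 hj.2

lemma isMinorModel_Xi {G : SimpleGraph α} {R : ℕ} {X Y Z : Fin R → Set α}
    (hX : ∀ i, (G.induce (X i)).Connected) (hY : ∀ i, (G.induce (Y i)).Connected)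
    (hZ : ∀ i, (G.induce (Z i)).Connected)
    (hXX : ∀ i j, i < j → Disjoint (X i) (X j)) (hYY : ∀ i j, i < j → Disjoint (Y i) (Y j))
    (hZZ : ∀ i j, i < j → Disjoint (Z i) (Z j)) (hXY : ∀ i j, Disjoint (X i) (Y j))
    (hXZ : ∀ i j, Disjoint (X i) (Z j)) (hYZ : ∀ i j, Disjoint (Y i) (Z j))
    (aX : ∀ i j : Fin R, (j : ℕ) = i + 1 → ∃ a ∈ X i, ∃ b ∈ X j, G.Adj a b)
    (aZ : ∀ i j : Fin R, (j : ℕ) = i + 1 → ∃ a ∈ Z i, ∃ b ∈ Z j, G.Adj a b)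
    (aYX : ∀ i, ∃ a ∈ Y i, ∃ b ∈ X i, G.Adj a b) (aYZ : ∀ i, ∃ a ∈ Y i, ∃ b ∈ Z i, G.Adj a b) :
    IsMinorModel (Xi R) G fun s => ![X, Y, Z] s.1 s.2 := by
  have sym : ∀ {A : Fin R → Set α}, (∀ i j, i < j → Disjoint (A i) (A j)) →
      ∀ i j, i ≠ j → Disjoint (A i) (A j) := fun h i j hij =>
    (lt_or_gt_of_ne hij).elim (h i j) fun h' => (h j i h').symm
  refine ⟨?_, ?_, ?_⟩
  · rintro ⟨s, i⟩
    fin_cases s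
    exacts [hX i, hY i, hZ i]
  · rintro ⟨s, i⟩ ⟨t, j⟩ hne
    fin_cases s <;> fin_cases t
    · exact sym hXX i j (by simpa using hne)
    · exact hXY i j
    · exact hXZ i j
    · exact (hXY j i).symm
    · exact sym hYY i j (by simpa using hne)
    · exact hYZ i j
    · exact (hXZ j i).symm
    · exact (hYZ j i).symm
    · exact sym hZZ i j (by simpa using hne)
  · have flip : ∀ {A B : Set α}, (∃ a ∈ A, ∃ b ∈ B, G.Adj a b) → ∃ a ∈ B, ∃ b ∈ A, G.Adj a b :=
      fun ⟨a, ha, b, hb, h⟩ => ⟨b, hb, a, ha, h.symm⟩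
    have dir : ∀ u v : Fin 3 × Fin R, ((u.1 = 0 ∧ v.1 = 0 ∧ (v.2 : ℕ) = (u.2 : ℕ) + 1) ∨
        (u.1 = 2 ∧ v.1 = 2 ∧ (v.2 : ℕ) = (u.2 : ℕ) + 1) ∨
        (u.1 = 1 ∧ u.2 = v.2 ∧ (v.1 = 0 ∨ v.1 = 2))) →
        ∃ a ∈ (![X, Y, Z] u.1 u.2 : Set α), ∃ b ∈ (![X, Y, Z] v.1 v.2 : Set α), G.Adj a b := by
      rintro ⟨s, i⟩ ⟨t, j⟩ (⟨rfl, rfl, h⟩ | ⟨rfl, rfl, h⟩ | ⟨rfl, h, rfl | rfl⟩)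
      · exact aX i j h
      · exact aZ i j h
      · obtain rfl : i = j := h
        exact aYX i
      · obtain rfl : i = j := h
        exact aYZ i
    intro u v huv
    rcases ((SimpleGraph.fromRel_adj _ _ _).1 huv).2 with h | h
    · exact dir u v h
    · exact flip (dir v u h)

/-- Two disjoint paths with `R + 1` disjoint connected sets attached to both in the same order
contain a model of `Ξ_R`. -/
lemma isMinor_Xi_of_rungs {G : SimpleGraph α} {R : ℕ} {p q : ℕ → α} {a b : Fin (R + 1) → ℕ}
    {I : Fin (R + 1) → Set α} (ha : StrictMono a) (hb : StrictMono b)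
    (hp : ∀ j, a 0 ≤ j → j < a (Fin.last R) → G.Adj (p j) (p (j + 1)))
    (hq : ∀ j, b 0 ≤ j → j < b (Fin.last R) → G.Adj (q j) (q (j + 1)))
    (hpi : Set.InjOn p (Set.Ico (a 0) (a (Fin.last R))))
    (hqi : Set.InjOn q (Set.Ico (b 0) (b (Fin.last R))))
    (hpq : ∀ i ∈ Set.Ico (a 0) (a (Fin.last R)), ∀ j ∈ Set.Ico (b 0) (b (Fin.last R)), p i ≠ q j)
    (hI : ∀ i, (G.induce (I i)).Connected) (hII : ∀ i j, i ≠ j → Disjoint (I i) (I j))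
    (hpI : ∀ i, ∀ j ∈ Set.Ico (a 0) (a (Fin.last R)), p j ∉ I i)
    (hqI : ∀ i, ∀ j ∈ Set.Ico (b 0) (b (Fin.last R)), q j ∉ I i)
    (haI : ∀ i, ∃ u ∈ I i, G.Adj (p (a i)) u) (hbI : ∀ i, ∃ u ∈ I i, G.Adj (q (b i)) u) :
    IsMinor (Xi R) G := by
  have sub : ∀ {c : Fin (R + 1) → ℕ}, StrictMono c → ∀ i : Fin R,
      Set.Ico (c i.castSucc) (c i.succ) ⊆ Set.Ico (c 0) (c (Fin.last R)) := fun hc i =>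
    Set.Ico_subset_Ico (hc.monotone (Fin.zero_le _)) (hc.monotone (Fin.le_last _))
  have lt : ∀ {c : Fin (R + 1) → ℕ}, StrictMono c → ∀ i : Fin R, c i.castSucc < c i.succ :=
    fun hc i => hc (Fin.castSucc_lt_succ)
  have conn : ∀ {c : Fin (R + 1) → ℕ} {p : ℕ → α}, StrictMono c →
      (∀ j, c 0 ≤ j → j < c (Fin.last R) → G.Adj (p j) (p (j + 1))) → ∀ i : Fin R,
      (G.induce (p '' Set.Ico (c i.castSucc) (c i.succ))).Connected := fun hc hp i =>
    connected_induce_image_Ico (lt hc i) fun j hj hj' =>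
      have h := sub hc i ⟨hj, (Nat.lt_succ_self j).trans hj'⟩
      hp j h.1 h.2
  have disj : ∀ {c : Fin (R + 1) → ℕ} {p : ℕ → α}, StrictMono c →
      Set.InjOn p (Set.Ico (c 0) (c (Fin.last R))) → ∀ i j : Fin R, i < j →
      Disjoint (p '' Set.Ico (c i.castSucc) (c i.succ))
        (p '' Set.Ico (c j.castSucc) (c j.succ)) := by
    intro c p hc hp i j hij
    rw [Set.disjoint_left]
    rintro _ ⟨x, hx, rfl⟩ ⟨y, hy, hxy⟩
    have h1 := hp (sub hc j hy) (sub hc i hx) hxy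
    have h2 : c i.succ ≤ c j.castSucc := hc.monotone (by
      rw [Fin.le_def]; simpa [Nat.succ_le_iff] using hij)
    have := hx.2
    have := hy.1
    omega
  have next : ∀ {c : Fin (R + 1) → ℕ} {p : ℕ → α}, StrictMono c →
      (∀ j, c 0 ≤ j → j < c (Fin.last R) → G.Adj (p j) (p (j + 1))) → ∀ i j : Fin R,
      (j : ℕ) = i + 1 → ∃ x ∈ p '' Set.Ico (c i.castSucc) (c i.succ),
        ∃ y ∈ p '' Set.Ico (c j.castSucc) (c j.succ), G.Adj x y := by
    intro c p hc hp i j hij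
    have hs : i.succ = j.castSucc := Fin.ext (by simp [hij])
    have h1 := lt hc i
    have h2 := lt hc j
    have hm : c i.succ - 1 ∈ Set.Ico (c i.castSucc) (c i.succ) := ⟨by omega, by omega⟩
    have h3 := sub hc i hm
    refine ⟨_, ⟨_, hm, rfl⟩, _, ⟨c j.castSucc, ⟨le_rfl, h2⟩, rfl⟩, ?_⟩
    have := hp _ h3.1 h3.2
    rw [← hs]
    rwa [Nat.sub_add_cancel (by omega)] at this
  refine ⟨_, isMinorModel_Xi (X := fun i : Fin R => p '' Set.Ico (a i.castSucc) (a i.succ))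
    (Y := fun i => I i.castSucc) (Z := fun i : Fin R => q '' Set.Ico (b i.castSucc) (b i.succ))
    (conn ha hp) (fun i => hI _) (conn hb hq) (disj ha hpi)
    (fun i j hij => hII _ _ (by simpa using hij.ne)) (disj hb hqi) ?_ ?_ ?_ (next ha hp)
    (next hb hq) ?_ ?_⟩
  · intro i j
    rw [Set.disjoint_left]
    rintro _ ⟨x, hx, rfl⟩
    exact hpI _ x (sub ha i hx)
  · intro i j
    rw [Set.disjoint_left]
    rintro _ ⟨x, hx, rfl⟩ ⟨y, hy, hxy⟩
    exact hpq x (sub ha i hx) y (sub hb j hy) hxy.symm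
  · intro i j
    rw [Set.disjoint_right]
    rintro _ ⟨x, hx, rfl⟩
    exact hqI _ x (sub hb j hx)
  · intro i
    obtain ⟨u, hu, hadj⟩ := haI i.castSucc
    exact ⟨u, hu, _, ⟨_, ⟨le_rfl, lt ha i⟩, rfl⟩, hadj.symm⟩
  · intro i
    obtain ⟨u, hu, hadj⟩ := hbI i.castSucc
    exact ⟨u, hu, _, ⟨_, ⟨le_rfl, lt hb i⟩, rfl⟩, hadj.symm⟩

/-- A family of pairwise intersecting connected sets which no small set covers forces a `Ξ_R`
minor. -/
lemma CoverAtLeast.isMinor_Xi [Fintype α] {G : SimpleGraph α} {F : Set (Finset α)} {R : ℕ}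
    (hconn : ∀ X ∈ F, (G.induce (X : Set α)).Connected)
    (hinter : ∀ X ∈ F, ∀ Y ∈ F, ∃ v ∈ X, v ∈ Y) (hF : CoverAtLeast F (6 * (R + 1) ^ 2)) :
    IsMinor (Xi R) G := by
  obtain ⟨p, t, s, e, hts, hinj, hadj₁, hadj₂, a, b, I, ha, hb, hai, hbi, hI, hpI, hqI, hII, haI,
    hbI⟩ := hF.exists_rungs hconn hinter (by positivity)
  obtain ⟨g, hga, hgb⟩ := erdos_szekeres_pair _ a b hai hbi
  have hg : ∀ i j, i ≠ j → g i ≠ g j := fun i j hij h => hij (hga.injective (by simp [h]))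
  have hat : ∀ i, (a ∘ g) i < t := fun i => ha _
  have hbt : ∀ i, s ≤ (b ∘ g) i ∧ (b ∘ g) i < e := fun i => hb _
  have hlast := hat (Fin.last R)
  have hL := hbt (Fin.last R)
  have h0 := hbt 0
  rcases hgb with hgb | hgb
  · refine isMinor_Xi_of_rungs (p := p) (q := p) (I := I ∘ g) hga hgb
      (fun j _ h => hadj₁ j (by omega)) (fun j h h' => hadj₂ j (by omega) (by omega))
      (hinj.mono fun j hj => ?_) (hinj.mono fun j hj => ?_) (fun i hi j hj hij => ?_)
      (fun i => hI _) (fun i j hij => hII _ _ (hg i j hij)) (fun i j hj => hpI _ j ?_)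
      (fun i j hj => hqI _ j ?_ ?_) (fun i => haI _) (fun i => hbI _)
    all_goals simp only [Set.mem_Ico] at *
    · simp; omega
    · simp; omega
    · have := hinj (by simp; omega) (by simp; omega) hij
      omega
    all_goals omega
  · refine isMinor_Xi_of_rungs (p := p) (q := fun j => p (e - j)) (I := I ∘ g)
      (b := fun i => e - (b ∘ g) i) hga (fun i j hij => ?_)
      (fun j _ h => hadj₁ j (by omega)) (fun j h h' => ?_)
      (hinj.mono fun j hj => ?_) (fun i hi j hj hij => ?_) (fun i hi j hj hij => ?_)
      (fun i => hI _) (fun i j hij => hII _ _ (hg i j hij)) (fun i j hj => hpI _ j ?_)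
      (fun i j hj => hqI _ _ ?_ ?_) (fun i => haI _) (fun i => ?_)
    all_goals try simp only [Set.mem_Ico] at *
    · have := hgb hij
      have := hbt i
      have := hbt j
      omega
    · have := hadj₂ (e - (j + 1)) (by omega) (by omega)
      rw [show e - (j + 1) + 1 = e - j by omega] at this
      exact this.symm
    · simp; omega
    · have := hinj (by simp; omega) (by simp; omega) hij
      omega
    · have := hinj (by simp; omega) (by simp; omega) hij
      omega
    · omega
    · omega
    · omega
    · have := hbt i
      obtain ⟨u, hu, h⟩ := hbI (g i)
      refine ⟨u, hu, ?_⟩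
      change G.Adj (p (e - (e - b (g i)))) u
      rwa [Nat.sub_sub_self (hb (g i)).2.le]

end SimpleGraph

namespace SimpleGraph

variable {α β : Type*}

lemma _root_.IsTreeDecomp.mem_of_le_of_le {H : SimpleGraph β} {n : ℕ} {X : Fin (n + 1) → Set β}
    (hX : IsTreeDecomp H (pathGraph (n + 1)) X) {v : β} {s t u : Fin (n + 1)} (hs : v ∈ X s)
    (ht : v ∈ X t) (hsu : s ≤ u) (hut : u ≤ t) : v ∈ X u := by
  by_contra hu
  have hsu' : s < u := lt_of_le_of_ne hsu fun h => hu (h ▸ hs)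
  have : t < u := ((hX.2.2 v).reachIn hs ht).closed (T := {x | x < u}) hsu' fun a ha b hb hab => by
    have hne : b ≠ u := fun h => hu (h ▸ hb)
    have := pathGraph_adj.1 hab
    simp only [Set.mem_ofPred_eq, Fin.lt_def, ne_eq, Fin.ext_iff] at *
    omega
  exact absurd hut (not_le.2 this)

lemma exists_isTreeDecomp_of_pathwidth_le [Fintype β] {H : SimpleGraph β} {w : ℕ}
    (hw : pathwidth H ≤ w) : ∃ (n : ℕ) (X : Fin (n + 1) → Set β),
      IsTreeDecomp H (pathGraph (n + 1)) X ∧ ∀ t, (X t).ncard ≤ w + 1 := by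
  obtain ⟨n, X, hX, hc⟩ := Nat.sInf_mem (s := {w | ∃ (n : ℕ) (X : Fin (n + 1) → Set β),
      IsTreeDecomp H (pathGraph (n + 1)) X ∧ ∀ t, (X t).ncard ≤ w + 1})
    ⟨Fintype.card β, 0, fun _ => Set.univ, ⟨fun _ => ⟨0, trivial⟩, fun _ _ _ => ⟨0, trivial, trivial⟩,
      fun v => connected_induce_of_reachIn (a := 0) trivial fun b _ => by
        obtain rfl : b = 0 := Fin.ext (by omega)
        exact .refl trivial⟩, fun t => by simp [Set.ncard_univ]⟩
  exact ⟨n, X, hX, fun t => (hc t).trans (Nat.add_le_add_right hw 1)⟩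

/-- A vertex ordering of a graph of pathwidth at most `w`, together with the sets `A j` of earlier
vertices which still are active at the time `j`. -/
lemma exists_frontier_of_pathwidth_le [Fintype β] {H : SimpleGraph β} {h w : ℕ}
    (hcard : Fintype.card β = h) (hw : pathwidth H ≤ w) :
    ∃ (e : Fin h ≃ β) (A : ℕ → Finset ℕ), (∀ j, A j ⊆ Finset.range j) ∧ (∀ j, (A j).card ≤ w) ∧
      (∀ j, A (j + 1) ⊆ insert j (A j)) ∧
      ∀ i j : Fin h, i < j → H.Adj (e i) (e j) → (i : ℕ) ∈ A j := by
  classical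
  obtain ⟨n, X, hX, hXw⟩ := exists_isTreeDecomp_of_pathwidth_le hw
  have hmin : ∀ v, ∃ t, v ∈ X t ∧ ∀ s, v ∈ X s → t ≤ s := fun v => by
    obtain ⟨t, ht, h⟩ := wellFounded_lt.has_min {t | v ∈ X t} (hX.1 v)
    exact ⟨t, ht, fun s hs => not_lt.1 (h s hs)⟩
  choose l hl hlmin using hmin
  let e₀ : Fin h ≃ β := (Fintype.equivFinOfCardEq hcard).symm
  let e : Fin h ≃ β := (Tuple.sort (l ∘ e₀)).trans e₀
  have he : Monotone (l ∘ e) := Tuple.monotone_sort (l ∘ e₀)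
  refine ⟨e, fun j => (Finset.range j).filter fun i =>
    ∃ (hi : i < h) (hj : j < h), e ⟨i, hi⟩ ∈ X (l (e ⟨j, hj⟩)), fun j => Finset.filter_subset _ _,
    fun j => ?_, fun j i hi => ?_, fun i j hij hadj => ?_⟩
  · by_cases hj : j < h
    · refine Nat.le_of_succ_le_succ (le_trans ?_ (hXw (l (e ⟨j, hj⟩))))
      rw [Nat.succ_eq_add_one, ← Finset.card_insert_of_notMem (a := j) (by simp),
        ← Set.ncard_coe_finset]
      refine Set.ncard_le_ncard_of_injOn (fun i => if hi : i < h then e ⟨i, hi⟩ else e ⟨j, hj⟩)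
        (fun i hi => ?_) (fun i hi i' hi' hii => ?_) (Set.toFinite _)
      · simp only [Finset.coe_insert, Finset.coe_filter, Finset.mem_range, Set.mem_insert_iff,
          Set.mem_ofPred_eq] at hi
        rcases hi with rfl | ⟨-, hi, _, hmem⟩
        · simpa [hj] using hl _
        · simpa [hi] using hmem
      · have lt : ∀ i ∈ (insert j ((Finset.range j).filter fun i =>
            ∃ (hi : i < h) (hj : j < h), e ⟨i, hi⟩ ∈ X (l (e ⟨j, hj⟩))) : Finset ℕ), i < h := by
          intro i hi
          simp only [Finset.mem_insert, Finset.mem_filter, Finset.mem_range] at hi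
          omega
        have h1 := lt i hi
        have h2 := lt i' hi'
        simpa [h1, h2] using hii
    · simp [hj]
  · simp only [Finset.mem_filter, Finset.mem_range, Finset.mem_insert] at hi ⊢
    obtain ⟨hij, hi, hj, hmem⟩ := hi
    rcases Nat.lt_succ_iff_lt_or_eq.1 hij with hij | hij
    · exact .inr ⟨hij, hi, by omega, hX.mem_of_le_of_le (hl _) hmem
        (he (Fin.mk_le_mk.2 hij.le)) (he (Fin.mk_le_mk.2 (Nat.le_succ j)))⟩
    · exact .inl hij
  · obtain ⟨t, hit, hjt⟩ := hX.2.1 _ _ hadj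
    exact Finset.mem_filter.2 ⟨Finset.mem_range.2 hij, i.2, j.2,
      hX.mem_of_le_of_le (hl _) hit (he hij.le) (hlmin _ _ hjt)⟩

/-- Sets of size at most two which gain only new elements can be kept in two registers, one of
which is overwritten at a time. -/
lemma exists_registers {A : ℕ → Finset ℕ} (hA : ∀ j, A j ⊆ Finset.range j)
    (hc : ∀ j, (A j).card ≤ 2) (hs : ∀ j, A (j + 1) ⊆ insert j (A j)) :
    ∃ τ σ : ℕ → ℕ, τ 0 = 0 ∧ σ 0 = 0 ∧ (∀ t, ∀ i ∈ A (t + 1), i = τ t ∨ i = σ t) ∧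
      (∀ t, τ (t + 1) = τ t ∨ τ (t + 1) = t + 1) ∧ ∀ t, σ (t + 1) = σ t ∨ σ (t + 1) = t + 1 := by
  have step : ∀ (t : ℕ) (p : ℕ × ℕ), (∀ i ∈ A (t + 1), i = p.1 ∨ i = p.2) →
      ∃ q : ℕ × ℕ, (∀ i ∈ A (t + 2), i = q.1 ∨ i = q.2) ∧ (q.1 = p.1 ∨ q.1 = t + 1) ∧
        (q.2 = p.2 ∨ q.2 = t + 1) := by
    rintro t ⟨x, y⟩ hp
    have hold : ∀ i ∈ A (t + 2), i ≠ t + 1 → i = x ∨ i = y := fun i hi hne =>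
      hp i ((Finset.mem_insert.1 (hs _ hi)).resolve_left hne)
    by_cases ht : t + 1 ∈ A (t + 2)
    · have hone : ((A (t + 2)).erase (t + 1)).card ≤ 1 := by
        rw [Finset.card_erase_of_mem ht]
        have := hc (t + 2)
        omega
      by_cases hy : y ∈ (A (t + 2)).erase (t + 1)
      · refine ⟨(t + 1, y), fun i hi => ?_, .inr rfl, .inl rfl⟩
        by_cases hi' : i = t + 1
        · exact .inl hi'
        · exact .inr (Finset.card_le_one.1 hone i (Finset.mem_erase.2 ⟨hi', hi⟩) y hy)
      · refine ⟨(x, t + 1), fun i hi => ?_, .inl rfl, .inr rfl⟩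
        by_cases hi' : i = t + 1
        · exact .inr hi'
        · refine .inl ((hold i hi hi').resolve_right ?_)
          rintro rfl
          exact hy (Finset.mem_erase.2 ⟨hi', hi⟩)
    · exact ⟨(x, y), fun i hi => hold i hi fun h => ht (h ▸ hi), .inl rfl, .inl rfl⟩
  choose! f hf using step
  let s : ℕ → ℕ × ℕ := fun t => Nat.rec (0, 0) f t
  have hP : ∀ t, ∀ i ∈ A (t + 1), i = (s t).1 ∨ i = (s t).2 := by
    intro t
    induction t with
    | zero =>
      intro i hi
      have := hA _ hi
      exact .inl (show i = 0 by simpa using this)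
    | succ t ih => exact (hf t _ ih).1
  exact ⟨fun t => (s t).1, fun t => (s t).2, rfl, rfl, hP, fun t => (hf t _ (hP t)).2.1,
    fun t => (hf t _ (hP t)).2.2⟩

lemma Xi_adj_rung {r : ℕ} {k : Fin 3} (hk : k = 0 ∨ k = 2) (j : Fin r) :
    (Xi r).Adj (1, j) (k, j) := by
  rw [Xi, fromRel_adj]
  rcases hk with rfl | rfl <;> simp

lemma Xi_adj_succ {r : ℕ} {k : Fin 3} (hk : k = 0 ∨ k = 2) {i j : Fin r} (hij : (j : ℕ) = i + 1) :
    (Xi r).Adj (k, i) (k, j) := by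
  have : i ≠ j := fun h => by simp [h] at hij
  rw [Xi, fromRel_adj]
  rcases hk with rfl | rfl <;> simp [hij, this]

lemma reachIn_Xi_register {r : ℕ} {k : Fin 3} (hk : k = 0 ∨ k = 2) {ρ : ℕ → ℕ} (h0 : ρ 0 = 0)
    (hρ : ∀ t, ρ (t + 1) = ρ t ∨ ρ (t + 1) = t + 1) {f : Fin 3 × Fin r → ℕ}
    (hf : ∀ j : Fin r, f (1, j) = j) (hfk : ∀ j : Fin r, f (k, j) = ρ j) (c : ℕ) (hc : c < r) :
    ∃ hj : ρ c < r, (Xi r).ReachIn {s | f s = ρ c} (k, ⟨c, hc⟩) (1, ⟨ρ c, hj⟩) := by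
  have direct : ∀ c (hc : c < r), ρ c = c →
      ∃ hj : ρ c < r, (Xi r).ReachIn {s | f s = ρ c} (k, ⟨c, hc⟩) (1, ⟨ρ c, hj⟩) := by
    intro c hc h
    refine ⟨by omega, .cons (hfk _) ?_ (.refl (hf _))⟩
    simp only [h]
    exact (Xi_adj_rung hk _).symm
  induction c with
  | zero => exact direct 0 hc h0
  | succ c ih =>
    rcases hρ c with h | h
    · obtain ⟨hj, hr⟩ := ih (by omega)
      refine ⟨by omega, .cons (hfk _) (Xi_adj_succ hk (i := ⟨c, by omega⟩) rfl).symm ?_⟩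
      simpa only [h] using hr
    · exact direct _ hc h

/-- A graph of pathwidth at most two on `h` vertices is a minor of `Ξ_h`. -/
lemma isMinor_Xi_of_pathwidth_le [Fintype β] {H : SimpleGraph β} {h : ℕ}
    (hcard : Fintype.card β = h) (hw : pathwidth H ≤ 2) : IsMinor H (Xi h) := by
  obtain ⟨e, A, hA, hc, hs, hadj⟩ := exists_frontier_of_pathwidth_le hcard hw
  obtain ⟨τ, σ, hτ0, hσ0, hAρ, hτ, hσ⟩ := exists_registers hA hc hs
  let f : Fin 3 × Fin h → ℕ := fun s => ![τ s.2, s.2, σ s.2] s.1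
  have hf : ∀ j : Fin h, f (1, j) = j := fun _ => rfl
  have hfτ : ∀ j : Fin h, f (0, j) = τ j := fun _ => rfl
  have hfσ : ∀ j : Fin h, f (2, j) = σ j := fun _ => rfl
  refine ⟨fun u => {s | f s = e.symm u}, fun u => ?_, fun u v huv => ?_, ?_⟩
  · refine connected_induce_of_reachIn (a := (1, e.symm u)) rfl fun s hs => ?_
    have finish : ∀ {c} {s : Fin 3 × Fin h}, f s = e.symm u → c = f s →
        (∃ hj : c < h, (Xi h).ReachIn {s | f s = c} s (1, ⟨c, hj⟩)) →
        (Xi h).ReachIn {s | f s = e.symm u} (1, e.symm u) s := by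
      rintro c s h1 rfl ⟨hj, hr⟩
      simp only [h1] at hr
      exact hr.symm
    obtain ⟨k, j⟩ := s
    fin_cases k
    · exact finish hs rfl (reachIn_Xi_register (.inl rfl) hτ0 hτ hf hfτ j j.2)
    · have : j = e.symm u := Fin.ext hs
      rw [← this]
      exact .refl hs
    · exact finish hs rfl (reachIn_Xi_register (.inr rfl) hσ0 hσ hf hfσ j j.2)
  · refine Set.disjoint_left.2 fun s h1 h2 => ?_
    exact huv (e.symm.injective (Fin.ext (h1.symm.trans h2)))
  · have key : ∀ (k : Fin 3) (ρ : ℕ → ℕ), (k = 0 ∨ k = 2) → (∀ j : Fin h, f (k, j) = ρ j) →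
        (∀ t, ρ (t + 1) = ρ t ∨ ρ (t + 1) = t + 1) → ∀ i j : Fin h, ∀ t, (j : ℕ) = t + 1 →
        (i : ℕ) = ρ t → ∃ a, f a = i ∧ ∃ b, f b = j ∧ (Xi h).Adj a b := by
      intro k ρ hk hfk hρ i j t hj hi
      have ht : t < h := by omega
      rcases hρ t with h' | h'
      · exact ⟨(k, j), by rw [hfk, hj, h', hi], (1, j), rfl, (Xi_adj_rung hk j).symm⟩
      · exact ⟨(k, ⟨t, ht⟩), by rw [hfk, hi], (k, j), by rw [hfk, hj, h'], Xi_adj_succ hk hj⟩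
    have dir : ∀ i j : Fin h, i < j → H.Adj (e i) (e j) →
        ∃ a, f a = i ∧ ∃ b, f b = j ∧ (Xi h).Adj a b := by
      intro i j hij hH
      obtain ⟨t, ht⟩ : ∃ t, (j : ℕ) = t + 1 := ⟨j - 1, by rw [Fin.lt_def] at hij; omega⟩
      have := hadj i j hij hH
      rw [ht] at this
      rcases hAρ t i this with h' | h'
      exacts [key 0 τ (.inl rfl) hfτ hτ i j t ht h', key 2 σ (.inr rfl) hfσ hσ i j t ht h']
    intro u v huv
    have hne : e.symm u ≠ e.symm v := e.symm.injective.ne huv.ne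
    rcases lt_or_gt_of_ne hne with hlt | hlt
    · exact dir _ _ hlt (by simpa using huv)
    · obtain ⟨a, ha, b, hb, hab⟩ := dir _ _ hlt (by simpa using huv.symm)
      exact ⟨b, hb, a, ha, hab.symm⟩

/-- `Ξ_{mr}` contains `m` disjoint copies of `Ξ_r`. -/
lemma exists_disjoint_models_of_isMinorModel_Xi {H : SimpleGraph β} {G : SimpleGraph α} {r m : ℕ}
    {M : Fin 3 × Fin (m * r) → Set α} {U : Set α} (hH : IsMinor H (Xi r))
    (hG : IsMinorModel (Xi (m * r)) G M) (hU : ∀ s, M s ⊆ U) :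
    ∃ N : Fin m → β → Set α, (∀ i, IsMinorModel H G (N i)) ∧ (∀ i u, N i u ⊆ U) ∧
      Pairwise fun i j => Disjoint (⋃ u, N i u) (⋃ u, N j u) := by
  obtain ⟨B, hBc, hBd, hBa⟩ := hH
  obtain ⟨hMc, hMd, hMa⟩ := hG
  let f : Fin m → Fin 3 × Fin r → Fin 3 × Fin (m * r) := fun c s => (s.1, finProdFinEquiv (c, s.2))
  have hf : ∀ c c' s s', f c s = f c' s' → c = c' ∧ s = s' := by
    rintro c c' ⟨k, j⟩ ⟨k', j'⟩ h
    have := Prod.ext_iff.1 h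
    simpa [f, and_left_comm] using this
  have hdisj : ∀ c c' s s', ¬ (c = c' ∧ s = s') → Disjoint (M (f c s)) (M (f c' s')) :=
    fun c c' s s' h => hMd fun h' => h (hf _ _ _ _ h')
  have hadj : ∀ c s s', (Xi r).Adj s s' → (Xi (m * r)).Adj (f c s) (f c s') := by
    intro c s s' h
    rw [Xi, fromRel_adj] at h ⊢
    refine ⟨fun h' => h.1 (hf _ _ _ _ h').2, ?_⟩
    have key : ∀ s s' : Fin 3 × Fin r, _ → _ := fun s s' (h :
        (s.1 = 0 ∧ s'.1 = 0 ∧ (s'.2 : ℕ) = (s.2 : ℕ) + 1) ∨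
        (s.1 = 2 ∧ s'.1 = 2 ∧ (s'.2 : ℕ) = (s.2 : ℕ) + 1) ∨
        (s.1 = 1 ∧ s.2 = s'.2 ∧ (s'.1 = 0 ∨ s'.1 = 2))) =>
      show (s.1 = 0 ∧ s'.1 = 0 ∧ ((f c s').2 : ℕ) = ((f c s).2 : ℕ) + 1) ∨
        (s.1 = 2 ∧ s'.1 = 2 ∧ ((f c s').2 : ℕ) = ((f c s).2 : ℕ) + 1) ∨
        (s.1 = 1 ∧ (f c s).2 = (f c s').2 ∧ (s'.1 = 0 ∨ s'.1 = 2)) by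
        rcases h with ⟨h1, h2, h3⟩ | ⟨h1, h2, h3⟩ | ⟨h1, h2, h3⟩
        · exact .inl ⟨h1, h2, by simp [f, h3]; ring⟩
        · exact .inr (.inl ⟨h1, h2, by simp [f, h3]; ring⟩)
        · exact .inr (.inr ⟨h1, by simp [f, h2], h3⟩)
    exact h.2.imp (key _ _) (key _ _)
  refine ⟨fun c u => ⋃ s ∈ B u, M (f c s), fun c => ⟨fun u => ?_, fun u v huv => ?_, ?_⟩,
    fun c u => Set.iUnion₂_subset fun s _ => hU _, ?_⟩
  · exact connected_induce_biUnion (hBc u) (fun s _ => hMc _) fun s t h => hMa _ _ (hadj c s t h)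
  · simp only [Set.disjoint_iUnion_left, Set.disjoint_iUnion_right]
    rintro t ht s hs
    exact hdisj _ _ _ _ fun h => Set.disjoint_left.1 (hBd huv) hs (h.2 ▸ ht)
  · intro u v huv
    obtain ⟨s, hs, t, ht, hst⟩ := hBa u v huv
    obtain ⟨a, ha, b, hb, hab⟩ := hMa _ _ (hadj c s t hst)
    exact ⟨a, Set.mem_biUnion hs ha, b, Set.mem_biUnion ht hb, hab⟩
  · intro c c' hcc
    simp only [Set.disjoint_iUnion_left, Set.disjoint_iUnion_right]
    rintro v t ht u s hs
    exact hdisj _ _ _ _ fun h => hcc h.1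

end SimpleGraph

namespace SimpleGraph

variable {α β : Type*}

/-- The subgraph of `H` induced on `W` has a model in the subgraph of `G` induced on `X`. -/
def HasModelIn (H : SimpleGraph β) (G : SimpleGraph α) (W : Finset β) (X : Finset α) : Prop :=
  ∃ B : β → Set α, (∀ u ∈ W, (G.induce (B u)).Connected ∧ B u ⊆ X) ∧
    (∀ u ∈ W, ∀ v ∈ W, u ≠ v → Disjoint (B u) (B v)) ∧
    ∀ u ∈ W, ∀ v ∈ W, H.Adj u v → ∃ a ∈ B u, ∃ b ∈ B v, G.Adj a b

namespace HasModelIn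

variable {H : SimpleGraph β} {G : SimpleGraph α} {W W₁ : Finset β} {X X₁ X₂ : Finset α}

lemma mono (h : HasModelIn H G W X₁) (hX : X₁ ⊆ X₂) : HasModelIn H G W X₂ := by
  obtain ⟨B, h1, h2, h3⟩ := h
  exact ⟨B, fun u hu => ⟨(h1 u hu).1, (h1 u hu).2.trans (Finset.coe_subset.2 hX)⟩, h2, h3⟩

lemma nonempty (h : HasModelIn H G W X) (hW : W.Nonempty) : X.Nonempty := by
  obtain ⟨B, h1, -⟩ := h
  obtain ⟨u, hu⟩ := hW
  obtain ⟨a, ha⟩ := (h1 u hu).1.nonempty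
  exact ⟨a, (h1 u hu).2 ha⟩

variable [DecidableEq α] [DecidableEq β]

lemma exists_split (h : HasModelIn H G W (X₁ ∪ X₂))
    (hadj : ∀ a ∈ X₁, ∀ b ∈ X₂, ¬ G.Adj a b) :
    ∃ W₁ ⊆ W, (∀ u ∈ W₁, ∀ v ∈ W \ W₁, ¬ H.Adj u v) ∧ HasModelIn H G W₁ X₁ ∧
      HasModelIn H G (W \ W₁) X₂ := by
  classical
  obtain ⟨B, h1, h2, h3⟩ := h
  let W₁ := W.filter fun u => B u ⊆ X₁
  have hW : ∀ u ∈ W \ W₁, B u ⊆ X₂ := by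
    intro u hu
    obtain ⟨huW, hu⟩ := Finset.mem_sdiff.1 hu
    obtain ⟨a, ha, haX⟩ := Set.not_subset.1 fun h => hu (Finset.mem_filter.2 ⟨huW, h⟩)
    have haX₂ : a ∈ X₂ := (Finset.mem_union.1 ((h1 u huW).2 ha)).resolve_left haX
    intro b hb
    refine ((h1 u huW).1.reachIn ha hb).closed (T := (X₂ : Set α)) haX₂ fun x hx y hy hxy => ?_
    exact (Finset.mem_union.1 ((h1 u huW).2 hy)).resolve_left fun hyX => hadj y hyX x hx hxy.symm
  have sub : ∀ u ∈ W \ W₁, u ∈ W := fun u hu => (Finset.mem_sdiff.1 hu).1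
  refine ⟨W₁, Finset.filter_subset _ _, fun u hu v hv huv => ?_,
    ⟨B, fun u hu => ?_, fun u hu v hv => ?_, fun u hu v hv => ?_⟩,
    ⟨B, fun u hu => ⟨(h1 u (sub u hu)).1, hW u hu⟩, fun u hu v hv => h2 u (sub u hu) v (sub v hv),
      fun u hu v hv => h3 u (sub u hu) v (sub v hv)⟩⟩
  · obtain ⟨huW, hu⟩ := Finset.mem_filter.1 hu
    obtain ⟨a, ha, b, hb, hab⟩ := h3 u huW v (sub v hv) huv
    exact hadj a (hu ha) b (hW v hv hb) hab
  · obtain ⟨huW, hu⟩ := Finset.mem_filter.1 hu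
    exact ⟨(h1 u huW).1, hu⟩
  · exact h2 u (Finset.mem_filter.1 hu).1 v (Finset.mem_filter.1 hv).1
  · exact h3 u (Finset.mem_filter.1 hu).1 v (Finset.mem_filter.1 hv).1

lemma join (hadj : ∀ u ∈ W₁, ∀ v ∈ W \ W₁, ¬ H.Adj u v) (h₁ : HasModelIn H G W₁ X₁)
    (h₂ : HasModelIn H G (W \ W₁) X₂) (hd : Disjoint X₁ X₂) : HasModelIn H G W (X₁ ∪ X₂) := by
  obtain ⟨B₁, h1, h2, h3⟩ := h₁
  obtain ⟨B₂, k1, k2, k3⟩ := h₂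
  have hd' : ∀ u ∈ W₁, ∀ v ∈ W \ W₁, Disjoint (B₁ u) (B₂ v) := fun u hu v hv =>
    Set.disjoint_of_subset (h1 u hu).2 (k1 v hv).2 (Finset.disjoint_coe.2 hd)
  have mem : ∀ u ∈ W, u ∉ W₁ → u ∈ W \ W₁ := fun u h h' => Finset.mem_sdiff.2 ⟨h, h'⟩
  refine ⟨fun u => if u ∈ W₁ then B₁ u else B₂ u, fun u hu => ?_, fun u hu v hv huv => ?_,
    fun u hu v hv huv => ?_⟩
  · by_cases h : u ∈ W₁
    · beta_reduce
      rw [if_pos h]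
      exact ⟨(h1 u h).1, (h1 u h).2.trans (by simp)⟩
    · beta_reduce
      rw [if_neg h]
      exact ⟨(k1 u (mem u hu h)).1, (k1 u (mem u hu h)).2.trans (by simp)⟩
  · by_cases h : u ∈ W₁ <;> by_cases h' : v ∈ W₁ <;> simp only [h, h', if_true, if_false]
    · exact h2 u h v h' huv
    · exact hd' u h v (mem v hv h')
    · exact (hd' v h' u (mem u hu h)).symm
    · exact k2 u (mem u hu h) v (mem v hv h') huv
  · by_cases h : u ∈ W₁ <;> by_cases h' : v ∈ W₁ <;> simp only [h, h', if_true, if_false]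
    · exact h3 u h v h' huv
    · exact absurd huv (hadj u h v (mem v hv h'))
    · exact absurd huv.symm (hadj v h' u (mem u hu h))
    · exact k3 u (mem u hu h) v (mem v hv h') huv

end HasModelIn

variable [DecidableEq α]

/-- `U` contains `k` pairwise disjoint models of the subgraph of `H` induced on `W`. -/
def Packs (H : SimpleGraph β) (G : SimpleGraph α) (W : Finset β) : ℕ → Finset α → Prop
  | 0, _ => True
  | k + 1, U => ∃ X ⊆ U, HasModelIn H G W X ∧ Packs H G W k (U \ X)

namespace Packs

variable {H : SimpleGraph β} {G : SimpleGraph α} {W W₁ : Finset β} {k l : ℕ} {U U₁ U₂ : Finset α}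

lemma mono (h : Packs H G W k U₁) (hU : U₁ ⊆ U₂) : Packs H G W k U₂ := by
  induction k generalizing U₁ U₂ with
  | zero => trivial
  | succ k ih =>
    obtain ⟨X, hX, hm, h⟩ := h
    exact ⟨X, hX.trans hU, hm, ih h (Finset.sdiff_subset_sdiff hU le_rfl)⟩

lemma of_le (h : Packs H G W l U) (hkl : k ≤ l) : Packs H G W k U := by
  induction k generalizing l U with
  | zero => trivial
  | succ k ih =>
    obtain ⟨l, rfl⟩ : ∃ l', l = l' + 1 := ⟨l - 1, by omega⟩
    obtain ⟨X, hX, hm, h⟩ := h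
    exact ⟨X, hX, hm, ih h (by omega)⟩

lemma add (h₁ : Packs H G W k U₁) (h₂ : Packs H G W l U₂) (hd : Disjoint U₁ U₂) :
    Packs H G W (k + l) (U₁ ∪ U₂) := by
  induction k generalizing U₁ with
  | zero =>
    rw [zero_add]
    exact h₂.mono Finset.subset_union_right
  | succ k ih =>
    obtain ⟨X, hX, hm, h⟩ := h₁
    rw [Nat.succ_add]
    refine ⟨X, hX.trans Finset.subset_union_left, hm,
      (ih h (hd.mono_left Finset.sdiff_subset)).mono ?_⟩
    rw [Finset.union_sdiff_distrib, Finset.sdiff_eq_self_of_disjoint (hd.symm.mono_right hX)]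

lemma empty_left : Packs H G ∅ k U := by
  induction k generalizing U with
  | zero => trivial
  | succ k ih => exact ⟨∅, by simp, ⟨fun _ => ∅, by simp, by simp, by simp⟩, ih⟩

lemma not_empty (hW : W.Nonempty) : ¬ Packs H G W (k + 1) ∅ := by
  rintro ⟨X, hX, hm, -⟩
  obtain ⟨a, ha⟩ := hm.nonempty hW
  simpa using hX ha

lemma join [DecidableEq β] (hadj : ∀ u ∈ W₁, ∀ v ∈ W \ W₁, ¬ H.Adj u v) (h₁ : Packs H G W₁ k U₁)
    (h₂ : Packs H G (W \ W₁) k U₂) (hd : Disjoint U₁ U₂) : Packs H G W k (U₁ ∪ U₂) := by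
  induction k generalizing U₁ U₂ with
  | zero => trivial
  | succ k ih =>
    obtain ⟨X₁, hX₁, hm₁, h₁⟩ := h₁
    obtain ⟨X₂, hX₂, hm₂, h₂⟩ := h₂
    refine ⟨X₁ ∪ X₂, Finset.union_subset_union hX₁ hX₂,
      hm₁.join hadj hm₂ (Finset.disjoint_of_subset_left hX₁ (hd.mono_right hX₂)),
      (ih h₁ h₂ (Finset.disjoint_of_subset_left Finset.sdiff_subset
        (hd.mono_right Finset.sdiff_subset))).mono fun a ha => ?_⟩
    have h1 : a ∈ U₁ → a ∉ U₂ := fun h => Finset.disjoint_left.1 hd h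
    have h2 := @hX₁ a
    have h3 := @hX₂ a
    simp only [Finset.mem_union, Finset.mem_sdiff] at ha ⊢
    tauto

lemma of_models [Fintype α] {N : Fin k → β → Set α} (hN : ∀ i, IsMinorModel H G (N i))
    (hU : ∀ i u, N i u ⊆ U) (hd : Pairwise fun i j => Disjoint (⋃ u, N i u) (⋃ u, N j u)) :
    Packs H G W k U := by
  classical
  induction k generalizing U with
  | zero => trivial
  | succ k ih =>
    refine ⟨(⋃ u, N 0 u).toFinset, fun a ha => ?_, ⟨N 0, fun u _ => ⟨(hN 0).1 u, ?_⟩,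
      fun u _ v _ huv => (hN 0).2.1 huv, fun u _ v _ huv => (hN 0).2.2 u v huv⟩,
      ih (N := fun i => N i.succ) (fun i => hN _) (fun i u a ha => ?_)
        fun i j hij => hd (by simpa using hij)⟩
    · obtain ⟨u, hu⟩ := Set.mem_iUnion.1 (Set.mem_toFinset.1 ha)
      exact hU 0 u hu
    · rw [Set.coe_toFinset]
      exact Set.subset_iUnion _ u
    · have h1 := hU _ u ha
      have h2 : a ∉ ⋃ u, N 0 u :=
        Set.disjoint_left.1 (hd (Fin.succ_ne_zero i)) (Set.mem_iUnion.2 ⟨u, ha⟩)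
      rw [Finset.coe_sdiff, Set.coe_toFinset]
      exact ⟨h1, h2⟩

lemma hasDisjointModels [Fintype β] (h : Packs H G Finset.univ k U) : HasDisjointModels H G k := by
  suffices ∃ M : Fin k → β → Set α, (∀ i, IsMinorModel H G (M i)) ∧ (∀ i u, M i u ⊆ U) ∧
      Pairwise fun i j => Disjoint (⋃ u, M i u) (⋃ u, M j u) by
    obtain ⟨M, h1, -, h2⟩ := this
    exact ⟨M, h1, h2⟩
  induction k generalizing U with
  | zero => exact ⟨fun i => i.elim0, fun i => i.elim0, fun i => i.elim0, fun i => i.elim0⟩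
  | succ k ih =>
    obtain ⟨X, hX, ⟨B, h1, h2, h3⟩, h⟩ := h
    obtain ⟨M, hM, hMU, hd⟩ := ih h
    have hB : ∀ i, Disjoint (⋃ u, B u) (⋃ u, M i u) := by
      intro i
      simp only [Set.disjoint_iUnion_left, Set.disjoint_iUnion_right]
      intro u v
      refine Set.disjoint_left.2 fun a ha hb => ?_
      exact (Finset.mem_sdiff.1 (hMU i _ hb)).2 ((h1 _ (Finset.mem_univ _)).2 ha)
    refine ⟨Fin.cons B M, Fin.cases ?_ fun i => ?_, Fin.cases (fun u => ?_) fun i u => ?_,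
      Fin.cases (Fin.cases ?_ fun j hj => ?_) fun i => Fin.cases (fun hj => ?_) fun j hj => ?_⟩
    · exact ⟨fun u => (h1 u (Finset.mem_univ _)).1,
        fun u v huv => h2 u (Finset.mem_univ _) v (Finset.mem_univ _) huv,
        fun u v huv => h3 u (Finset.mem_univ _) v (Finset.mem_univ _) huv⟩
    · exact hM i
    · exact (h1 u (Finset.mem_univ _)).2.trans (Finset.coe_subset.2 hX)
    · exact (hMU i u).trans (Finset.coe_subset.2 Finset.sdiff_subset)
    · exact fun h => absurd rfl h
    · exact hB j
    · exact (hB i).symm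
    · exact hd fun h => hj (congrArg Fin.succ h)

end Packs

end SimpleGraph

namespace SimpleGraph

variable {α β : Type*} {H : SimpleGraph β} {G : SimpleGraph α}

lemma exists_hitting_union [DecidableEq α] [DecidableEq β] {W : Finset β} {X₁ X₂ S₁ S₂ : Finset α}
    {k m : ℕ} (hadj : ∀ a ∈ X₁, ∀ b ∈ X₂, ¬ G.Adj a b) (hd : Disjoint X₁ X₂)
    (hP : ¬ Packs H G W k (X₁ ∪ X₂))
    (hsub : ∀ W' ⊂ W, ∀ Y, ¬ Packs H G W' k Y → ∃ S, S.card ≤ m ∧ ¬ HasModelIn H G W' (Y \ S))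
    (h₁ : ¬ HasModelIn H G W (X₁ \ S₁)) (h₂ : ¬ HasModelIn H G W (X₂ \ S₂)) :
    ∃ S, S.card ≤ S₁.card + S₂.card + 2 ^ W.card * m ∧ ¬ HasModelIn H G W ((X₁ ∪ X₂) \ S) := by
  have hex : ∀ W₁ : Finset β, ∃ T : Finset α, T.card ≤ m ∧ (W₁ ⊂ W → W₁ ≠ ∅ →
      (∀ u ∈ W₁, ∀ v ∈ W \ W₁, ¬ H.Adj u v) →
      ¬ (HasModelIn H G W₁ (X₁ \ T) ∧ HasModelIn H G (W \ W₁) (X₂ \ T))) := by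
    intro W₁
    by_cases hW : W₁ ⊂ W ∧ W₁ ≠ ∅ ∧ ∀ u ∈ W₁, ∀ v ∈ W \ W₁, ¬ H.Adj u v
    · obtain ⟨hW, hne, hWadj⟩ := hW
      by_cases hp : Packs H G W₁ k X₁
      · obtain ⟨T, hT, hm⟩ := hsub (W \ W₁)
          (Finset.sdiff_ssubset hW.1 (Finset.nonempty_iff_ne_empty.2 hne)) X₂
          fun h => hP (hp.join hWadj h hd)
        exact ⟨T, hT, fun _ _ _ h => hm h.2⟩
      · obtain ⟨T, hT, hm⟩ := hsub W₁ hW X₁ hp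
        exact ⟨T, hT, fun _ _ _ h => hm h.1⟩
    · exact ⟨∅, by simp, fun h1 h2 h3 => absurd ⟨h1, h2, h3⟩ hW⟩
  choose T hTm hT using hex
  refine ⟨S₁ ∪ S₂ ∪ W.powerset.biUnion T, ?_, fun h => ?_⟩
  · have h3 := Finset.card_biUnion_le_card_mul W.powerset T m fun W₁ _ => hTm W₁
    rw [Finset.card_powerset] at h3
    have h4 := Finset.card_union_le (S₁ ∪ S₂) (W.powerset.biUnion T)
    have h5 := Finset.card_union_le S₁ S₂
    omega
  · rw [Finset.union_sdiff_distrib] at h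
    obtain ⟨W₁, hW₁, hWadj, hm₁, hm₂⟩ := h.exists_split
      (fun a ha b hb => hadj a (Finset.mem_sdiff.1 ha).1 b (Finset.mem_sdiff.1 hb).1)
    have sub : ∀ {S : Finset α}, S ⊆ S₁ ∪ S₂ ∪ W.powerset.biUnion T → ∀ X : Finset α,
        X \ (S₁ ∪ S₂ ∪ W.powerset.biUnion T) ⊆ X \ S := fun hS X =>
      Finset.sdiff_subset_sdiff le_rfl hS
    have hTsub : T W₁ ⊆ S₁ ∪ S₂ ∪ W.powerset.biUnion T :=
      (Finset.subset_biUnion_of_mem T (Finset.mem_powerset.2 hW₁)).trans Finset.subset_union_right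
    by_cases hne : W₁ = ∅
    · rw [hne, Finset.sdiff_empty] at hm₂
      exact h₂ (hm₂.mono (sub (Finset.subset_union_right.trans Finset.subset_union_left) _))
    by_cases heq : W₁ = W
    · rw [heq] at hm₁
      exact h₁ (hm₁.mono (sub (Finset.subset_union_left.trans Finset.subset_union_left) _))
    exact hT W₁ (hW₁.ssubset_of_ne heq) hne hWadj ⟨hm₁.mono (sub hTsub _), hm₂.mono (sub hTsub _)⟩

/-- A family of pairwise intersecting connected subsets of `U` which no small set covers forces
many disjoint models of a graph of pathwidth at most two in `U`. -/
lemma CoverAtLeast.packs [Fintype α] [DecidableEq α] [Fintype β] {F : Set (Finset α)}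
    {U : Finset α} {h m : ℕ} (hcard : Fintype.card β = h) (hw : pathwidth H ≤ 2)
    (hconn : ∀ X ∈ F, X ⊆ U ∧ (G.induce (X : Set α)).Connected)
    (hinter : ∀ X ∈ F, ∀ Y ∈ F, ∃ v ∈ X, v ∈ Y) (hF : CoverAtLeast F (6 * (m * h + 1) ^ 2))
    (W : Finset β) : Packs H G W m U := by
  let G' : SimpleGraph α :=
    { Adj := fun a b => G.Adj a b ∧ a ∈ U ∧ b ∈ U
      symm := ⟨fun _ _ h => ⟨h.1.symm, h.2.2, h.2.1⟩⟩
      loopless := ⟨fun _ h => h.1.ne rfl⟩ }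
  have transfer : ∀ {G₁ G₂ : SimpleGraph α} {Z : Set α}, (G₁.induce Z).Connected →
      (∀ a ∈ Z, ∀ b ∈ Z, G₁.Adj a b → G₂.Adj a b) → (G₂.induce Z).Connected := by
    intro G₁ G₂ Z hZ hG
    obtain ⟨a, ha⟩ := hZ.nonempty
    exact connected_induce_of_reachIn ha fun b hb =>
      (hZ.reachIn ha hb).mono_of_adj subset_rfl hG
  obtain ⟨M, hM, hMd, hMa⟩ := hF.isMinor_Xi (G := G') (fun X hX =>
    transfer (hconn X hX).2 fun a ha b hb hab => ⟨hab, (hconn X hX).1 ha, (hconn X hX).1 hb⟩) hinter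
  have hMU : ∀ s, M s ⊆ U := by
    rintro ⟨k, j⟩
    obtain ⟨t, ht⟩ : ∃ t, (Xi (m * h)).Adj (k, j) t := by
      by_cases hk : k = 1
      · exact ⟨(0, j), hk ▸ Xi_adj_rung (.inl rfl) j⟩
      · exact ⟨(1, j), (Xi_adj_rung (by omega) j).symm⟩
    obtain ⟨a, ha, b, hb, hab⟩ := hMa _ _ ht
    exact fun x hx => ((hM _).reachIn ha hx).closed (T := (U : Set α)) hab.2.1
      fun _ _ _ _ h => h.2.2
  obtain ⟨N, hN, hNU, hNd⟩ := exists_disjoint_models_of_isMinorModel_Xi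
    (isMinor_Xi_of_pathwidth_le hcard hw)
    (M := M) (G := G) ⟨fun s => transfer (hM s) fun _ _ _ _ h => h.1, hMd, fun s t hst => by
      obtain ⟨a, ha, b, hb, hab⟩ := hMa s t hst
      exact ⟨a, ha, b, hb, hab.1⟩⟩ hMU
  exact Packs.of_models hN hNU hNd

/-- A set of vertices in which each connected subset has small packing number splits into three
mutually nonadjacent parts with small packing number. -/
lemma exists_partition_of_connected [DecidableEq α] {W : Finset β} {U : Finset α} {k : ℕ}
    (hW : W.Nonempty) (hU : ¬ Packs H G W (k + 1 + (k + 1)) U)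
    (hconn : ∀ X ⊆ U, (G.induce (X : Set α)).Connected → ¬ Packs H G W (k + 1) X) :
    ∃ L C R : Finset α, L ∪ (C ∪ R) = U ∧ Disjoint L (C ∪ R) ∧ Disjoint C R ∧
      (∀ a ∈ L, ∀ b ∈ C ∪ R, ¬ G.Adj a b) ∧ (∀ a ∈ C, ∀ b ∈ R, ¬ G.Adj a b) ∧
      ¬ Packs H G W (k + 1) L ∧ ¬ Packs H G W (k + 1) C ∧ ¬ Packs H G W (k + 1) R := by
  classical
  obtain ⟨L, hL, hmax⟩ := (U.powerset.filter fun L =>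
      (∀ a ∈ L, ∀ b ∈ U, G.Adj a b → b ∈ L) ∧ ¬ Packs H G W (k + 1) L).exists_max_image Finset.card
    ⟨∅, by simpa using Packs.not_empty hW⟩
  obtain ⟨hLU, hLadj, hLP⟩ : L ⊆ U ∧ (∀ a ∈ L, ∀ b ∈ U, G.Adj a b → b ∈ L) ∧
    ¬ Packs H G W (k + 1) L := by simpa using hL
  by_cases hLeq : L = U
  · exact ⟨L, ∅, ∅, by simpa using hLeq, by simp, by simp, by simp, by simp, hLP,
      Packs.not_empty hW, Packs.not_empty hW⟩
  obtain ⟨v, hvU, hvL⟩ := Finset.exists_of_ssubset (hLU.ssubset_of_ne hLeq)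
  let C := U.filter fun x => G.ReachIn U v x
  have hCU : C ⊆ U := Finset.filter_subset _ _
  have hCset : (C : Set α) = {x | G.ReachIn U v x} := by
    ext x
    simpa [C] using fun h => h.right_mem
  have hvC : v ∈ C := Finset.mem_filter.2 ⟨hvU, .refl hvU⟩
  have hCadj : ∀ a ∈ C, ∀ b ∈ U, G.Adj a b → b ∈ C := fun a ha b hb hab =>
    Finset.mem_filter.2 ⟨hb, (Finset.mem_filter.1 ha).2.snoc hab hb⟩
  have hLC : Disjoint L C := Finset.disjoint_left.2 fun x hxL hxC =>
    hvL ((Finset.mem_filter.1 hxC).2.symm.closed (T := (L : Set α)) hxL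
      fun a ha b hb hab => hLadj a ha b hb hab)
  have hCP : ¬ Packs H G W (k + 1) C := hconn C hCU (by
    rw [hCset]
    exact connected_induce_setOf_reachIn hvU)
  have hLCadj : ∀ a ∈ L ∪ C, ∀ b ∈ U, G.Adj a b → b ∈ L ∪ C := fun a ha b hb hab => by
    rcases Finset.mem_union.1 ha with ha | ha
    · exact Finset.mem_union_left _ (hLadj a ha b hb hab)
    · exact Finset.mem_union_right _ (hCadj a ha b hb hab)
  have hLCP : Packs H G W (k + 1) (L ∪ C) := by
    by_contra hP
    have := hmax (L ∪ C) (by 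
      simp only [Finset.mem_filter, Finset.mem_powerset]
      exact ⟨Finset.union_subset hLU hCU, hLCadj, hP⟩)
    rw [Finset.card_union_of_disjoint hLC] at this
    have := Finset.card_pos.2 ⟨v, hvC⟩
    omega
  have hRU : L ∪ C ∪ U \ (L ∪ C) = U :=
    Finset.union_sdiff_of_subset (Finset.union_subset hLU hCU)
  refine ⟨L, C, U \ (L ∪ C), by rw [← Finset.union_assoc, hRU], ?_, ?_, fun a ha b hb hab => ?_,
    fun a ha b hb hab => ?_, hLP, hCP, fun hP => hU ?_⟩
  · refine Finset.disjoint_union_right.2 ⟨hLC, Finset.disjoint_sdiff.mono_left ?_⟩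
    exact Finset.subset_union_left
  · exact Finset.disjoint_sdiff.mono_left Finset.subset_union_right
  · have hbU : b ∈ U := (Finset.mem_union.1 hb).elim (fun h => hCU h)
      fun h => (Finset.mem_sdiff.1 h).1
    have hbL := hLadj a ha b hbU hab
    rcases Finset.mem_union.1 hb with h | h
    · exact Finset.disjoint_left.1 hLC hbL h
    · exact (Finset.mem_sdiff.1 h).2 (Finset.mem_union_left _ hbL)
  · obtain ⟨hbU, hb⟩ := Finset.mem_sdiff.1 hb
    exact hb (Finset.mem_union_right _ (hCadj a ha b hbU hab))
  · rw [← hRU]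
    exact hLCP.add hP Finset.disjoint_sdiff

/-- The constant `c` such that subgraphs on `w` vertices have the Erdős–Pósa property with gap
`c * k ^ 2`, where `A * k ^ 2` vertices are needed for a family of intersecting connected sets. -/
def erdosPosaGap (A : ℕ) : ℕ → ℕ
  | 0 => 0
  | w + 1 => 4 * (A + 2 ^ (w + 2) * erdosPosaGap A w)

lemma erdosPosaGap_le (A w : ℕ) : erdosPosaGap A w ≤ A * 2 ^ (w + 3) ^ 2 := by
  induction w with
  | zero => simp [erdosPosaGap]
  | succ w ih =>
    have h1 : 4 ≤ 2 ^ ((w + 3) ^ 2 + (w + 4)) :=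
      (Nat.pow_le_pow_right (by norm_num) (by omega : 2 ≤ (w + 3) ^ 2 + (w + 4))).trans' (by norm_num)
    calc erdosPosaGap A (w + 1) = 4 * A + 2 ^ (w + 4) * erdosPosaGap A w := by
          rw [erdosPosaGap]
          ring
      _ ≤ 2 ^ ((w + 3) ^ 2 + (w + 4)) * A + 2 ^ (w + 4) * (A * 2 ^ (w + 3) ^ 2) := by gcongr
      _ = A * 2 ^ ((w + 3) ^ 2 + (w + 4) + 1) := by ring
      _ ≤ A * 2 ^ (w + 1 + 3) ^ 2 := by
          gcongr
          · norm_num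
          · nlinarith

lemma exists_hitting_of_not_packs [Fintype α] [DecidableEq α] [Fintype β] {h : ℕ}
    (hcard : Fintype.card β = h) (hw : pathwidth H ≤ 2) (w : ℕ) (W : Finset β) (hWw : W.card ≤ w)
    (k : ℕ) (U : Finset α) (hU : ¬ Packs H G W (k + 1) U) :
    ∃ S, S.card ≤ erdosPosaGap (54 * h ^ 2) w * k ^ 2 ∧ ¬ HasModelIn H G W (U \ S) := by
  classical
  induction w generalizing W k U with
  | zero =>
    obtain rfl : W = ∅ := by simpa using hWw
    exact absurd Packs.empty_left hU
  | succ w ihw =>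
    induction k using Nat.strong_induction_on generalizing U with
    | _ k ihk =>
      have hW : W.Nonempty := by
        by_contra hW
        rw [Finset.not_nonempty_iff_eq_empty] at hW
        exact hU (hW ▸ Packs.empty_left)
      rcases Nat.eq_zero_or_pos k with rfl | hk
      · refine ⟨∅, by simp, fun hm => hU ⟨U \ ∅, by simp, hm, trivial⟩⟩
      have hlt : k / 2 < k := Nat.div_lt_self hk (by norm_num)
      let F : Set (Finset α) :=
        {X | X ⊆ U ∧ (G.induce (X : Set α)).Connected ∧ Packs H G W (k / 2 + 1) X}
      have hU2 : ¬ Packs H G W (k / 2 + 1 + (k / 2 + 1)) U := fun hP => hU (hP.of_le (by omega))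
      have hinter : ∀ X ∈ F, ∀ Y ∈ F, ∃ v ∈ X, v ∈ Y := by
        intro X hX Y hY
        by_contra hno
        push Not at hno
        exact hU2 ((hX.2.2.add hY.2.2 (Finset.disjoint_left.2 hno)).mono
          (Finset.union_subset hX.1 hY.1))
      have hcov : ¬ CoverAtLeast F (6 * ((k + 1) * h + 1) ^ 2) := fun hF =>
        hU (hF.packs hcard hw (fun X hX => ⟨hX.1, hX.2.1⟩) hinter W)
      simp only [CoverAtLeast, not_forall, not_exists, not_and] at hcov
      obtain ⟨S₀, hS₀, hFS⟩ := hcov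
      obtain ⟨L, C, R, hLCR, hdL, hdC, hadjL, hadjC, hL, hC, hR⟩ :=
        exists_partition_of_connected (U := U \ S₀) hW (fun hP => hU2 (hP.mono Finset.sdiff_subset))
          fun X hX hXc hP => hFS X ⟨hX.trans Finset.sdiff_subset, hXc, hP⟩
            (Finset.disjoint_of_subset_left hX Finset.sdiff_disjoint)
      obtain ⟨SL, hSL, hmL⟩ := ihk _ hlt L hL
      obtain ⟨SC, hSC, hmC⟩ := ihk _ hlt C hC
      obtain ⟨SR, hSR, hmR⟩ := ihk _ hlt R hR
      have hsub : ∀ W' ⊂ W, ∀ Y, ¬ Packs H G W' (k + 1) Y → ∃ S,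
          S.card ≤ erdosPosaGap (54 * h ^ 2) w * k ^ 2 ∧ ¬ HasModelIn H G W' (Y \ S) :=
        fun W' hW' Y hY => ihw W' (by have := Finset.card_lt_card hW'; omega) k Y hY
      have hPU : ¬ Packs H G W (k + 1) (L ∪ (C ∪ R)) := fun hP =>
        hU (hP.mono (hLCR ▸ Finset.sdiff_subset))
      obtain ⟨S₁, hS₁, hm₁⟩ := exists_hitting_union hadjC hdC
        (fun hP => hPU (hP.mono Finset.subset_union_right)) hsub hmC hmR
      obtain ⟨S₂, hS₂, hm₂⟩ := exists_hitting_union hadjL hdL hPU hsub hmL hm₁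
      refine ⟨S₀ ∪ S₂, ?_, ?_⟩
      · have hh : 1 ≤ h := by
          obtain ⟨u, -⟩ := hW
          rw [← hcard]
          exact Fintype.card_pos_iff.2 ⟨u⟩
        have h0 : 6 * ((k + 1) * h + 1) ^ 2 ≤ 54 * h ^ 2 * k ^ 2 := by
          have : (k + 1) * h + 1 ≤ 3 * (h * k) := by nlinarith
          calc 6 * ((k + 1) * h + 1) ^ 2 ≤ 6 * (3 * (h * k)) ^ 2 := by gcongr
            _ = 54 * h ^ 2 * k ^ 2 := by ring
        have h1 := Finset.card_union_le S₀ S₂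
        have h2 : 4 * (k / 2) ^ 2 ≤ k ^ 2 := by
          have : 2 * (k / 2) ≤ k := Nat.mul_div_le k 2
          calc 4 * (k / 2) ^ 2 = (2 * (k / 2)) ^ 2 := by ring
            _ ≤ k ^ 2 := by gcongr
        have h3 : 2 ^ W.card ≤ 2 ^ (w + 1) := Nat.pow_le_pow_right (by norm_num) hWw
        have h4 := Nat.mul_le_mul_left (erdosPosaGap (54 * h ^ 2) (w + 1)) h2
        have h5 := Nat.mul_le_mul_right (erdosPosaGap (54 * h ^ 2) w * k ^ 2) h3
        have h6 : erdosPosaGap (54 * h ^ 2) (w + 1) * k ^ 2 = 4 * (54 * h ^ 2 * k ^ 2) +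
            8 * (2 ^ (w + 1) * (erdosPosaGap (54 * h ^ 2) w * k ^ 2)) := by
          rw [erdosPosaGap]
          ring
        have h7 : erdosPosaGap (54 * h ^ 2) (w + 1) * (4 * (k / 2) ^ 2) =
            4 * (erdosPosaGap (54 * h ^ 2) (w + 1) * (k / 2) ^ 2) := by ring
        omega
      · rwa [← Finset.sup_eq_union, ← sdiff_sdiff_left, ← hLCR]

end SimpleGraph

namespace SimpleGraph

variable {α β : Type*} {H : SimpleGraph β} {G : SimpleGraph α}

lemma _root_.HasDisjointModels.le_card [Fintype α] [Nonempty β] {k : ℕ}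
    (hk : HasDisjointModels H G k) : k ≤ Fintype.card α := by
  obtain ⟨M, hM, hd⟩ := hk
  have hex : ∀ i, ∃ a, a ∈ ⋃ u, M i u := fun i => by
    obtain ⟨a, ha⟩ := ((hM i).1 (Classical.arbitrary β)).nonempty
    exact ⟨a, Set.mem_iUnion.2 ⟨_, ha⟩⟩
  choose f hf using hex
  have hinj : Function.Injective f := fun i j hij => by
    by_contra hne
    exact Set.disjoint_left.1 (hd hne) (hf i) (hij ▸ hf j)
  simpa using Fintype.card_le_of_injective f hinj

lemma coverNumber_le_mul_packNumber_sq [Fintype α] [Fintype β] {h : ℕ} (hh : 0 < h)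
    (hcard : Fintype.card β = h) (hw : pathwidth H ≤ 2) :
    coverNumber H G ≤ erdosPosaGap (54 * h ^ 2) h * packNumber H G ^ 2 := by
  classical
  have : Nonempty β := Fintype.card_pos_iff.1 (hcard ▸ hh)
  have hP : ¬ Packs H G Finset.univ (packNumber H G + 1) Finset.univ := fun hP =>
    absurd (le_csSup (s := {k | HasDisjointModels H G k}) ⟨_, fun _ hk => hk.le_card⟩
      hP.hasDisjointModels) (Nat.not_succ_le_self _)
  obtain ⟨S, hS, hm⟩ := exists_hitting_of_not_packs hcard hw h Finset.univ
    (by rw [Finset.card_univ, hcard]) _ _ hP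
  suffices hhit : IsHittingSet H G (S : Set α) by
    have hle : coverNumber H G ≤ S.card := Nat.sInf_le ⟨(S : Set α), hhit, Set.ncard_coe_finset S⟩
    exact hle.trans hS
  intro B hB
  by_contra hno
  push Not at hno
  exact hm ⟨B, fun u _ => ⟨hB.1 u, fun a ha => by simpa using fun h => hno a h u ha⟩,
    fun u _ v _ huv => hB.2.1 huv, fun u _ v _ huv => hB.2.2 u v huv⟩

lemma erdosPosaGap_le_two_pow {h : ℕ} (hh : 5 < h) :
    erdosPosaGap (54 * h ^ 2) h ≤ 2 ^ (4 * h ^ 2) :=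
  calc erdosPosaGap (54 * h ^ 2) h ≤ 54 * h ^ 2 * 2 ^ (h + 3) ^ 2 := erdosPosaGap_le _ _
    _ ≤ 2 ^ 6 * (2 ^ h) ^ 2 * 2 ^ (h + 3) ^ 2 := by
        gcongr
        · norm_num
        · exact Nat.lt_two_pow_self.le
    _ = 2 ^ (6 + h * 2 + (h + 3) ^ 2) := by rw [← pow_mul, ← pow_add, ← pow_add]
    _ ≤ 2 ^ (4 * h ^ 2) := Nat.pow_le_pow_right (by norm_num) (by nlinarith)

end SimpleGraph

/-- For every integer `h > 5` there is a constant `c > 0` with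
`c = 2^{O(h^2)}` (i.e. `c ≤ 2^(C·h²)` for a universal constant `C > 0`) such that
for every graph `H` on `h` vertices of pathwidth at most `2` and every graph `G`,
if `k = pack_H(G)` then `cover_H(G) ≤ c · k² · log(2k)`. -/
theorem erdos_posa_pathwidth_two :
    ∃ C : ℝ, 0 < C ∧
      ∀ (h : ℕ), 5 < h →
        ∀ (β : Type) [Fintype β], ∀ (H : SimpleGraph β),
          Fintype.card β = h → pathwidth H ≤ 2 →
            ∀ (α : Type) [Fintype α], ∀ (G : SimpleGraph α),
              (coverNumber H G : ℝ) ≤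
                (2 : ℝ) ^ (C * (h : ℝ) ^ 2) * (packNumber H G : ℝ) ^ 2 *
                  Real.logb 2 (2 * (packNumber H G : ℝ)) := by
  refine ⟨4, by norm_num, fun h hh β _ H hcard hw α _ G => ?_⟩
  have hcover : (coverNumber H G : ℝ) ≤ 2 ^ (4 * h ^ 2) * (packNumber H G : ℝ) ^ 2 := by
    exact_mod_cast (coverNumber_le_mul_packNumber_sq (G := G) (by omega) hcard hw).trans
      (Nat.mul_le_mul_right _ (erdosPosaGap_le_two_pow hh))
  have hpow : (2 : ℝ) ^ ((4 : ℝ) * (h : ℝ) ^ 2) = 2 ^ (4 * h ^ 2) := by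
    have := Real.rpow_natCast (2 : ℝ) (4 * h ^ 2)
    push_cast at this
    exact this
  rw [hpow]
  rcases Nat.eq_zero_or_pos (packNumber H G) with hK | hK
  · simpa [hK] using hcover
  · refine hcover.trans (le_mul_of_one_le_right (by positivity) ?_)
    have hK' : (1 : ℝ) ≤ packNumber H G := by exact_mod_cast hK
    rw [Real.le_logb_iff_rpow_le (by norm_num) (by positivity), Real.rpow_one]
    linarith
end

section
/- There is a constant c > 0 such that for every integer r ≥ 1 and every graph G, if k = pack_{K_{2,r}}(G) is the maximum number of pairwise disjoint models of the complete bipartite graph K_{2,r} in G, then cover_{K_{2,r}}(G) ≤ c · r^2 · k^2. In other words, K_{2,r} has the Erdős–Pósa property with gap O(r^2 · k^2). -/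
open SimpleGraph

namespace ErdosPosa

variable {α β : Type*} {G G' : SimpleGraph α} {A B D S T : Set α} {a b c u v x y : α}

/-! ### Connected vertex sets -/

/-- The vertex set `A` is nonempty and induces a connected subgraph, phrased through closure of
subsets under adjacency. -/
def IsConn (G : SimpleGraph α) (A : Set α) : Prop :=
  A.Nonempty ∧ ∀ S : Set α, (A ∩ S).Nonempty →
    (∀ u ∈ A, u ∈ S → ∀ v ∈ A, G.Adj u v → v ∈ S) → A ⊆ S

theorem isConn_iff : IsConn G A ↔ (G.induce A).Connected := by
  constructor
  · rintro ⟨⟨a₀, ha₀⟩, h⟩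
    have : Nonempty A := ⟨⟨a₀, ha₀⟩⟩
    refine ⟨fun a b ↦ ?_⟩
    have := h {v | ∃ hv : v ∈ A, (G.induce A).Reachable a ⟨v, hv⟩}
      ⟨a, a.2, a.2, Reachable.refl _⟩ (by
        rintro u hu ⟨_, hr⟩ v hv huv
        exact ⟨hv, hr.trans (Adj.reachable (by simpa using huv))⟩) b.2
    exact this.2
  · intro h
    obtain ⟨a₀⟩ := h.nonempty
    refine ⟨⟨a₀, a₀.2⟩, fun S ⟨a, haA, haS⟩ hS v hv ↦ ?_⟩
    have hr := (reachable_iff_reflTransGen _ _).1 (h.preconnected ⟨a, haA⟩ ⟨v, hv⟩)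
    have : ∀ w : A, Relation.ReflTransGen (G.induce A).Adj ⟨a, haA⟩ w → (w : α) ∈ S := by
      intro w hw
      induction hw with
      | refl => exact haS
      | tail _ hadj ih => exact hS _ (Subtype.prop _) ih _ (Subtype.prop _) hadj
    exact this _ hr

theorem IsConn.nonempty (h : IsConn G A) : A.Nonempty := h.1

theorem IsConn.mono (h : IsConn G A) (hG : G ≤ G') : IsConn G' A :=
  ⟨h.1, fun S hS hc ↦ h.2 S hS fun u hu huS v hv huv ↦ hc u hu huS v hv (hG huv)⟩

theorem isConn_singleton (a : α) : IsConn G {a} :=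
  ⟨⟨a, rfl⟩, by rintro S ⟨b, rfl, hb⟩ _ c rfl; exact hb⟩

theorem IsConn.union_of_adj (hA : IsConn G A) (hB : IsConn G B) (ha : a ∈ A) (hb : b ∈ B)
    (hab : G.Adj a b) : IsConn G (A ∪ B) := by
  refine ⟨hA.1.mono Set.subset_union_left, fun S hS hc ↦ ?_⟩
  have h1 : (A ∩ S).Nonempty → A ⊆ S := fun h ↦
    hA.2 S h fun u hu huS v hv ↦ hc u (.inl hu) huS v (.inl hv)
  have h2 : (B ∩ S).Nonempty → B ⊆ S := fun h ↦
    hB.2 S h fun u hu huS v hv ↦ hc u (.inr hu) huS v (.inr hv)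
  obtain ⟨x, hx | hx, hxS⟩ := hS
  · have := h1 ⟨x, hx, hxS⟩
    exact Set.union_subset this
      (h2 ⟨b, hb, hc a (.inl ha) (this ha) b (.inr hb) hab⟩)
  · have := h2 ⟨x, hx, hxS⟩
    exact Set.union_subset
      (h1 ⟨a, ha, hc b (.inr hb) (this hb) a (.inl ha) hab.symm⟩) this

theorem IsConn.exists_adj_of_not_subset (h : IsConn G A) (hS : (A ∩ S).Nonempty)
    (hn : ¬ A ⊆ S) : ∃ u ∈ A, u ∈ S ∧ ∃ v ∈ A, v ∉ S ∧ G.Adj u v := by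
  by_contra! hc
  exact hn (h.2 S hS fun u hu huS v hv huv ↦ by
    by_contra hvS
    exact hc u hu huS v hv hvS huv)

/-! ### Reachability avoiding a set -/

/-- `v` is the end of a walk of `G` that starts in `A` and avoids `S`. -/
inductive Reach (G : SimpleGraph α) (S A : Set α) : α → Prop
  | base {a : α} : a ∈ A → a ∉ S → Reach G S A a
  | step {u v : α} : Reach G S A u → G.Adj u v → v ∉ S → Reach G S A v

theorem Reach.notMem (h : Reach G S A v) : v ∉ S := by
  cases h <;> assumption

theorem Reach.trans (h : Reach G S A u) (h' : Reach G S {u} v) : Reach G S A v := by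
  induction h' with
  | base hu _ => exact hu ▸ h
  | step _ huv hv ih => exact ih.step huv hv

theorem Reach.avoid (h : Reach G S A v) (hT : ∀ w, Reach G S A w → w ∉ T) : Reach G T A v := by
  induction h with
  | base h1 h2 => exact .base h1 (hT _ (.base h1 h2))
  | step h1 huv hv ih => exact ih.step huv (hT _ (h1.step huv hv))

theorem IsConn.reach (hD : IsConn G D) (hS : ∀ w ∈ D, w ∉ S) (ha : a ∈ D) (haA : a ∈ A)
    (hb : b ∈ D) : Reach G S A b :=
  hD.2 {v | Reach G S A v} ⟨a, ha, .base haA (hS a ha)⟩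
    (fun _ _ huR v hv huv ↦ Reach.step huR huv (hS v hv)) hb

theorem isConn_reach (hD : IsConn G D) (hS : ∀ w ∈ D, w ∉ S) : IsConn G {v | Reach G S D v} := by
  have hsub : D ⊆ {v | Reach G S D v} := fun v hv ↦ .base hv (hS v hv)
  refine ⟨hD.1.mono hsub, fun T hT hc ↦ ?_⟩
  have key : ∀ v, Reach G S D v → v ∈ T → D ⊆ T := by
    intro v hv
    induction hv with
    | base h1 h2 =>
      intro h
      exact hD.2 T ⟨_, h1, h⟩ fun u hu huT v hv huv ↦ hc u (hsub hu) huT v (hsub hv) huv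
    | step h1 huv hv ih =>
      intro h
      exact ih (hc _ (h1.step huv hv) h _ h1 huv.symm)
  obtain ⟨w, hw, hwT⟩ := hT
  have hDT := key w hw hwT
  intro v hv
  induction hv with
  | base h1 h2 => exact hDT h1
  | step h1 huv hv ih => exact hc _ h1 ih _ (h1.step huv hv) huv

/-! ### Paths -/

/-- `L` is the vertex set of a path of `G` from `a` to `b`. -/
inductive PathOn (G : SimpleGraph α) (a : α) : Set α → α → Prop
  | nil : PathOn G a {a} a
  | snoc {L : Set α} {u v : α} : PathOn G a L u → G.Adj u v → v ∉ L → PathOn G a (insert v L) v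

variable {L M : Set α}

theorem PathOn.left_mem (h : PathOn G a L b) : a ∈ L := by
  induction h with
  | nil => rfl
  | snoc _ _ _ ih => exact .inr ih

theorem PathOn.right_mem (h : PathOn G a L b) : b ∈ L := by
  cases h with
  | nil => rfl
  | snoc => exact .inl rfl

theorem PathOn.mono (h : PathOn G a L b) (hG : G ≤ G') : PathOn G' a L b := by
  induction h with
  | nil => exact .nil
  | snoc _ huv hv ih => exact ih.snoc (hG huv) hv

theorem PathOn.isConn (h : PathOn G a L b) : IsConn G L := by
  induction h with
  | nil => exact isConn_singleton a
  | @snoc L u v h huv _ ih =>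
    rw [Set.insert_eq, Set.union_comm]
    exact ih.union_of_adj (isConn_singleton v) h.right_mem rfl huv

theorem PathOn.append (h : PathOn G a L b) (h' : PathOn G b M c)
    (hd : ∀ v ∈ L, v ∈ M → v = b) : PathOn G a (L ∪ M) c := by
  induction h' with
  | nil => rwa [Set.union_eq_self_of_subset_right (by simpa using h.right_mem)]
  | @snoc M u v h1 huv hv ih =>
    rw [Set.union_insert]
    refine (ih fun w hw hw' ↦ hd w hw (.inr hw')).snoc huv ?_
    rintro (h2 | h2)
    · have := hd v h2 (.inl rfl)
      exact hv (this ▸ h1.left_mem)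
    · exact hv h2

theorem PathOn.append_adj (h : PathOn G a L b) (hbc : G.Adj b c) (h' : PathOn G c M x)
    (hd : Disjoint L M) : PathOn G a (L ∪ M) x := by
  rw [Set.disjoint_left] at hd
  have := (h.snoc hbc fun hc ↦ hd hc h'.left_mem).append h' (by
    rintro v (rfl | hv) hvM
    · rfl
    · exact (hd hv hvM).elim)
  rwa [Set.insert_union, Set.insert_eq_of_mem (.inr h'.left_mem)] at this

/-- The vertices of a path avoiding `S` except possibly at the end are reachable from the start. -/
theorem PathOn.reach_of_mem (h : PathOn G a L b) (haA : a ∈ A) (hS : ∀ w ∈ L, w ∈ S → w = b)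
    (hv : v ∈ L) (hvS : v ∉ S) : Reach G S A v := by
  induction h generalizing v with
  | nil => exact .base (by rwa [Set.mem_singleton_iff.1 hv]) hvS
  | @snoc L u w h huw hw ih =>
    have hS' : ∀ x ∈ L, x ∉ S := fun x hx hxS ↦ hw (hS x (.inr hx) hxS ▸ hx)
    rcases hv with rfl | hv
    · exact (ih (fun x hx hxS ↦ (hS' x hx hxS).elim) h.right_mem (hS' _ h.right_mem)).step huw hvS
    · exact ih (fun x hx hxS ↦ (hS' x hx hxS).elim) hv hvS

/-- From any vertex of a path avoiding `S` except possibly at the start one can reach the end. -/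
theorem PathOn.reach_end (h : PathOn G a L b) (hS : ∀ w ∈ L, w ∈ S → w = a)
    (hv : v ∈ L) (hvS : v ∉ S) : Reach G S {v} b := by
  induction h with
  | nil =>
    exact .base (Set.mem_singleton_iff.1 hv).symm (by rwa [Set.mem_singleton_iff.1 hv] at hvS)
  | @snoc L u w h huw hw ih =>
    have hwS : w ∉ S := fun hwS ↦ hw (hS w (.inl rfl) hwS ▸ h.left_mem)
    rcases hv with rfl | hv
    · exact .base rfl hwS
    · exact (ih (fun x hx ↦ hS x (.inr hx)) hv).step huw hwS

/-- A path starting in `A` has a final segment meeting `A` only in its start. -/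
theorem PathOn.exists_suffix (h : PathOn G a L b) (ha : a ∈ A) :
    ∃ a' ∈ A, ∃ L' ⊆ L, PathOn G a' L' b ∧ ∀ v ∈ L', v ∈ A → v = a' := by
  induction h with
  | nil => exact ⟨a, ha, _, subset_rfl, .nil, fun v hv _ ↦ hv⟩
  | @snoc L u w h huw hw ih =>
    by_cases hwA : w ∈ A
    · exact ⟨w, hwA, {w}, by simp, .nil, fun v hv _ ↦ hv⟩
    · obtain ⟨a', ha', L', hL', hp, hA⟩ := ih
      refine ⟨a', ha', insert w L', Set.insert_subset_insert hL',
        hp.snoc huw fun h ↦ hw (hL' h), ?_⟩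
      rintro v (rfl | hv) hvA
      · exact (hwA hvA).elim
      · exact hA v hv hvA

/-- The interior of a path between distinct vertices is empty or a connected set adjacent to both
ends. -/
theorem PathOn.exists_interior (h : PathOn G a L b) (hab : a ≠ b) :
    G.Adj a b ∨ ∃ c d I, PathOn G c I d ∧ G.Adj a c ∧ G.Adj d b ∧ I ⊆ L ∧ a ∉ I ∧ b ∉ I := by
  induction h with
  | nil => exact (hab rfl).elim
  | @snoc L u v h huv hv ih =>
    by_cases hau : a = u
    · subst hau; exact .inl huv
    right
    rcases ih hau with hadj | ⟨c, d, I, hI, hac, hdu, hIL, haI, huI⟩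
    · refine ⟨u, u, {u}, .nil, hadj, huv, ?_, hau, ?_⟩
      · simpa using Or.inr h.right_mem
      · rintro rfl; exact hv h.right_mem
    · refine ⟨c, u, insert u I, hI.snoc hdu huI, hac, huv, ?_, ?_, ?_⟩
      · exact Set.insert_subset (.inr h.right_mem) (hIL.trans (Set.subset_insert _ _))
      · rintro (h1 | h1)
        exacts [hau h1, haI h1]
      · rintro (rfl | h1)
        exacts [hv h.right_mem, hv (hIL h1)]

theorem PathOn.subset {L W : Set α} (hL : PathOn G a L b) (ha : a ∈ W)
    (hW : ∀ u v, G.Adj u v → v ∈ W) : L ⊆ W := by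
  induction hL with
  | nil => simpa using ha
  | snoc _ huv _ ih => exact Set.insert_subset (hW _ _ huv) ih

/-! ### Menger's theorem -/

/-- There are `n` pairwise disjoint paths of `G` from `A` to `B`. -/
def HasLinkage (G : SimpleGraph α) (A B : Set α) (n : ℕ) : Prop :=
  ∃ (a b : Fin n → α) (L : Fin n → Set α),
    (∀ i, a i ∈ A ∧ b i ∈ B ∧ PathOn G (a i) (L i) (b i)) ∧ Pairwise fun i j ↦ Disjoint (L i) (L j)

theorem eq_of_mem_of_mem {ι : Type*} {L : ι → Set α} (h : Pairwise fun i j ↦ Disjoint (L i) (L j))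
    {i j : ι} (hi : v ∈ L i) (hj : v ∈ L j) : i = j := by
  by_contra hij
  exact Set.disjoint_left.1 (h hij) hi hj

/-- If `n` disjoint sets have representatives in a set of at most `n` elements, then each element
of the latter is a representative. -/
theorem exists_rep_eq {n : ℕ} {L : Fin n → Set α} {f : Fin n → α} {X : Finset α}
    (h : Pairwise fun i j ↦ Disjoint (L i) (L j)) (hfL : ∀ i, f i ∈ L i) (hfX : ∀ i, f i ∈ X)
    (hX : X.card ≤ n) (hx : x ∈ X) : ∃ i, f i = x := by
  classical
  have hinj : Function.Injective f := fun i j hij ↦ eq_of_mem_of_mem h (hfL i) (hij ▸ hfL j)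
  have h1 : Finset.univ.image f = X := by
    refine Finset.eq_of_subset_of_card_le (fun y hy ↦ ?_) ?_
    · obtain ⟨i, _, rfl⟩ := Finset.mem_image.1 hy
      exact hfX i
    · rwa [Finset.card_image_of_injective _ hinj, Finset.card_univ, Fintype.card_fin]
  rw [← h1] at hx
  simpa using hx

theorem eq_rep_of_mem {n : ℕ} {L : Fin n → Set α} {f : Fin n → α} {X : Finset α}
    (h : Pairwise fun i j ↦ Disjoint (L i) (L j)) (hfL : ∀ i, f i ∈ L i) (hfX : ∀ i, f i ∈ X)
    (hX : X.card ≤ n) {i : Fin n} (hx : x ∈ X) (hxL : x ∈ L i) : x = f i := by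
  obtain ⟨j, rfl⟩ := exists_rep_eq h hfL hfX hX hx
  rw [eq_of_mem_of_mem h (hfL j) hxL]

/-- The gluing step of Göring's proof of Menger's theorem. -/
theorem hasLinkage_glue {n : ℕ} {S X Y : Finset α} {P Q : Set α}
    (hxy : G.Adj x y) (hG : G' ≤ G) (hX : ∀ v, v ∈ X ↔ v = x ∨ v ∈ S)
    (hY : ∀ v, v ∈ Y ↔ v = y ∨ v ∈ S)
    (hXn : X.card ≤ n) (hYn : Y.card ≤ n) (hSn : S.card < n)
    (hsep : ∀ b ∈ Q, ¬ Reach G' S P b)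
    (h1 : HasLinkage G' P X n) (h2 : HasLinkage G' Y Q n) : HasLinkage G P Q n := by
  obtain ⟨a, s, L, hL, hLd⟩ := h1
  obtain ⟨t, b, M, hM, hMd⟩ := h2
  have hsL : ∀ i, s i ∈ L i := fun i ↦ (hL i).2.2.right_mem
  have htM : ∀ i, t i ∈ M i := fun i ↦ (hM i).2.2.left_mem
  have hsX : ∀ i, s i ∈ X := fun i ↦ (hL i).2.1
  have htY : ∀ i, t i ∈ Y := fun i ↦ (hM i).1
  have hxS : x ∉ S := by
    intro hxS
    have : n ≤ S.card := by
      have hinj : Function.Injective s := fun i j hij ↦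
        eq_of_mem_of_mem hLd (hsL i) (hij ▸ hsL j)
      simpa using Finset.card_le_card_of_injOn s (s := Finset.univ) (t := S)
        (fun i _ ↦ by rcases (hX _).1 (hsX i) with h | h; exacts [h ▸ hxS, h]) hinj.injOn
    omega
  have hyS : y ∉ S := by
    intro hyS
    have : n ≤ S.card := by
      have hinj : Function.Injective t := fun i j hij ↦
        eq_of_mem_of_mem hMd (htM i) (hij ▸ htM j)
      simpa using Finset.card_le_card_of_injOn t (s := Finset.univ) (t := S)
        (fun i _ ↦ by rcases (hY _).1 (htY i) with h | h; exacts [h ▸ hyS, h]) hinj.injOn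
    omega
  have key : ∀ i j v, v ∈ L i → v ∈ M j → v ∈ S ∧ v = s i ∧ v = t j := by
    intro i j v hvL hvM
    have hvS : v ∈ S := by
      by_contra hvS
      have r1 : Reach G' S P v := (hL i).2.2.reach_of_mem (hL i).1
        (fun w hw hwS ↦ eq_rep_of_mem hLd hsL hsX hXn ((hX w).2 (.inr hwS)) hw) hvL hvS
      have r2 : Reach G' S {v} (b j) := (hM j).2.2.reach_end
        (fun w hw hwS ↦ eq_rep_of_mem hMd htM htY hYn ((hY w).2 (.inr hwS)) hw) hvM hvS
      exact hsep _ (hM j).2.1 (r1.trans r2)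
    exact ⟨hvS, eq_rep_of_mem hLd hsL hsX hXn ((hX v).2 (.inr hvS)) hvL,
      eq_rep_of_mem hMd htM htY hYn ((hY v).2 (.inr hvS)) hvM⟩
  have hj : ∀ i, ∃ j, (s i = x ∧ t j = y) ∨ (s i ∈ S ∧ t j = s i) := by
    intro i
    rcases (hX _).1 (hsX i) with h | h
    · obtain ⟨j, hj⟩ := exists_rep_eq hMd htM htY hYn ((hY y).2 (.inl rfl))
      exact ⟨j, .inl ⟨h, hj⟩⟩
    · obtain ⟨j, hj⟩ := exists_rep_eq hMd htM htY hYn ((hY (s i)).2 (.inr h))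
      exact ⟨j, .inr ⟨h, hj⟩⟩
  choose f hf using hj
  have hfinj : ∀ i i', f i = f i' → i = i' := by
    intro i i' hii
    refine eq_of_mem_of_mem hLd (hsL i) (?_ : s i ∈ L i')
    have h1 := hf i
    have h2 := hf i'
    rw [hii] at h1
    have : s i = s i' := by
      rcases h1 with ⟨h1, h1'⟩ | ⟨h1, h1'⟩ <;> rcases h2 with ⟨h2, h2'⟩ | ⟨h2, h2'⟩
      · rw [h1, h2]
      · exact (hyS (by rw [← h1', h2']; exact h2)).elim
      · exact (hyS (by rw [← h2', h1']; exact h1)).elim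
      · rw [← h1', h2']
    exact this ▸ hsL i'
  have key' : ∀ i i' v, v ∈ L i → v ∈ M (f i') → i = i' := by
    intro i i' v hvL hvM
    obtain ⟨hvS, h1, h2⟩ := key _ _ v hvL hvM
    rcases hf i' with ⟨_, h3⟩ | ⟨_, h3⟩
    · exact (hyS (by rw [← h3, ← h2]; exact hvS)).elim
    · refine eq_of_mem_of_mem hLd (hsL i) ?_
      rw [← h1, h2, h3]
      exact hsL i'
  refine ⟨a, fun i ↦ b (f i), fun i ↦ L i ∪ M (f i),
    fun i ↦ ⟨(hL i).1, (hM (f i)).2.1, ?_⟩, ?_⟩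
  · have p1 := (hL i).2.2.mono hG
    have p2 := (hM (f i)).2.2.mono hG
    rcases hf i with ⟨h1, h2⟩ | ⟨h1, h2⟩
    · refine p1.append_adj (by rw [h1, h2]; exact hxy) p2 (Set.disjoint_left.2 fun v hv hv' ↦ ?_)
      obtain ⟨h3, h4, _⟩ := key _ _ v hv hv'
      exact hxS (by rw [← h1, ← h4]; exact h3)
    · rw [h2] at p2
      exact p1.append p2 fun v hv hv' ↦ (key _ _ v hv hv').2.1
  · intro i j hij
    rw [Set.disjoint_left]
    rintro v (hv | hv) (hvj | hvj)
    · exact hij (eq_of_mem_of_mem hLd hv hvj)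
    · exact hij (key' _ _ v hv hvj)
    · exact hij (key' _ _ v hvj hv).symm
    · exact hij (hfinj _ _ (eq_of_mem_of_mem hMd hv hvj))

/-- **Menger's theorem** for vertex sets. -/
theorem hasLinkage_of_forall_reach [Finite α] (n : ℕ) (G : SimpleGraph α) :
    ∀ A B : Set α, (∀ S : Finset α, S.card < n → ∃ b ∈ B, Reach G S A b) → HasLinkage G A B n := by
  classical
  induction G using WellFoundedLT.induction with
  | ind G ih =>
  intro A B h
  by_cases hE : ∃ x y, G.Adj x y
  · obtain ⟨x, y, hxy⟩ := hE
    set G' := G.deleteEdges {s(x, y)} with hG'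
    have hle : G' ≤ G := G.deleteEdges_le _
    have hlt : G' < G := by
      refine lt_of_le_of_ne hle fun heq ↦ ?_
      have : G'.Adj x y := heq ▸ hxy
      simp [hG'] at this
    have hadj : ∀ u v, G.Adj u v → G'.Adj u v ∨ (u = x ∧ v = y) ∨ (u = y ∧ v = x) := by
      intro u v huv
      by_cases h : s(u, v) = s(x, y)
      · right; simpa using h
      · left; simp [hG', huv, h]
    by_cases hS : ∀ S : Finset α, S.card < n → ∃ b ∈ B, Reach G' S A b
    · obtain ⟨a, b, L, hL, hd⟩ := ih G' hlt A B hS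
      exact ⟨a, b, L, fun i ↦ ⟨(hL i).1, (hL i).2.1, (hL i).2.2.mono hle⟩, hd⟩
    push Not at hS
    obtain ⟨S, hSn, hsep⟩ := hS
    have main : ∀ x y, G.Adj x y →
        (∀ u v, G.Adj u v → G'.Adj u v ∨ (u = x ∧ v = y) ∨ (u = y ∧ v = x)) →
        Reach G' S A x → ¬ Reach G' S A y → HasLinkage G A B n := by
      intro x y hxy hadj hx hy
      refine hasLinkage_glue (S := S) (X := insert x S) (Y := insert y S) hxy hle
        (by simp) (by simp) ((Finset.card_insert_le _ _).trans hSn)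
        ((Finset.card_insert_le _ _).trans hSn) hSn hsep (ih G' hlt _ _ ?_) (ih G' hlt _ _ ?_)
      · intro T hT
        by_contra! hc
        obtain ⟨b, hb, hr⟩ := h T hT
        have hav : ∀ w, Reach G' T A w → w ∉ (S : Set α) := fun w hw hwS ↦
          hc w (by simp [Finset.mem_coe.1 hwS]) hw
        have : ∀ v, Reach G T A v → Reach G' T A v := by
          intro v hv
          induction hv with
          | base h1 h2 => exact .base h1 h2
          | step _ huv hv ih =>
            rcases hadj _ _ huv with h1 | ⟨rfl, rfl⟩ | ⟨rfl, rfl⟩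
            · exact ih.step h1 hv
            · exact (hc _ (by simp) ih).elim
            · exact (hy (ih.avoid hav)).elim
        exact hsep b hb ((this b hr).avoid hav)
      · intro T hT
        obtain ⟨b, hb, hr⟩ := h T hT
        have : ∀ v, Reach G T A v → Reach G' S A v ∨ Reach G' T (insert y S : Finset α) v := by
          intro v hv
          induction hv with
          | @base a h1 h2 =>
            by_cases haS : a ∈ S
            · exact .inr (.base (by simp [haS]) h2)
            · exact .inl (.base h1 haS)
          | @step u v _ huv hv ih =>
            rcases hadj _ _ huv with h1 | ⟨rfl, rfl⟩ | ⟨rfl, rfl⟩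
            · rcases ih with ih | ih
              · by_cases hvS : v ∈ S
                · exact .inr (.base (by simp [hvS]) hv)
                · exact .inl (ih.step h1 hvS)
              · exact .inr (ih.step h1 hv)
            · exact .inr (.base (by simp) hv)
            · exact .inl hx
        rcases this b hr with h1 | h1
        · exact (hsep b hb h1).elim
        · exact ⟨b, hb, h1⟩
    by_cases hx : Reach G' S A x <;> by_cases hy : Reach G' S A y
    · exfalso
      obtain ⟨b, hb, hr⟩ := h S hSn
      refine hsep b hb ?_
      clear hb
      induction hr with
      | base h1 h2 => exact .base h1 h2
      | step _ huv hv ih =>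
        rcases hadj _ _ huv with h1 | ⟨rfl, rfl⟩ | ⟨rfl, rfl⟩
        exacts [ih.step h1 hv, hy, hx]
    · exact main x y hxy hadj hx hy
    · exact main y x hxy.symm (fun u v huv ↦ (hadj u v huv).imp id Or.symm) hy hx
    · exfalso
      obtain ⟨b, hb, hr⟩ := h S hSn
      refine hsep b hb ?_
      clear hb
      induction hr with
      | base h1 h2 => exact .base h1 h2
      | step _ huv hv ih =>
        rcases hadj _ _ huv with h1 | ⟨rfl, rfl⟩ | ⟨rfl, rfl⟩
        exacts [ih.step h1 hv, (hx ih).elim, (hy ih).elim]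
  · push Not at hE
    have hfin : (A ∩ B).Finite := Set.toFinite _
    have hn : n ≤ hfin.toFinset.card := by
      by_contra! hlt
      obtain ⟨b, hb, hr⟩ := h _ hlt
      cases hr with
      | base h1 h2 => exact h2 (by simpa using ⟨h1, hb⟩)
      | step _ huv _ => exact hE _ _ huv
    obtain ⟨t, ht, htn⟩ := Finset.exists_subset_card_eq hn
    have e := t.equivFinOfCardEq htn
    have hmem : ∀ i, (e.symm i : α) ∈ A ∩ B := fun i ↦ by simpa using ht (e.symm i).2
    refine ⟨fun i ↦ e.symm i, fun i ↦ e.symm i, fun i ↦ {(e.symm i : α)},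
      fun i ↦ ⟨(hmem i).1, (hmem i).2, .nil⟩, fun i j hij ↦ ?_⟩
    simpa [Subtype.ext_iff] using fun h ↦ hij (e.symm.injective (Subtype.ext h))

/-! ### Ladders from havens -/

/-- The edges of `G` with no end in `D`. -/
def outside (G : SimpleGraph α) (D : Set α) : SimpleGraph α where
  Adj u v := G.Adj u v ∧ u ∉ D ∧ v ∉ D
  symm := ⟨fun _ _ h ↦ ⟨h.1.symm, h.2.2, h.2.1⟩⟩
  loopless := ⟨fun _ h ↦ h.1.ne rfl⟩

/-- The edges of `G` with at least one end in `D`. -/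
def touching (G : SimpleGraph α) (D : Set α) : SimpleGraph α where
  Adj u v := G.Adj u v ∧ (u ∈ D ∨ v ∈ D)
  symm := ⟨fun _ _ h ↦ ⟨h.1.symm, h.2.symm⟩⟩
  loopless := ⟨fun _ h ↦ h.1.ne rfl⟩

theorem outside_le : outside G D ≤ G := fun _ _ h ↦ h.1

theorem touching_le : touching G D ≤ G := fun _ _ h ↦ h.1

/-- Disjoint connected sets `A 0, …, A (l - 1)`, consecutive ones adjacent, together with disjoint
connected rungs, the `j`-th of which is adjacent to `A (a j)` and to `A (b j)`. -/
structure IsLadder (G : SimpleGraph α) (l : ℕ) (A : ℕ → Set α) {n : ℕ} (R : Fin n → Set α)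
    (a b : Fin n → ℕ) : Prop where
  atom_conn : ∀ t < l, IsConn G (A t)
  atom_adj : ∀ t, t + 1 < l → ∃ u ∈ A t, ∃ v ∈ A (t + 1), G.Adj u v
  atom_disj : ∀ s t, s < l → t < l → s ≠ t → Disjoint (A s) (A t)
  rung_conn : ∀ j, IsConn G (R j)
  rung_disj : Pairwise fun i j ↦ Disjoint (R i) (R j)
  rung_atom : ∀ j, ∀ t < l, Disjoint (R j) (A t)
  a_inj : Function.Injective a
  b_inj : Function.Injective b
  a_lt_b : ∀ i j, a i < b j
  b_lt : ∀ j, b j < l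
  a_adj : ∀ j, ∃ u ∈ A (a j), ∃ v ∈ R j, G.Adj u v
  b_adj : ∀ j, ∃ u ∈ A (b j), ∃ v ∈ R j, G.Adj u v

section Haven

variable [Fintype α] {ℋ : Set α → Prop} {θ h n : ℕ} {C : Set α}

open Classical in
/-- The outer vertex boundary of `D`. -/
noncomputable def bd (G : SimpleGraph α) (D : Set α) : Finset α :=
  {v | v ∉ D ∧ ∃ u ∈ D, G.Adj u v}

theorem mem_bd : v ∈ bd G D ↔ v ∉ D ∧ ∃ u ∈ D, G.Adj u v := by simp [bd]

theorem IsConn.subset_of_bd (hD : IsConn G D) (hDC : (D ∩ C).Nonempty)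
    (hbd : ∀ v ∈ bd G C, v ∉ D) : D ⊆ C := by
  by_contra hn
  obtain ⟨u, _, huC, v, hv, hvC, huv⟩ := hD.exists_adj_of_not_subset hDC hn
  exact hbd v (mem_bd.2 ⟨hvC, u, huC, huv⟩) hv

/-- A family of pairwise intersecting connected sets, closed under connected supersets, such that
no set of at most `θ` vertices meets all of them. -/
structure IsHaven (G : SimpleGraph α) (θ : ℕ) (ℋ : Set α → Prop) : Prop where
  conn : ∀ D, ℋ D → IsConn G D
  inter : ∀ D D', ℋ D → ℋ D' → (D ∩ D').Nonempty
  up : ∀ D D', ℋ D → IsConn G D' → D ⊆ D' → ℋ D'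
  avoid : ∀ X : Finset α, X.card ≤ θ → ∃ D, ℋ D ∧ ∀ v ∈ X, v ∉ D

theorem IsHaven.exists_component (hH : IsHaven G θ ℋ) {X : Set α} (hD : ℋ D)
    (hX : ∀ v ∈ X, v ∉ D) :
    ∃ D', ℋ D' ∧ D ⊆ D' ∧ (∀ v ∈ X, v ∉ D') ∧ ∀ v ∈ bd G D', v ∈ X := by
  have hX' : ∀ v ∈ D, v ∉ X := fun v hv hvX ↦ hX v hvX hv
  have hsub : D ⊆ {v | Reach G X D v} := fun v hv ↦ .base hv (hX' v hv)
  refine ⟨{v | Reach G X D v}, hH.up D _ hD (isConn_reach (hH.conn D hD) hX') hsub, hsub,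
    fun v hv hr ↦ hr.notMem hv, fun v hv ↦ ?_⟩
  obtain ⟨hv, u, hu, huv⟩ := mem_bd.1 hv
  by_contra hvX
  exact hv (Reach.step hu huv hvX)

theorem IsHaven.exists_avoid_bd (hH : IsHaven G θ ℋ) (X : Finset α) (hX : X.card ≤ θ) :
    ∃ D, ℋ D ∧ (∀ v ∈ X, v ∉ D) ∧ ∀ v ∈ bd G D, v ∈ X := by
  obtain ⟨D, hD, hDX⟩ := hH.avoid X hX
  obtain ⟨D', hD', _, h1, h2⟩ := hH.exists_component (X := X) hD hDX
  exact ⟨D', hD', h1, h2⟩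

/-- A depth-first search path: `P` is a path avoiding `C` and containing the boundary of `C`. -/
structure IsSearchPath (G : SimpleGraph α) (P : List α) (C : Set α) : Prop where
  chain : P.IsChain G.Adj
  nodup : P.Nodup
  notMem : ∀ v ∈ P, v ∉ C
  bd_mem : ∀ v ∈ bd G C, v ∈ P

/-- A search path can be backtracked until its head is adjacent to the unexplored part. -/
theorem IsSearchPath.exists_head {P : List α} (hP : IsSearchPath G P C) :
    ∃ P', IsSearchPath G P' C ∧ ∀ p ∈ P'.head?, p ∈ bd G C := by
  induction P with
  | nil => exact ⟨[], hP, by simp⟩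
  | cons p P ih =>
    by_cases hp : p ∈ bd G C
    · exact ⟨p :: P, hP, by simpa using hp⟩
    · refine ih ⟨hP.chain.tail, hP.nodup.of_cons, fun v hv ↦ hP.notMem v (.tail _ hv),
        fun v hv ↦ ?_⟩
      rcases List.mem_cons.1 (hP.bd_mem v hv) with rfl | h
      exacts [(hp hv).elim, h]

/-- A search path such that separating the haven from it takes exactly `h` vertices. -/
theorem IsHaven.exists_searchPath (hH : IsHaven G θ ℋ) (hh : h ≤ θ) :
    ∃ P C D, IsSearchPath G P C ∧ ℋ C ∧ ℋ D ∧ D ⊆ C ∧ (bd G D).card = h ∧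
      ∀ D', ℋ D' → D' ⊆ C → h ≤ (bd G D').card := by
  classical
  have main : ∀ (m : ℕ) (C : Set α) (P : List α) (D : Set α), C.ncard = m → ℋ C →
      IsSearchPath G P C → ℋ D → D ⊆ C → (bd G D).card ≤ h →
      ∃ P C D, IsSearchPath G P C ∧ ℋ C ∧ ℋ D ∧ D ⊆ C ∧ (bd G D).card = h ∧
        ∀ D', ℋ D' → D' ⊆ C → h ≤ (bd G D').card := by
    intro m
    induction m using Nat.strong_induction_on with
    | _ m ih =>
    intro C P₀ D₀ hm hC hP₀ hD₀ hD₀C hD₀h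
    by_cases hmin : ∀ D', ℋ D' → D' ⊆ C → h ≤ (bd G D').card
    · exact ⟨P₀, C, D₀, hP₀, hC, hD₀, hD₀C, hD₀h.antisymm (hmin D₀ hD₀ hD₀C), hmin⟩
    push Not at hmin
    obtain ⟨D, hD, hDC, hDh⟩ := hmin
    obtain ⟨P, hP, hhead⟩ := hP₀.exists_head
    obtain ⟨c, hcC, hchain⟩ : ∃ c ∈ C, (c :: P).IsChain G.Adj := by
      cases P with
      | nil =>
        obtain ⟨c, hc⟩ := (hH.conn C hC).nonempty
        exact ⟨c, hc, by simp⟩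
      | cons p P =>
        obtain ⟨_, c, hc, hcp⟩ := mem_bd.1 (hhead p (by simp))
        exact ⟨c, hc, by simpa using ⟨hcp, hP.chain⟩⟩
    obtain ⟨D', hD', hD'X, hbd'⟩ := hH.exists_avoid_bd (insert c (bd G D))
      ((Finset.card_insert_le _ _).trans (by omega))
    have hD'D : D' ⊆ D := (hH.conn D' hD').subset_of_bd (hH.inter _ _ hD' hD)
      fun v hv ↦ hD'X v (by simp [hv])
    have hcD' : c ∉ D' := hD'X c (by simp)
    obtain ⟨C', hC', hD'C', hC'X, hbdC'⟩ := hH.exists_component (X := insert c ↑(bd G C)) hD' (by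
      rintro v (rfl | hv)
      · exact hcD'
      · exact fun hvD' ↦ (mem_bd.1 hv).1 (hDC (hD'D hvD')))
    have hC'C : C' ⊆ C := (hH.conn C' hC').subset_of_bd (hH.inter _ _ hC' hC)
      fun v hv ↦ hC'X v (.inr hv)
    have hcC' : c ∉ C' := hC'X c (.inl rfl)
    refine ih C'.ncard ?_ C' (c :: P) D' rfl hC' ⟨hchain, ?_, ?_, ?_⟩ hD' hD'C' ?_
    · rw [← hm]
      exact Set.ncard_lt_ncard ⟨hC'C, fun hle ↦ hcC' (hle hcC)⟩
    · exact List.nodup_cons.2 ⟨fun hcP ↦ hP.notMem c hcP hcC, hP.nodup⟩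
    · intro v hv
      rcases List.mem_cons.1 hv with rfl | hv
      · exact hcC'
      · exact fun hvC' ↦ hP.notMem v hv (hC'C hvC')
    · intro v hv
      rcases hbdC' v hv with rfl | hv
      · exact .head _
      · exact .tail _ (hP.bd_mem v hv)
    · have : (bd G D').card ≤ (insert c (bd G D)).card := Finset.card_le_card hbd'
      have := Finset.card_insert_le c (bd G D)
      omega
  obtain ⟨C, hC, _, hbd⟩ := hH.exists_avoid_bd ∅ (by simp)
  have hbd0 : bd G C = ∅ := Finset.eq_empty_of_forall_notMem fun v hv ↦ by simpa using hbd v hv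
  exact main _ C [] C rfl hC ⟨by simp, by simp, by simp, by simp [hbd0]⟩ hC subset_rfl
    (by simp [hbd0])

theorem IsHaven.hasLinkage_outside (hH : IsHaven G θ ℋ) (hh : h ≤ θ) {P : List α}
    (hP : IsSearchPath G P C) (hD : ℋ D) (hDC : D ⊆ C) (hC : ℋ C)
    (hmin : ∀ D', ℋ D' → D' ⊆ C → h ≤ (bd G D').card) :
    HasLinkage (outside G D) {v | v ∈ P} (bd G D) h := by
  refine hasLinkage_of_forall_reach _ _ _ _ fun S hS ↦ ?_
  obtain ⟨D₁, hD₁, hD₁S, hbd₁⟩ := hH.exists_avoid_bd S (by omega)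
  have hn : ¬ D₁ ⊆ C := fun hsub ↦ by
    have h1 := hmin D₁ hD₁ hsub
    have : (bd G D₁).card ≤ S.card := Finset.card_le_card hbd₁
    omega
  obtain ⟨w, _, hwC, p, hp, hpC, hwp⟩ :=
    (hH.conn _ hD₁).exists_adj_of_not_subset (hH.inter _ _ hD₁ hC) hn
  have hpP : p ∈ P := hP.bd_mem p (mem_bd.2 ⟨hpC, w, hwC, hwp⟩)
  obtain ⟨d, hdD₁, hdD⟩ := hH.inter _ _ hD₁ hD
  have hRD : ∀ v, Reach (outside G D) S {v | v ∈ P} v → v ∉ D := by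
    intro v hv
    cases hv with
    | base h1 _ => exact fun hvD ↦ hP.notMem v h1 (hDC hvD)
    | step _ huv _ => exact huv.2.2
  obtain ⟨u, hu, huR, v, hv, hvR, huv⟩ := (hH.conn _ hD₁).exists_adj_of_not_subset
    (S := {v | Reach (outside G D) S {v | v ∈ P} v}) ⟨p, hp, .base hpP fun h ↦ hD₁S p h hp⟩
    (fun hsub ↦ hRD d (hsub hdD₁) hdD)
  have huD := hRD u huR
  have hvD : v ∈ D := by
    by_contra hvD
    exact hvR (Reach.step huR ⟨huv, huD, hvD⟩ fun h ↦ hD₁S v h hv)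
  exact ⟨u, mem_bd.2 ⟨huD, v, hvD, huv.symm⟩, huR⟩

open Classical in
theorem IsHaven.hasLinkage_touching (hH : IsHaven G θ ℋ) (hn : 3 * n ≤ θ) (hD : ℋ D)
    (hmin : ∀ D', ℋ D' → D' ⊆ D → 2 * n ≤ (bd G D').card) {Z₁ Z₂ : Finset α}
    (hZ : bd G D = Z₁ ∪ Z₂) (h1 : Z₁.card ≤ n) (h2 : Z₂.card ≤ n) :
    HasLinkage (touching G D) Z₁ Z₂ n := by
  refine hasLinkage_of_forall_reach _ _ _ _ fun S hS ↦ ?_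
  have hcard : (S ∪ (Z₁ ∪ Z₂)).card ≤ θ := by
    have := Finset.card_union_le S (Z₁ ∪ Z₂)
    have := Finset.card_union_le Z₁ Z₂
    omega
  obtain ⟨D', hD', hX, hbd'⟩ := hH.exists_avoid_bd _ hcard
  have hD'D : D' ⊆ D := (hH.conn _ hD').subset_of_bd (hH.inter _ _ hD' hD) fun v hv ↦
    hX v (by rw [hZ] at hv; exact Finset.mem_union_right _ hv)
  have hD'S : ∀ w ∈ D', w ∉ (S : Set α) := fun w hw hwS ↦
    hX w (Finset.mem_union_left _ hwS) hw
  have hbig := hmin D' hD' hD'D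
  have key : ∀ Z Z' : Finset α, Z'.card ≤ n → (∀ v ∈ Z₁ ∪ Z₂, v ∈ Z ∨ v ∈ Z') →
      ∃ z ∈ Z, z ∉ S ∧ z ∈ bd G D' := by
    intro Z Z' hZ' hZZ'
    by_contra! hc
    have : bd G D' ⊆ S ∪ Z' := by
      intro v hv
      rcases Finset.mem_union.1 (hbd' v hv) with h | h
      · exact Finset.mem_union_left _ h
      · rcases hZZ' v h with h | h
        · by_contra hvS
          exact hc v h (fun h' ↦ hvS (Finset.mem_union_left _ h')) hv
        · exact Finset.mem_union_right _ h
    have := Finset.card_le_card this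
    have := Finset.card_union_le S Z'
    omega
  obtain ⟨z₁, hz₁, hz₁S, hz₁b⟩ := key Z₁ Z₂ h2 fun v hv ↦ Finset.mem_union.1 hv
  obtain ⟨z₂, hz₂, hz₂S, hz₂b⟩ := key Z₂ Z₁ h1 fun v hv ↦ (Finset.mem_union.1 hv).symm
  obtain ⟨_, u, hu, huz⟩ := mem_bd.1 hz₁b
  obtain ⟨_, w, hw, hwz⟩ := mem_bd.1 hz₂b
  have r1 : Reach (touching G D) S Z₁ u :=
    (Reach.base hz₁ hz₁S).step ⟨huz.symm, .inr (hD'D hu)⟩ (hD'S u hu)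
  have hconn : IsConn (touching G D) D' := by
    obtain ⟨hne, hc⟩ := hH.conn _ hD'
    exact ⟨hne, fun T hT hcl ↦ hc T hT fun u hu huT v hv huv ↦
      hcl u hu huT v hv ⟨huv, .inl (hD'D hu)⟩⟩
  have r2 : Reach (touching G D) S {u} w := hconn.reach hD'S hu rfl hw
  exact ⟨z₂, hz₂, (r1.trans r2).step ⟨hwz, .inl (hD'D hw)⟩ hz₂S⟩

theorem IsHaven.exists_sorted_legs (hH : IsHaven G θ ℋ) (hh : h ≤ θ) {P : List α}
    (hP : IsSearchPath G P C) (hD : ℋ D) (hDC : D ⊆ C) (hC : ℋ C)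
    (hmin : ∀ D', ℋ D' → D' ⊆ C → h ≤ (bd G D').card) :
    ∃ (q : Fin h → ℕ) (a z : Fin h → α) (L : Fin h → Set α), StrictMono q ∧
      (∀ i, P[q i]? = some (a i) ∧ z i ∈ bd G D ∧ PathOn (outside G D) (a i) (L i) (z i) ∧
        ∀ v ∈ L i, v ∈ P → v = a i) ∧
      Pairwise fun i j ↦ Disjoint (L i) (L j) := by
  classical
  obtain ⟨a₀, z, L₀, hL₀, hd₀⟩ := hH.hasLinkage_outside hh hP hD hDC hC hmin
  have htrim := fun i ↦ (hL₀ i).2.2.exists_suffix (hL₀ i).1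
  choose a ha L hLL hL hLP using htrim
  have hd : Pairwise fun i j ↦ Disjoint (L i) (L j) := fun i j hij ↦
    (hd₀ hij).mono (hLL i) (hLL j)
  have hinj : Function.Injective fun i ↦ P.idxOf (a i) := by
    intro i j hij
    have : a i = a j := (List.idxOf_inj (ha i)).1 hij
    exact eq_of_mem_of_mem hd (hL i).left_mem (this ▸ (hL j).left_mem)
  let σ := Tuple.sort fun i ↦ P.idxOf (a i)
  refine ⟨fun i ↦ P.idxOf (a (σ i)), fun i ↦ a (σ i), fun i ↦ z (σ i), fun i ↦ L (σ i), ?_,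
    fun i ↦ ⟨?_, (hL₀ _).2.1, hL _, hLP _⟩, fun i j hij ↦ hd (σ.injective.ne hij)⟩
  · exact (Tuple.monotone_sort fun i ↦ P.idxOf (a i)).strictMono_of_injective
      (hinj.comp σ.injective)
  · exact List.getElem?_idxOf (ha _)

theorem IsHaven.exists_isLadder (hH : IsHaven G θ ℋ) (hn : 3 * n ≤ θ) :
    ∃ (l : ℕ) (A : ℕ → Set α) (R : Fin n → Set α) (a b : Fin n → ℕ), IsLadder G l A R a b := by
  classical
  obtain ⟨P, C, D, hP, hC, hD, hDC, hcard, hmin⟩ := hH.exists_searchPath (h := 2 * n) (by omega)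
  obtain ⟨q, p, z, L, hq, hL, hLd⟩ := hH.exists_sorted_legs (by omega) hP hD hDC hC hmin
  have hPD : ∀ v ∈ P, v ∉ D := fun v hv hvD ↦ hP.notMem v hv (hDC hvD)
  have hpP : ∀ i, p i ∈ P := fun i ↦ List.mem_of_getElem? (hL i).1
  have hLD : ∀ i, L i ⊆ Dᶜ := fun i ↦
    (hL i).2.2.1.subset (hPD _ (hpP i)) fun u v huv ↦ huv.2.2
  have hzL : ∀ i, z i ∈ L i := fun i ↦ (hL i).2.2.1.right_mem
  have hz : ∀ i, z i ∈ bd G D := fun i ↦ (hL i).2.1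
  have hzinj : Function.Injective z := fun i j hij ↦
    eq_of_mem_of_mem hLd (hzL i) (hij ▸ hzL j)
  let e₁ : Fin n → Fin (2 * n) := fun i ↦ ⟨i, by omega⟩
  let e₂ : Fin n → Fin (2 * n) := fun i ↦ ⟨n + i, by omega⟩
  have he : ∀ i j, e₁ i < e₂ j := fun i j ↦ by
    simp only [e₁, e₂, Fin.mk_lt_mk]; omega
  set Z₁ : Finset α := Finset.univ.image (z ∘ e₁) with hZ₁
  set Z₂ : Finset α := Finset.univ.image (z ∘ e₂) with hZ₂
  have hZ₁n : Z₁.card ≤ n := Finset.card_image_le.trans (by simp)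
  have hZ₂n : Z₂.card ≤ n := Finset.card_image_le.trans (by simp)
  have hZ : bd G D = Z₁ ∪ Z₂ := by
    ext v
    constructor
    · intro hv
      obtain ⟨i, rfl⟩ := exists_rep_eq hLd hzL hz hcard.le hv
      rw [Finset.mem_union]
      by_cases hi : (i : ℕ) < n
      · exact .inl (Finset.mem_image.2 ⟨⟨i, hi⟩, by simp, rfl⟩)
      · refine .inr (Finset.mem_image.2 ⟨⟨i - n, by omega⟩, by simp, ?_⟩)
        simp only [Function.comp, e₂]
        congr 1
        ext
        simp only
        omega
    · simp only [Finset.mem_union, hZ₁, hZ₂, Finset.mem_image]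
      rintro (⟨i, -, rfl⟩ | ⟨i, -, rfl⟩) <;> exact hz _
  obtain ⟨u, w, M, hM, hMd⟩ := hH.hasLinkage_touching hn hD
    (fun D' hD' hsub ↦ hmin D' hD' (hsub.trans hDC)) hZ hZ₁n hZ₂n
  have huM : ∀ j, u j ∈ M j := fun j ↦ (hM j).2.2.left_mem
  have hwM : ∀ j, w j ∈ M j := fun j ↦ (hM j).2.2.right_mem
  have hla : ∀ j, ∃ i, z (e₁ i) = u j := fun j ↦ by
    simpa [hZ₁] using (hM j).1
  have hlb : ∀ j, ∃ i, z (e₂ i) = w j := fun j ↦ by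
    simpa [hZ₂] using (hM j).2.1
  choose la hla using hla
  choose lb hlb using hlb
  have hubd : ∀ j, u j ∈ bd G D := fun j ↦ hla j ▸ hz _
  have hwbd : ∀ j, w j ∈ bd G D := fun j ↦ hlb j ▸ hz _
  have huw : ∀ j, u j ≠ w j := by
    intro j hj
    rw [← hla, ← hlb] at hj
    exact (he _ _).ne (hzinj hj)
  have hint : ∀ j, ∃ c d I, PathOn (touching G D) c I d ∧ (touching G D).Adj (u j) c ∧
      (touching G D).Adj d (w j) ∧ I ⊆ M j ∧ u j ∉ I ∧ w j ∉ I := by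
    intro j
    refine ((hM j).2.2.exists_interior (huw j)).resolve_left fun hadj ↦ ?_
    rcases hadj.2 with h | h
    · exact (mem_bd.1 (hubd j)).1 h
    · exact (mem_bd.1 (hwbd j)).1 h
  choose c d I hI huc hdw hIM huI hwI using hint
  have hID : ∀ j, I j ⊆ D := by
    intro j v hv
    have hMW : M j ⊆ D ∪ bd G D := by
      refine (hM j).2.2.subset (.inr (hubd j)) fun x y hxy ↦ ?_
      by_cases hy : y ∈ D
      · exact .inl hy
      · exact .inr (mem_bd.2 ⟨hy, x, hxy.2.resolve_right hy, hxy.1⟩)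
    rcases hMW (hIM j hv) with h | h
    · exact h
    · rw [hZ, Finset.mem_coe, Finset.mem_union] at h
      rcases h with h | h
      · exact (huI j (eq_rep_of_mem hMd huM (fun i ↦ (hM i).1) hZ₁n h (hIM j hv) ▸ hv)).elim
      · exact (hwI j (eq_rep_of_mem hMd hwM (fun i ↦ (hM i).2.1) hZ₂n h (hIM j hv) ▸ hv)).elim
  have hget : ∀ {s t : ℕ} {x : α}, P[s]? = some x → P[t]? = some x → s = t := by
    intro s t x hs ht
    obtain ⟨hs', -⟩ := List.getElem?_eq_some_iff.1 hs
    exact (List.getElem?_inj hs' hP.nodup).1 (hs.trans ht.symm)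
  have hqP : ∀ i, q i < P.length := fun i ↦ (List.getElem?_eq_some_iff.1 (hL i).1).1
  have hLA : ∀ i, z i ∈ {x | P[q i]? = some x ∨ ∃ i', q i' = q i ∧ x ∈ L i'} := fun i ↦
    .inr ⟨i, rfl, hzL i⟩
  refine ⟨P.length, fun t ↦ {x | P[t]? = some x ∨ ∃ i, q i = t ∧ x ∈ L i}, I,
    fun j ↦ q (e₁ (la j)), fun j ↦ q (e₂ (lb j)), ?_, ?_, ?_, ?_, ?_, ?_, ?_, ?_, ?_, ?_, ?_, ?_⟩
  · intro t ht
    by_cases hi : ∃ i, q i = t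
    · obtain ⟨i, rfl⟩ := hi
      convert ((hL i).2.2.1.mono outside_le).isConn using 1
      ext x
      constructor
      · rintro (hx | ⟨i', hi', hx⟩)
        · rw [(hL i).1] at hx
          obtain rfl := Option.some_injective _ hx
          exact (hL i).2.2.1.left_mem
        · rwa [← hq.injective hi']
      · exact fun hx ↦ .inr ⟨i, rfl, hx⟩
    · convert isConn_singleton (G := G) P[t] using 1
      ext x
      constructor
      · rintro (hx | ⟨i, hi', -⟩)
        · rw [List.getElem?_eq_getElem ht] at hx
          exact (Option.some_injective _ hx).symm
        · exact (hi ⟨i, hi'⟩).elim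
      · rintro rfl
        exact .inl (List.getElem?_eq_getElem ht)
  · intro t ht
    exact ⟨P[t], .inl (List.getElem?_eq_getElem _), P[t + 1], .inl (List.getElem?_eq_getElem _),
      List.isChain_iff_getElem.1 hP.chain t ht⟩
  · intro s t hs ht hst
    rw [Set.disjoint_left]
    rintro x (hx | ⟨i, rfl, hx⟩) (hx' | ⟨j, rfl, hx'⟩)
    · exact hst (hget hx hx')
    · have := (hL j).2.2.2 x hx' (List.mem_of_getElem? hx)
      exact hst (hget hx (this ▸ (hL j).1))
    · have := (hL i).2.2.2 x hx (List.mem_of_getElem? hx')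
      exact hst (hget (this ▸ (hL i).1) hx')
    · exact hst (congrArg q (eq_of_mem_of_mem hLd hx hx'))
  · exact fun j ↦ ((hI j).mono touching_le).isConn
  · exact fun i j hij ↦ (hMd hij).mono (hIM i) (hIM j)
  · intro j t ht
    rw [Set.disjoint_left]
    rintro x hx (hx' | ⟨i, -, hx'⟩)
    · exact hPD x (List.mem_of_getElem? hx') (hID j hx)
    · exact hLD i hx' (hID j hx)
  · intro i j hij
    have h1 : e₁ (la i) = e₁ (la j) := hq.injective hij
    refine eq_of_mem_of_mem hMd (huM i) ?_
    rw [← hla, h1, hla]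
    exact huM j
  · intro i j hij
    have h1 : e₂ (lb i) = e₂ (lb j) := hq.injective hij
    refine eq_of_mem_of_mem hMd (hwM i) ?_
    rw [← hlb, h1, hlb]
    exact hwM j
  · exact fun i j ↦ hq (he _ _)
  · exact fun j ↦ hqP _
  · exact fun j ↦ ⟨u j, hla j ▸ hLA _, c j, (hI j).left_mem, (huc j).1⟩
  · exact fun j ↦ ⟨w j, hlb j ▸ hLA _, d j, (hI j).right_mem, (hdw j).1.symm⟩

end Haven

/-! ### From ladders to disjoint models -/

/-- The **Erdős–Szekeres theorem** for a finite set carrying two injective rankings. -/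
theorem exists_agree_or_disagree {ι : Type*} {a b : ι → ℕ} (ha : Function.Injective a)
    (hb : Function.Injective b) (p q : ℕ) (s : Finset ι) (hs : p * q < s.card) :
    (∃ t ⊆ s, t.card = p + 1 ∧ ∀ u ∈ t, ∀ v ∈ t, a u < a v → b u < b v) ∨
      ∃ t ⊆ s, t.card = q + 1 ∧ ∀ u ∈ t, ∀ v ∈ t, a u < a v → b v < b u := by
  classical
  induction p generalizing s with
  | zero =>
    obtain ⟨v, hv⟩ := Finset.card_pos.1 (by omega : 0 < s.card)
    refine .inl ⟨{v}, by simpa using hv, by simp, ?_⟩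
    simp
  | succ p ih =>
    let m := s.filter fun v ↦ ∀ u ∈ s, a u < a v → b v < b u
    have hms : m ⊆ s := Finset.filter_subset _ _
    by_cases hm : q + 1 ≤ m.card
    · obtain ⟨t, htm, ht⟩ := Finset.exists_subset_card_eq hm
      exact .inr ⟨t, htm.trans hms, ht, fun u hu v hv huv ↦
        (Finset.mem_filter.1 (htm hv)).2 u (hms (htm hu)) huv⟩
    · have hcard : (s \ m).card = s.card - m.card := Finset.card_sdiff_of_subset hms
      obtain ⟨t, hts, ht, hab⟩ | ⟨t, hts, ht, hab⟩ := ih (s \ m) (by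
        rw [hcard]; have : (p + 1) * q = p * q + q := by ring
        omega)
      · obtain ⟨v, hv, hmin⟩ := t.exists_min_image a (Finset.card_pos.1 (by omega))
        have hvs := Finset.mem_sdiff.1 (hts hv)
        obtain ⟨u, hu, huv, hbu⟩ : ∃ u ∈ s, a u < a v ∧ ¬ b v < b u := by
          by_contra! hc
          exact hvs.2 (Finset.mem_filter.2 ⟨hvs.1, hc⟩)
        have hbuv : b u < b v :=
          lt_of_le_of_ne (not_lt.1 hbu) fun h ↦ huv.ne (congrArg a (hb h))
        have hut : u ∉ t := fun h ↦ (hmin u h).not_gt huv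
        refine .inl ⟨insert u t, Finset.insert_subset hu (hts.trans Finset.sdiff_subset),
          by rw [Finset.card_insert_of_notMem hut, ht], fun x hx y hy hxy ↦ ?_⟩
        rcases Finset.mem_insert.1 hx with rfl | hxt <;>
          rcases Finset.mem_insert.1 hy with rfl | hyt
        · exact absurd hxy (lt_irrefl _)
        · rcases (hmin y hyt).lt_or_eq with h | h
          · exact hbuv.trans (hab v hv y hyt h)
          · exact ha h ▸ hbuv
        · have := hmin x hxt
          omega
        · exact hab x hxt y hyt hxy
      · exact .inr ⟨t, hts.trans Finset.sdiff_subset, ht, hab⟩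

theorem exists_strictMono_and {n N : ℕ} {a b : Fin n → ℕ} (ha : Function.Injective a)
    (hb : Function.Injective b) (hN : N ^ 2 ≤ n) :
    ∃ g : Fin N → Fin n, StrictMono (a ∘ g) ∧ (StrictMono (b ∘ g) ∨ StrictAnti (b ∘ g)) := by
  classical
  obtain _ | p := N
  · exact ⟨Fin.elim0, fun i ↦ i.elim0, .inl fun i ↦ i.elim0⟩
  have sort : ∀ t : Finset (Fin n), t.card = p + 1 →
      ∃ g : Fin (p + 1) → Fin n, StrictMono (a ∘ g) ∧ ∀ i, g i ∈ t := by
    intro t ht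
    have hc : (t.image a).card = p + 1 := by rw [Finset.card_image_of_injective _ ha, ht]
    have := fun i ↦ Finset.mem_image.1 ((t.image a).orderEmbOfFin_mem hc i)
    choose g hgt hg using this
    exact ⟨g, fun i j hij ↦ by simpa [hg] using hij, hgt⟩
  obtain ⟨t, -, ht, hab⟩ | ⟨t, -, ht, hab⟩ :=
    exists_agree_or_disagree ha hb p p Finset.univ (by simp; nlinarith)
  all_goals obtain ⟨g, hg, hgt⟩ := sort t ht
  · exact ⟨g, hg, .inl fun i j hij ↦ hab _ (hgt i) _ (hgt j) (hg hij)⟩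
  · exact ⟨g, hg, .inr fun i j hij ↦ hab _ (hgt i) _ (hgt j) (hg hij)⟩

/-- The values of a strictly monotone or antitone function on consecutive blocks of length `r`
span pairwise disjoint intervals. -/
theorem exists_blocks {K r : ℕ} (hr : 1 ≤ r) {f : Fin (K * r) → ℕ}
    (hf : StrictMono f ∨ StrictAnti f) :
    ∃ lo hi : Fin K → Fin (K * r),
      (∀ m j, f (finProdFinEquiv (m, j)) ∈ Set.Icc (f (lo m)) (f (hi m))) ∧
      ∀ m m', m ≠ m' →
        Disjoint (Set.Icc (f (lo m)) (f (hi m))) (Set.Icc (f (lo m')) (f (hi m'))) := by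
  have hlt : ∀ (m m' : Fin K) (j j' : Fin r), m < m' →
      finProdFinEquiv (m, j) < finProdFinEquiv (m', j') := by
    intro m m' j j' h
    rw [Fin.lt_def]
    simp only [finProdFinEquiv_apply_val]
    have : r * (m + 1 : ℕ) ≤ r * m' := Nat.mul_le_mul_left r h
    have := j.2
    rw [mul_add] at *
    omega
  have hle : ∀ (m : Fin K) (j j' : Fin r), j ≤ j' →
      finProdFinEquiv (m, j) ≤ finProdFinEquiv (m, j') := by
    intro m j j' h
    rw [Fin.le_def]
    simpa using h
  have hdisj : ∀ F G : Fin K → ℕ, (∀ m m', m ≠ m' → G m < F m' ∨ G m' < F m) →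
      ∀ m m', m ≠ m' → Disjoint (Set.Icc (F m) (G m)) (Set.Icc (F m') (G m')) := by
    intro F G h m m' hm
    rw [Set.disjoint_left]
    rintro t ⟨h1, h2⟩ ⟨h3, h4⟩
    have := h m m' hm
    omega
  let first : Fin r := ⟨0, hr⟩
  let last : Fin r := ⟨r - 1, by omega⟩
  have hfirst : ∀ j, first ≤ j := fun j ↦ Fin.le_def.2 (Nat.zero_le _)
  have hlast : ∀ j, j ≤ last := fun j ↦ Fin.le_def.2 (by have := j.2; simp only [last]; omega)
  rcases hf with hf | hf
  · refine ⟨fun m ↦ finProdFinEquiv (m, first), fun m ↦ finProdFinEquiv (m, last),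
      fun m j ↦ ⟨hf.monotone (hle _ _ _ (hfirst j)), hf.monotone (hle _ _ _ (hlast j))⟩,
      hdisj _ _ fun m m' hm ↦ ?_⟩
    exact hm.lt_or_gt.imp (fun h ↦ hf (hlt _ _ _ _ h)) fun h ↦ hf (hlt _ _ _ _ h)
  · refine ⟨fun m ↦ finProdFinEquiv (m, last), fun m ↦ finProdFinEquiv (m, first),
      fun m j ↦ ⟨hf.antitone (hle _ _ _ (hlast j)), hf.antitone (hle _ _ _ (hfirst j))⟩,
      hdisj _ _ fun m m' hm ↦ ?_⟩
    exact hm.lt_or_gt.symm.imp (fun h ↦ hf (hlt _ _ _ _ h)) fun h ↦ hf (hlt _ _ _ _ h)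

theorem isConn_biUnion_Icc {A : ℕ → Set α} {l s t : ℕ} (hA : ∀ t < l, IsConn G (A t))
    (hadj : ∀ t, t + 1 < l → ∃ u ∈ A t, ∃ v ∈ A (t + 1), G.Adj u v) (hst : s ≤ t) (ht : t < l) :
    IsConn G (⋃ i ∈ Set.Icc s t, A i) := by
  induction t, hst using Nat.le_induction with
  | base => simpa using hA s ht
  | succ t hst ih =>
    obtain ⟨u, hu, v, hv, huv⟩ := hadj t ht
    have : Set.Icc s (t + 1) = Set.Icc s t ∪ {t + 1} := by
      ext i; simp only [Set.mem_Icc, Set.mem_union, Set.mem_singleton_iff]; omega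
    rw [this, Set.biUnion_union, Set.biUnion_singleton]
    exact (ih (by omega)).union_of_adj (hA _ ht)
      (Set.mem_biUnion (Set.right_mem_Icc.2 hst) hu) hv huv

theorem IsLadder.disjoint_biUnion {l n : ℕ} {A : ℕ → Set α} {R : Fin n → Set α}
    {a b : Fin n → ℕ} (h : IsLadder G l A R a b) {s t s' t' : ℕ} (ht : t < l) (ht' : t' < l)
    (hd : Disjoint (Set.Icc s t) (Set.Icc s' t')) :
    Disjoint (⋃ i ∈ Set.Icc s t, A i) (⋃ i ∈ Set.Icc s' t', A i) := by
  simp only [Set.disjoint_iUnion_left, Set.disjoint_iUnion_right]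
  exact fun j hj i hi ↦ h.atom_disj i j (hi.2.trans_lt ht) (hj.2.trans_lt ht')
    fun hij ↦ Set.disjoint_left.1 hd hi (hij ▸ hj)

theorem IsLadder.hasDisjointModels {l n K r : ℕ} {A : ℕ → Set α} {R : Fin n → Set α}
    {a b : Fin n → ℕ} (h : IsLadder G l A R a b) (hr : 1 ≤ r) (hn : (K * r) ^ 2 ≤ n) :
    HasDisjointModels (completeBipartiteGraph (Fin 2) (Fin r)) G K := by
  obtain ⟨g, hga, hgb⟩ := exists_strictMono_and h.a_inj h.b_inj hn
  have hg : Function.Injective g := hga.injective.of_comp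
  obtain ⟨lo, hi, hmem, hdisj⟩ := exists_blocks hr (.inl hga)
  obtain ⟨lo', hi', hmem', hdisj'⟩ := exists_blocks hr hgb
  simp only [Function.comp_apply] at hmem hmem' hdisj hdisj'
  have hal : ∀ j, a j < l := fun j ↦ (h.a_lt_b j j).trans (h.b_lt j)
  let left : Fin K → Set α := fun m ↦ ⋃ i ∈ Set.Icc (a (g (lo m))) (a (g (hi m))), A i
  let right : Fin K → Set α := fun m ↦ ⋃ i ∈ Set.Icc (b (g (lo' m))) (b (g (hi' m))), A i
  let mid : Fin K → Fin r → Set α := fun m j ↦ R (g (finProdFinEquiv (m, j)))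
  have hll : ∀ m m', m ≠ m' → Disjoint (left m) (left m') := fun m m' hm ↦
    h.disjoint_biUnion (hal _) (hal _) (hdisj m m' hm)
  have hrr : ∀ m m', m ≠ m' → Disjoint (right m) (right m') := fun m m' hm ↦
    h.disjoint_biUnion (h.b_lt _) (h.b_lt _) (hdisj' m m' hm)
  have hlr : ∀ m m', Disjoint (left m) (right m') := fun m m' ↦
    h.disjoint_biUnion (hal _) (h.b_lt _) <| Set.disjoint_left.2 fun t ht ht' ↦
      ((ht.2.trans_lt (h.a_lt_b _ _)).trans_le ht'.1).false
  have hlm : ∀ m m' j, Disjoint (left m) (mid m' j) := fun m m' j ↦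
    Set.disjoint_iUnion₂_left.2 fun i hi ↦ (h.rung_atom _ i (hi.2.trans_lt (hal _))).symm
  have hrm : ∀ m m' j, Disjoint (right m) (mid m' j) := fun m m' j ↦
    Set.disjoint_iUnion₂_left.2 fun i hi ↦ (h.rung_atom _ i (hi.2.trans_lt (h.b_lt _))).symm
  have hmm : ∀ m m' j j', (m, j) ≠ (m', j') → Disjoint (mid m j) (mid m' j') :=
    fun m m' j j' hne ↦ h.rung_disj fun he ↦ hne (finProdFinEquiv.injective (hg he))
  let M : Fin K → Fin 2 ⊕ Fin r → Set α := fun m ↦ Sum.elim ![left m, right m] (mid m)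
  have hM : ∀ m m' x y, (m, x) ≠ (m', y) → Disjoint (M m x) (M m' y) := by
    rintro m m' (i | j) (i' | j') hne
    · fin_cases i <;> fin_cases i'
      · exact hll m m' (by simpa using hne)
      · exact hlr m m'
      · exact (hlr m' m).symm
      · exact hrr m m' (by simpa using hne)
    · fin_cases i
      exacts [hlm _ _ _, hrm _ _ _]
    · fin_cases i'
      exacts [(hlm _ _ _).symm, (hrm _ _ _).symm]
    · exact hmm m m' j j' (by simpa using hne)
  have hadj : ∀ m i j, ∃ u ∈ M m (.inl i), ∃ v ∈ M m (.inr j), G.Adj u v := by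
    intro m i j
    fin_cases i
    · obtain ⟨u, hu, v, hv, huv⟩ := h.a_adj (g (finProdFinEquiv (m, j)))
      exact ⟨u, Set.mem_biUnion (hmem m j) hu, v, hv, huv⟩
    · obtain ⟨u, hu, v, hv, huv⟩ := h.b_adj (g (finProdFinEquiv (m, j)))
      exact ⟨u, Set.mem_biUnion (hmem' m j) hu, v, hv, huv⟩
  refine ⟨M, fun m ↦ ⟨?_, fun x y hxy ↦ hM m m x y (by simpa using hxy), ?_⟩, fun m m' hm ↦ ?_⟩
  · rintro (i | j)
    · refine isConn_iff.1 ?_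
      have first : Fin r := ⟨0, hr⟩
      fin_cases i
      · exact isConn_biUnion_Icc h.atom_conn h.atom_adj
          ((hmem m first).1.trans (hmem m first).2) (hal _)
      · exact isConn_biUnion_Icc h.atom_conn h.atom_adj
          ((hmem' m first).1.trans (hmem' m first).2) (h.b_lt _)
    · exact isConn_iff.1 (h.rung_conn _)
  · rintro (i | j) (i' | j') hxy
    · simp at hxy
    · exact hadj m i j'
    · obtain ⟨u, hu, v, hv, huv⟩ := hadj m i' j
      exact ⟨v, hv, u, hu, huv.symm⟩
    · simp at hxy
  · simp only [Set.disjoint_iUnion_left, Set.disjoint_iUnion_right]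
    exact fun _ _ ↦ hM _ _ _ _ (by simp [hm])

/-! ### Packing and covering -/

section Packing

variable {H : SimpleGraph β} {k m n p : ℕ} {B : β → Set α}

theorem IsMinorModel.isConn_iUnion (hB : IsMinorModel H G B) (hH : H.Connected) :
    IsConn G (⋃ u, B u) := by
  have hconn : ∀ u, IsConn G (B u) := fun u ↦ isConn_iff.2 (hB.1 u)
  obtain ⟨u₀⟩ := hH.nonempty
  refine ⟨(hconn u₀).nonempty.mono (Set.subset_iUnion B u₀), ?_⟩
  rintro S ⟨a, haB, haS⟩ hS
  have sub : ∀ u, (B u ∩ S).Nonempty → B u ⊆ S := fun u hu ↦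
    (hconn u).2 S hu fun x hx hxS y hy ↦
      hS x (Set.mem_iUnion_of_mem u hx) hxS y (Set.mem_iUnion_of_mem u hy)
  obtain ⟨u, hau⟩ := Set.mem_iUnion.1 haB
  refine Set.iUnion_subset fun w ↦ ?_
  have hr := (reachable_iff_reflTransGen _ _).1 (hH.preconnected u w)
  induction hr with
  | refl => exact sub u ⟨a, hau, haS⟩
  | @tail v w _ hvw ih =>
    obtain ⟨x, hx, y, hy, hxy⟩ := hB.2.2 v w hvw
    exact sub w ⟨y, hy, hS x (Set.mem_iUnion_of_mem v hx) (ih hx) y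
      (Set.mem_iUnion_of_mem w hy) hxy⟩

theorem isMinorModel_mono (hB : IsMinorModel H G B) (hG : G ≤ G') : IsMinorModel H G' B :=
  ⟨fun u ↦ isConn_iff.1 ((isConn_iff.2 (hB.1 u)).mono hG), hB.2.1, fun u v huv ↦
    let ⟨a, ha, b, hb, hab⟩ := hB.2.2 u v huv
    ⟨a, ha, b, hb, hG hab⟩⟩

/-- The edges of `G` with both ends in `D`. -/
def inside (G : SimpleGraph α) (D : Set α) : SimpleGraph α where
  Adj u v := G.Adj u v ∧ u ∈ D ∧ v ∈ D
  symm := ⟨fun _ _ h ↦ ⟨h.1.symm, h.2.2, h.2.1⟩⟩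
  loopless := ⟨fun _ h ↦ h.1.ne rfl⟩

theorem inside_le : inside G D ≤ G := fun _ _ h ↦ h.1

theorem isMinorModel_inside_iff (hH : H.Connected) [Nontrivial β] :
    IsMinorModel H (inside G D) B ↔ IsMinorModel H G B ∧ ∀ u, B u ⊆ D := by
  constructor
  · refine fun hB ↦ ⟨isMinorModel_mono hB inside_le, fun u ↦ ?_⟩
    obtain ⟨v, huv⟩ := hH.preconnected.exists_adj_of_nontrivial u
    obtain ⟨a, ha, b, -, hab⟩ := hB.2.2 u v huv
    exact (isConn_iff.2 (hB.1 u)).2 D ⟨a, ha, hab.2.1⟩ fun x _ _ y _ hxy ↦ hxy.2.2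
  · rintro ⟨hB, hD⟩
    refine ⟨fun u ↦ isConn_iff.1 ?_, hB.2.1, fun u v huv ↦ ?_⟩
    · have := isConn_iff.2 (hB.1 u)
      exact ⟨this.1, fun S hS hc ↦ this.2 S hS fun x hx hxS y hy hxy ↦
        hc x hx hxS y hy ⟨hxy, hD u hx, hD u hy⟩⟩
    · obtain ⟨a, ha, b, hb, hab⟩ := hB.2.2 u v huv
      exact ⟨a, ha, b, hb, hab, hD u ha, hD v hb⟩

theorem hasDisjointModels_zero : HasDisjointModels H G 0 :=
  ⟨fun i ↦ i.elim0, fun i ↦ i.elim0, fun i ↦ i.elim0⟩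

theorem hasDisjointModels_of_le (h : HasDisjointModels H G n) (hmn : m ≤ n) :
    HasDisjointModels H G m := by
  obtain ⟨M, hM, hd⟩ := h
  exact ⟨fun i ↦ M (i.castLE hmn), fun i ↦ hM _, fun i j hij ↦
    hd fun h ↦ hij (Fin.castLE_injective hmn h)⟩

theorem hasDisjointModels_mono (h : HasDisjointModels H G n) (hG : G ≤ G') :
    HasDisjointModels H G' n :=
  let ⟨M, hM, hd⟩ := h
  ⟨M, fun i ↦ isMinorModel_mono (hM i) hG, hd⟩

theorem inside_mono (h : A ⊆ D) : inside G A ≤ inside G D :=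
  fun _ _ huv ↦ ⟨huv.1, h huv.2.1, h huv.2.2⟩

theorem hasDisjointModels_add (hH : H.Connected) [Nontrivial β] (hAD : Disjoint A D)
    (hA : HasDisjointModels H (inside G A) m) (hD : HasDisjointModels H (inside G D) n) :
    HasDisjointModels H (inside G (A ∪ D)) (m + n) := by
  obtain ⟨M, hM, hMd⟩ := hA
  obtain ⟨N, hN, hNd⟩ := hD
  have hMN : ∀ i j, Disjoint (⋃ u, M i u) (⋃ u, N j u) := fun i j ↦
    hAD.mono (Set.iUnion_subset ((isMinorModel_inside_iff hH).1 (hM i)).2)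
      (Set.iUnion_subset ((isMinorModel_inside_iff hH).1 (hN j)).2)
  refine ⟨Fin.append M N, fun i ↦ ?_, fun i j hij ↦ ?_⟩
  · induction i using Fin.addCases with
    | left i => simpa using isMinorModel_mono (hM i) (inside_mono Set.subset_union_left)
    | right i => simpa using isMinorModel_mono (hN i) (inside_mono Set.subset_union_right)
  · induction i using Fin.addCases with
    | left i =>
      induction j using Fin.addCases with
      | left j => simpa using hMd fun h ↦ hij (congrArg _ h)
      | right j => simpa using hMN i j
    | right i =>
      induction j using Fin.addCases with
      | left j => simpa using (hMN j i).symm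
      | right j => simpa using hNd fun h ↦ hij (congrArg _ h)

/-- If every connected set avoiding `X` packs few models of `H`, then the sets covering these
components combine to a set covering the part of `G` off `X`. -/
theorem exists_hittingSet_inside [Finite α] (hH : H.Connected) [Nontrivial β] {c : ℕ} {X : Set α}
    (hk : 1 ≤ k)
    (ih : ∀ p < k, ∀ G' : SimpleGraph α, ¬ HasDisjointModels H G' (p + 1) →
      ∃ S : Finset α, S.card ≤ 2 * c * p ^ 2 ∧ IsHittingSet H G' S)
    (hX : ∀ D, IsConn G D → (∀ v ∈ X, v ∉ D) → ∀ p, HasDisjointModels H (inside G D) p → 2 * p ≤ k)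
    (U : Set α) (m : ℕ) (hUX : ∀ v ∈ U, v ∉ X) (hU : ∀ u ∈ U, ∀ v, G.Adj u v → v ∉ X → v ∈ U)
    (hm : ¬ HasDisjointModels H (inside G U) (m + 1)) :
    ∃ S : Finset α, S.card ≤ c * k * m ∧ IsHittingSet H (inside G U) S := by
  classical
  induction hn : U.ncard using Nat.strong_induction_on generalizing U m with
  | _ n ihU =>
  obtain rfl | ⟨v, hv⟩ := U.eq_empty_or_nonempty
  · refine ⟨∅, by simp, fun B hB ↦ ?_⟩
    obtain ⟨a, ha⟩ := (IsMinorModel.isConn_iUnion hB hH).nonempty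
    obtain ⟨u, hu⟩ := Set.mem_iUnion.1 ha
    exact (((isMinorModel_inside_iff hH).1 hB).2 u hu).elim
  let D : Set α := {w | Reach G X {v} w}
  have hvD : v ∈ D := .base rfl (hUX v hv)
  have hDU : D ⊆ U := by
    intro w hw
    induction hw with
    | base h _ => exact h ▸ hv
    | step _ huw hwX ih => exact hU _ ih _ huw hwX
  have hDX : ∀ w ∈ X, w ∉ D := fun w hw hwD ↦ hUX w (hDU hwD) hw
  have hD : IsConn G D := isConn_reach (isConn_singleton v) (by rintro _ rfl; exact hUX _ hv)
  obtain ⟨p, hp, hp'⟩ : ∃ p, HasDisjointModels H (inside G D) p ∧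
      ¬ HasDisjointModels H (inside G D) (p + 1) := by
    by_contra! hc
    have : ∀ p, HasDisjointModels H (inside G D) p := fun p ↦ by
      induction p with
      | zero => exact hasDisjointModels_zero
      | succ p ih => exact hc p ih
    exact hm (hasDisjointModels_mono (this _) (inside_mono hDU))
  have hpk := hX D hD hDX p hp
  have hpm : p ≤ m := by
    by_contra! h
    exact hm (hasDisjointModels_of_le (hasDisjointModels_mono hp (inside_mono hDU)) h)
  obtain ⟨S, hS, hSD⟩ := ih p (by omega) _ hp'
  obtain ⟨T, hT, hTU⟩ := ihU (U \ D).ncard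
    (hn ▸ Set.ncard_lt_ncard ⟨Set.sdiff_subset, fun h ↦ (h hv).2 hvD⟩ (Set.toFinite U))
    (U \ D) (m - p) (fun w hw ↦ hUX w hw.1)
    (fun u hu w huw hwX ↦ ⟨hU u hu.1 w huw hwX,
      fun hwD ↦ hu.2 (Reach.step hwD huw.symm (hUX u hu.1))⟩)
    (fun h ↦ hm (by
      have := hasDisjointModels_add hH Set.disjoint_sdiff_right hp h
      rwa [Set.union_sdiff_cancel hDU, show p + (m - p + 1) = m + 1 by omega] at this)) rfl
  refine ⟨S ∪ T, ?_, fun B hB ↦ ?_⟩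
  · obtain ⟨q, rfl⟩ := Nat.exists_eq_add_of_le hpm
    rw [Nat.add_sub_cancel_left] at hT
    refine (Finset.card_union_le S T).trans ?_
    have : c * p * (2 * p) ≤ c * p * k := Nat.mul_le_mul_left _ hpk
    nlinarith
  · obtain ⟨hBG, hBU⟩ := (isMinorModel_inside_iff hH).1 hB
    have hconn := IsMinorModel.isConn_iUnion hBG hH
    by_cases hBD : ((⋃ u, B u) ∩ D).Nonempty
    · have hsub := hconn.2 D hBD fun u _ huD w hw huw ↦
        Reach.step huD huw (hUX w (Set.iUnion_subset hBU hw))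
      obtain ⟨a, ha, hau⟩ := hSD B ((isMinorModel_inside_iff hH).2
        ⟨hBG, fun u ↦ (Set.subset_iUnion B u).trans hsub⟩)
      exact ⟨a, by simpa using Or.inl ha, hau⟩
    · obtain ⟨a, ha, hau⟩ := hTU B ((isMinorModel_inside_iff hH).2
        ⟨hBG, fun u w hw ↦ ⟨hBU u hw, fun hwD ↦ hBD ⟨w, Set.mem_iUnion_of_mem u hw, hwD⟩⟩⟩)
      exact ⟨a, by simpa using Or.inr ha, hau⟩

/-- If every haven of order `c * k ^ 2` forces `k + 1` disjoint models of `H`, then `H` has the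
Erdős–Pósa property with gap `2 * c * k ^ 2`. -/
theorem exists_hittingSet [Fintype α] (hH : H.Connected) [Nontrivial β] {c : ℕ}
    (hc : ∀ (G : SimpleGraph α) (k : ℕ) (ℋ : Set α → Prop), 1 ≤ k →
      IsHaven G (c * k ^ 2) ℋ → HasDisjointModels H G (k + 1))
    (k : ℕ) (G : SimpleGraph α) (hG : ¬ HasDisjointModels H G (k + 1)) :
    ∃ S : Finset α, S.card ≤ 2 * c * k ^ 2 ∧ IsHittingSet H G S := by
  classical
  induction k using Nat.strong_induction_on generalizing G with
  | _ k ih =>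
  obtain rfl | hk := k.eq_zero_or_pos
  · refine ⟨∅, by simp, fun B hB ↦ (hG ⟨fun _ ↦ B, fun _ ↦ hB, fun i j hij ↦ ?_⟩).elim⟩
    exact (hij (by omega)).elim
  let Big : Set α → Prop := fun D ↦
    IsConn G D ∧ ∃ m, k < 2 * m ∧ HasDisjointModels H (inside G D) m
  obtain ⟨X, hXc, hX⟩ : ∃ X : Finset α, X.card ≤ c * k ^ 2 ∧ ∀ D, Big D → ∃ v ∈ X, v ∈ D := by
    by_contra! hav
    refine hG (hc G k Big hk ⟨fun D hD ↦ hD.1, ?_, ?_, hav⟩)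
    · rintro D D' ⟨-, m, hm, hD⟩ ⟨-, m', hm', hD'⟩
      by_contra hne
      have hdis : Disjoint D D' :=
        Set.disjoint_iff_inter_eq_empty.2 (Set.not_nonempty_iff_eq_empty.1 hne)
      exact hG (hasDisjointModels_of_le (hasDisjointModels_mono
        (hasDisjointModels_add hH hdis hD hD') inside_le) (by omega))
    · rintro D D' ⟨-, m, hm, hD⟩ hD' hDD'
      exact ⟨hD', m, hm, hasDisjointModels_mono hD (inside_mono hDD')⟩
  obtain ⟨S, hS, hSX⟩ := exists_hittingSet_inside (X := (X : Set α)) hH hk ih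
    (fun D hD hDX p hp ↦ by
      by_contra! h
      obtain ⟨v, hv, hvD⟩ := hX D ⟨hD, p, h, hp⟩
      exact hDX v hv hvD) (X : Set α)ᶜ k (fun _ h ↦ h) (fun _ _ _ _ h ↦ h)
    fun h ↦ hG (hasDisjointModels_mono h inside_le)
  refine ⟨S ∪ X, (Finset.card_union_le S X).trans (by nlinarith), fun B hB ↦ ?_⟩
  by_cases h : ∀ u, B u ⊆ (X : Set α)ᶜ
  · obtain ⟨a, ha, hau⟩ := hSX B ((isMinorModel_inside_iff hH).2 ⟨hB, h⟩)
    exact ⟨a, by simpa using Or.inl ha, hau⟩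
  · simp only [not_forall, Set.not_subset, Set.mem_compl_iff, not_not] at h
    obtain ⟨u, a, hau, haX⟩ := h
    exact ⟨a, by simpa using Or.inr haX, u, hau⟩

theorem le_card_of_hasDisjointModels [Fintype α] [Nonempty β] (h : HasDisjointModels H G k) :
    k ≤ Fintype.card α := by
  obtain ⟨M, hM, hd⟩ := h
  let u : β := Classical.arbitrary β
  choose f hf using fun i ↦ (isConn_iff.2 ((hM i).1 u)).nonempty
  have hinj : Function.Injective f := fun i j hij ↦
    eq_of_mem_of_mem hd (Set.mem_iUnion_of_mem u (hf i)) (Set.mem_iUnion_of_mem u (hij ▸ hf j))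
  simpa using Fintype.card_le_of_injective f hinj

theorem not_hasDisjointModels_packNumber_succ [Fintype α] [Nonempty β] :
    ¬ HasDisjointModels H G (packNumber H G + 1) := fun h ↦
  (Nat.lt_succ_self _).not_ge <|
    le_csSup ⟨Fintype.card α, fun _ hk ↦ le_card_of_hasDisjointModels hk⟩ h

theorem coverNumber_le_card {S : Finset α} (hS : IsHittingSet H G S) :
    coverNumber H G ≤ S.card :=
  Nat.sInf_le ⟨S, hS, Set.ncard_coe_finset S⟩

theorem connected_completeBipartiteGraph {V W : Type*} [Nonempty V] [Nonempty W] :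
    (completeBipartiteGraph V W).Connected := by
  have hVW : ∀ v w, (completeBipartiteGraph V W).Reachable (.inl v) (.inr w) := fun v w ↦
    Adj.reachable (by simp)
  have : Nonempty (V ⊕ W) := ⟨.inl (Classical.arbitrary V)⟩
  refine ⟨fun x y ↦ ?_⟩
  rcases x with v | w <;> rcases y with v' | w'
  · exact (hVW v (Classical.arbitrary W)).trans (hVW v' _).symm
  · exact hVW v w'
  · exact (hVW v' w).symm
  · exact (hVW (Classical.arbitrary V) w).symm.trans (hVW _ w')

end Packing

end ErdosPosa

/-- There is a constant `c > 0` such that for every `r ≥ 1` and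
every graph `G`, if `k = pack_{K_{2,r}}(G)` then `cover_{K_{2,r}}(G) ≤ c · r² · k²`. -/
theorem erdos_posa_K2r :
    ∃ C : ℝ, 0 < C ∧
      ∀ (r : ℕ), 1 ≤ r →
        ∀ (α : Type) [Fintype α], ∀ (G : SimpleGraph α),
          (coverNumber (completeBipartiteGraph (Fin 2) (Fin r)) G : ℝ) ≤
            C * (r : ℝ) ^ 2 *
              (packNumber (completeBipartiteGraph (Fin 2) (Fin r)) G : ℝ) ^ 2 := by
  refine ⟨24, by norm_num, fun r hr α _ G ↦ ?_⟩
  have : Nonempty (Fin r) := ⟨⟨0, hr⟩⟩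
  have : Nontrivial (Fin 2 ⊕ Fin r) := Sum.inl_injective.nontrivial
  set H := completeBipartiteGraph (Fin 2) (Fin r)
  have haven : ∀ (G : SimpleGraph α) (k : ℕ) (ℋ : Set α → Prop), 1 ≤ k →
      ErdosPosa.IsHaven G (12 * r ^ 2 * k ^ 2) ℋ → HasDisjointModels H G (k + 1) := by
    intro G k ℋ hk h
    have hle : 3 * ((k + 1) * r) ^ 2 ≤ 12 * r ^ 2 * k ^ 2 := calc
      3 * ((k + 1) * r) ^ 2 ≤ 3 * (2 * k * r) ^ 2 := by gcongr; omega
      _ = 12 * r ^ 2 * k ^ 2 := by ring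
    obtain ⟨l, A, R, a, b, hladder⟩ := h.exists_isLadder hle
    exact hladder.hasDisjointModels hr le_rfl
  obtain ⟨S, hS, hSG⟩ := ErdosPosa.exists_hittingSet
    ErdosPosa.connected_completeBipartiteGraph haven (packNumber H G) G
    ErdosPosa.not_hasDisjointModels_packNumber_succ
  have := (ErdosPosa.coverNumber_le_card hSG).trans hS
  calc (coverNumber H G : ℝ) ≤ (2 * (12 * r ^ 2) * packNumber H G ^ 2 : ℕ) := by exact_mod_cast this
    _ = 24 * (r : ℝ) ^ 2 * (packNumber H G : ℝ) ^ 2 := by push_cast; ring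
end
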